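/- Assume the Continuum Hypothesis, i.e. 2^ℵ₀ = ℵ₁. Then the Calkin algebra Q(H) of a separable infinite-dimensional complex Hilbert space H is a 2^ℵ₀-universal C*-algebra: its density character equals 2^ℵ₀, and every C*-algebra of density character at most 2^ℵ₀ admits an injective *-homomorphism into Q(H). -/

import Mathlib

open Cardinal

/-- The density character of a metric (topological) space: the smallest cardinality of a
dense subset. -/
noncomputable def densityCharacter (X : Type*) [TopologicalSpace X] : Cardinal :=
  sInf {c : Cardinal | ∃ s : Set X, Dense s ∧ #s = c}

section part1
open Filter Topology

lemma ckPowComm {R : Type*} [NormedRing R] [NormOneClass R] (y b : R) (n : ℕ) :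
    ‖y ^ (n + 1) * b - b * y ^ (n + 1)‖ ≤ (n + 1) * ‖y‖ ^ n * ‖y * b - b * y‖ := by
  induction n with
  | zero => simp
  | succ n ih =>
    have h : y ^ (n + 1 + 1) * b - b * y ^ (n + 1 + 1)
        = y * (y ^ (n + 1) * b - b * y ^ (n + 1)) + (y * b - b * y) * y ^ (n + 1) := by
      rw [pow_succ' y (n + 1)]; noncomm_ring
    rw [h]
    calc _ ≤ ‖y‖ * ((n + 1) * ‖y‖ ^ n * ‖y * b - b * y‖) + ‖y * b - b * y‖ * ‖y‖ ^ (n + 1) := by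
          refine (norm_add_le _ _).trans (add_le_add ?_ ?_)
          · exact (norm_mul_le _ _).trans (mul_le_mul_of_nonneg_left ih (norm_nonneg _))
          · exact (norm_mul_le _ _).trans
              (mul_le_mul_of_nonneg_left (norm_pow_le _ _) (norm_nonneg _))
      _ = _ := by push_cast; ring

lemma ckExpComm {R : Type*} [NormedRing R] [NormOneClass R] [NormedAlgebra ℂ R] [CompleteSpace R]
    (y b : R) : ‖NormedSpace.exp y * b - b * NormedSpace.exp y‖
      ≤ Real.exp ‖y‖ * ‖y * b - b * y‖ := by
  have h1 := NormedSpace.exp_series_hasSum_exp' (𝕂 := ℂ) y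
  have h2 := (h1.mul_right b).sub (h1.mul_left b)
  rw [← h2.tsum_eq]
  have h3 : HasSum (fun n : ℕ => (‖y‖ ^ n / n.factorial) * ‖y * b - b * y‖)
      (Real.exp ‖y‖ * ‖y * b - b * y‖) := by
    have := (NormedSpace.expSeries_div_hasSum_exp ‖y‖).mul_right ‖y * b - b * y‖
    rwa [← Real.exp_eq_exp_ℝ] at this
  have h4 : HasSum (fun n : ℕ => match n with
      | 0 => (0 : ℝ)
      | (n + 1) => (‖y‖ ^ n / n.factorial) * ‖y * b - b * y‖)
      (Real.exp ‖y‖ * ‖y * b - b * y‖) := by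
    rw [← hasSum_nat_add_iff' 1]
    simpa using h3
  refine tsum_of_norm_bounded h4 ?_
  intro n
  cases n with
  | zero => simp
  | succ n =>
    simp only [smul_mul_assoc, mul_smul_comm, ← smul_sub, norm_smul]
    rw [norm_inv, Complex.norm_natCast, Nat.factorial_succ]
    have := ckPowComm y b n
    have hp : (0 : ℝ) < n.factorial := by exact_mod_cast n.factorial_pos
    calc _ ≤ (((n + 1) * n.factorial : ℕ) : ℝ)⁻¹ * ((n + 1) * ‖y‖ ^ n * ‖y * b - b * y‖) := by
          gcongr
      _ = _ := by push_cast; field_simp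

lemma ckExpEig {R : Type*} [NormedRing R] [NormedAlgebra ℂ R] [CompleteSpace R]
    (y v : R) (l : ℂ) (h : y * v = l • v) :
    NormedSpace.exp y * v = Complex.exp l • v := by
  have h1 := (NormedSpace.exp_series_hasSum_exp' (𝕂 := ℂ) y).mul_right v
  have h2 := (NormedSpace.exp_series_hasSum_exp' (𝕂 := ℂ) l).smul_const v
  rw [← Complex.exp_eq_exp_ℂ] at h2
  have hp : ∀ n : ℕ, y ^ n * v = l ^ n • v := by
    intro n
    induction n with
    | zero => simp
    | succ n ih => rw [pow_succ, mul_assoc, h, mul_smul_comm, ih, smul_smul, pow_succ, mul_comm]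
  have h3 : (fun n : ℕ => ((n.factorial : ℂ)⁻¹ • y ^ n) * v)
      = fun n : ℕ => ((n.factorial : ℂ)⁻¹ • l ^ n) • v := by
    funext n
    rw [smul_mul_assoc, hp, smul_assoc]
  rw [h3] at h1
  exact h1.unique h2

section tri
variable {H : Type*} [NormedAddCommGroup H] [InnerProductSpace ℂ H] [CompleteSpace H]

lemma ckSumSq (p : ℕ → H →L[ℂ] H) (hs : ∀ m, star (p m) = p m)
    (hn : ∀ m n, m ≤ n → p m * p n = p m) (v : H) (N : ℕ) :
    ∑ m ∈ Finset.range N, ‖(p (m + 1) - p m) v‖ ^ 2 ≤ ‖v‖ ^ 2 := by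
  have hn' : ∀ m n, m ≤ n → p n * p m = p m := fun m n h => by
    have := congrArg star (hn m n h)
    simpa [hs] using this
  have sq : ∀ (q : H →L[ℂ] H), star q = q → q * q = q → ‖q v‖ ^ 2 = (inner ℂ (q v) v).re := by
    intro q h1 h2
    have h3 : inner ℂ (q v) (q v) = inner ℂ (q v) v := by
      have h4 := (ContinuousLinearMap.adjoint_inner_left q v (q v)).symm
      rw [← ContinuousLinearMap.star_eq_adjoint, h1] at h4
      rw [h4]
      change inner ℂ ((q * q) v) v = _
      rw [h2]
    rw [← h3]
    exact (inner_self_eq_norm_sq (𝕜 := ℂ) _).symm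
  have tel : ∀ N, ∑ m ∈ Finset.range N, ‖(p (m + 1) - p m) v‖ ^ 2
      = ‖p N v‖ ^ 2 - ‖p 0 v‖ ^ 2 := by
    intro N
    rw [← Finset.sum_range_sub (fun m => ‖p m v‖ ^ 2) N]
    refine Finset.sum_congr rfl fun m _ => ?_
    rw [sq _ (by simp [hs]) _, sq _ (hs _) (hn _ _ le_rfl), sq _ (hs _) (hn _ _ le_rfl)]
    · simp [inner_sub_left]
    · rw [mul_sub, sub_mul, sub_mul, hn _ _ le_rfl, hn _ _ le_rfl, hn _ _ (Nat.le_succ _),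
        hn' _ _ (Nat.le_succ _)]
      simp
  rw [tel]
  have : ‖p N v‖ ≤ ‖v‖ := by
    have h1 := sq _ (hs N) (hn N N le_rfl)
    have h2 : (inner ℂ (p N v) v).re ≤ ‖p N v‖ * ‖v‖ :=
      (Complex.re_le_norm _).trans (norm_inner_le_norm _ _)
    by_contra hc
    push Not at hc
    nlinarith [norm_nonneg v]
  nlinarith [norm_nonneg v, norm_nonneg (p N v), sq_nonneg ‖p 0 v‖]

lemma ckTri (p : ℕ → H →L[ℂ] H) (hs : ∀ m, star (p m) = p m)
    (hn : ∀ m n, m ≤ n → p m * p n = p m) (b : H →L[ℂ] H)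
    (hb : ∀ m, p (m + 1) * (b * p m) = b * p m) (N : ℕ) :
    ‖∑ m ∈ Finset.range N, (1 - p (m + 1)) * b * p (m + 1)‖ ≤ ‖b‖ := by
  have hn' : ∀ m n, m ≤ n → p n * p m = p m := fun m n h => by
    have := congrArg star (hn m n h)
    simpa [hs] using this
  have e : ∀ m, (1 - p (m + 1)) * b * p (m + 1)
      = (p (m + 1 + 1) - p (m + 1)) * b * (p (m + 1) - p m) := by
    intro m
    have h1 := hb m
    have h2 := hb (m + 1)
    have h3 : p (m + 1 + 1) * (b * p m) = b * p m := by
      rw [← h1, ← mul_assoc, hn' _ _ (Nat.le_succ _)]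
    simp only [mul_sub, sub_mul, mul_assoc, h1, h2, h3, one_mul]
    abel
  refine ContinuousLinearMap.opNorm_le_bound _ (norm_nonneg _) fun v => ?_
  have key : ∀ w, ‖inner ℂ w ((∑ m ∈ Finset.range N, (1 - p (m + 1)) * b * p (m + 1)) v)‖
      ≤ ‖b‖ * ‖v‖ * ‖w‖ := by
    intro w
    rw [sum_apply, inner_sum]
    calc _ ≤ ∑ m ∈ Finset.range N, ‖(p (m + 1) - p m) v‖ * ‖(p (m + 1 + 1) - p (m + 1)) w‖ * ‖b‖ := by
          refine (norm_sum_le _ _).trans (Finset.sum_le_sum fun m _ => ?_)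
          rw [e]
          have hq : star (p (m + 1 + 1) - p (m + 1)) = p (m + 1 + 1) - p (m + 1) := by simp [hs]
          change ‖inner ℂ w ((p (m + 1 + 1) - p (m + 1)) (b ((p (m + 1) - p m) v)))‖ ≤ _
          rw [← hq, ContinuousLinearMap.star_eq_adjoint, ContinuousLinearMap.adjoint_inner_right,
            ← ContinuousLinearMap.star_eq_adjoint, hq]
          refine (norm_inner_le_norm _ _).trans ?_
          have := b.le_opNorm ((p (m + 1) - p m) v)
          calc _ ≤ ‖(p (m + 1 + 1) - p (m + 1)) w‖ * (‖b‖ * ‖(p (m + 1) - p m) v‖) := by gcongr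
            _ = _ := by ring
      _ = (∑ m ∈ Finset.range N, ‖(p (m + 1) - p m) v‖ * ‖(p (m + 1 + 1) - p (m + 1)) w‖) * ‖b‖ := by
          rw [Finset.sum_mul]
      _ ≤ (‖v‖ * ‖w‖) * ‖b‖ := by
          gcongr
          refine (Real.sum_mul_le_sqrt_mul_sqrt _ _ _).trans ?_
          have h1 := ckSumSq p hs hn v N
          have h2 := ckSumSq (fun m => p (m + 1)) (fun m => hs _)
            (fun m n h => hn _ _ (by omega)) w N
          gcongr
          · exact Real.sqrt_le_iff.2 ⟨norm_nonneg _, h1⟩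
          · exact Real.sqrt_le_iff.2 ⟨norm_nonneg _, h2⟩
      _ = _ := by ring
  set z := (∑ m ∈ Finset.range N, (1 - p (m + 1)) * b * p (m + 1)) v
  have := key z
  rw [inner_self_eq_norm_sq_to_K] at this
  simp only [norm_pow] at this
  rw [RCLike.norm_ofReal, abs_norm] at this
  by_contra hc
  push Not at hc
  have : 0 ≤ ‖b‖ * ‖v‖ := by positivity
  nlinarith

lemma ckQC0 (G : Finset H) (F : Finset (H →L[ℂ] H)) (ε : ℝ) (hε : 0 < ε) :
    ∃ (k : H →L[ℂ] H) (E : Submodule ℂ H) (_ : FiniteDimensional ℂ E),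
      star k = k ∧ ‖k‖ ≤ 1 ∧ E.starProjection * k = k ∧ (∀ g ∈ G, k g = g) ∧
      ∀ b ∈ F, ‖k * b - b * k‖ ≤ ε := by
  classical
  let nx : Submodule ℂ H → Submodule ℂ H := fun E => E ⊔ Submodule.span ℂ (G : Set H) ⊔
    F.sup fun b => E.map (b : H →ₗ[ℂ] H) ⊔ E.map ((star b : H →L[ℂ] H) : H →ₗ[ℂ] H)
  let E : ℕ → Submodule ℂ H := fun n => nx^[n] ⊥
  have Es : ∀ n, E (n + 1) = nx (E n) := fun n => Function.iterate_succ_apply' nx n ⊥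
  have fd : ∀ n, FiniteDimensional ℂ (E n) := by
    intro n
    induction n with
    | zero => exact inferInstanceAs (FiniteDimensional ℂ (⊥ : Submodule ℂ H))
    | succ n ih =>
      rw [Es]
      have : FiniteDimensional ℂ (Submodule.span ℂ (G : Set H)) :=
        FiniteDimensional.span_finset ℂ G
      infer_instance
  have mono : Monotone E := monotone_nat_of_le_succ fun n => by
    rw [Es]; exact le_sup_left.trans le_sup_left
  have hG : ∀ n, ∀ g ∈ G, g ∈ E (n + 1) := fun n g hg => by
    rw [Es]
    exact (le_sup_right.trans le_sup_left : Submodule.span ℂ (G : Set H) ≤ nx (E n))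
      (Submodule.subset_span hg)
  have hF : ∀ n, ∀ b ∈ F, E n ≤ (E (n + 1)).comap (b : H →ₗ[ℂ] H) ∧
      E n ≤ (E (n + 1)).comap ((star b : H →L[ℂ] H) : H →ₗ[ℂ] H) := by
    intro n b hb
    have h : (E n).map (b : H →ₗ[ℂ] H) ⊔ (E n).map ((star b : H →L[ℂ] H) : H →ₗ[ℂ] H)
        ≤ E (n + 1) := by
      rw [Es]
      exact (Finset.le_sup (f := fun b : H →L[ℂ] H => (E n).map (b : H →ₗ[ℂ] H) ⊔
        (E n).map ((star b : H →L[ℂ] H) : H →ₗ[ℂ] H)) hb).trans le_sup_right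
    constructor
    · rw [← Submodule.map_le_iff_le_comap]; exact le_sup_left.trans h
    · rw [← Submodule.map_le_iff_le_comap]; exact le_sup_right.trans h
  let p : ℕ → H →L[ℂ] H := fun n => (E n).starProjection
  have hs : ∀ m, star (p m) = p m := fun m => by
    rw [ContinuousLinearMap.star_eq_adjoint]
    exact ((E m).starProjection_isSymmetric).isSelfAdjoint.adjoint_eq
  have hn' : ∀ m n, m ≤ n → p n * p m = p m := fun m n h => by
    ext v
    exact Submodule.starProjection_eq_self_iff.2 (mono h ((E m).starProjection_apply_mem v))
  have hn : ∀ m n, m ≤ n → p m * p n = p m := fun m n h => by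
    have := congrArg star (hn' m n h)
    simpa [hs] using this
  have hb : ∀ b ∈ F, (∀ m, p (m + 1) * (b * p m) = b * p m) ∧
      (∀ m, p (m + 1) * (star b * p m) = star b * p m) := by
    intro b hb
    constructor <;> intro m <;> ext v <;> refine Submodule.starProjection_eq_self_iff.2 ?_
    · exact (hF m b hb).1 ((E m).starProjection_apply_mem v)
    · exact (hF m b hb).2 ((E m).starProjection_apply_mem v)
  -- choose N
  obtain ⟨N, hN⟩ : ∃ N : ℕ, ∀ b ∈ F, 2 * ‖b‖ / ε ≤ (N + 1 : ℕ) := by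
    obtain ⟨N, hN⟩ := exists_nat_ge (∑ b ∈ F, 2 * ‖b‖ / ε)
    refine ⟨N, fun b hb => ?_⟩
    refine (Finset.single_le_sum (f := fun b => 2 * ‖b‖ / ε) (fun b _ => by positivity) hb).trans
      (hN.trans ?_)
    push_cast; linarith
  have hNp : (0 : ℝ) < (N + 1 : ℕ) := by positivity
  set c : ℂ := ((((N + 1 : ℕ) : ℝ)⁻¹ : ℝ) : ℂ) with hc
  have hcn : ‖c‖ = ((N + 1 : ℕ) : ℝ)⁻¹ := by
    rw [hc, Complex.norm_real, Real.norm_of_nonneg (by positivity)]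
  let k : H →L[ℂ] H := c • ∑ m ∈ Finset.range (N + 1), p (m + 1)
  refine ⟨k, E (N + 1), fd _, ?_, ?_, ?_, ?_, ?_⟩
  · simp [k, hs, hc]
  · simp only [k, norm_smul, hcn]
    rw [inv_mul_le_iff₀ hNp, mul_one]
    refine (norm_sum_le _ _).trans ?_
    refine (Finset.sum_le_sum fun m _ => (E (m + 1)).starProjection_norm_le).trans ?_
    simp
  · change p (N + 1) * k = k
    simp only [k, mul_smul_comm, Finset.mul_sum]
    congr 1
    refine Finset.sum_congr rfl fun m hm => hn' _ _ ?_
    simp at hm; omega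
  · intro g hg
    have : ∀ m, p (m + 1) g = g := fun m => Submodule.starProjection_eq_self_iff.2 (hG m g hg)
    simp only [k, ContinuousLinearMap.smul_apply, sum_apply, this]
    simp only [Finset.sum_const, Finset.card_range]
    rw [← Nat.cast_smul_eq_nsmul ℂ, smul_smul, hc]
    push_cast
    rw [inv_mul_cancel₀ (by exact_mod_cast Nat.succ_ne_zero N), one_smul]
  · intro b hbF
    have e : k * b - b * k = c • (star (∑ m ∈ Finset.range (N + 1),
        (1 - p (m + 1)) * star b * p (m + 1))
        - ∑ m ∈ Finset.range (N + 1), (1 - p (m + 1)) * b * p (m + 1)) := by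
      simp only [k, smul_mul_assoc, mul_smul_comm, ← smul_sub, Finset.sum_mul, Finset.mul_sum,
        star_sum, ← Finset.sum_sub_distrib]
      congr 1
      refine Finset.sum_congr rfl fun m _ => ?_
      simp only [star_mul, star_sub, star_one, star_star, hs]
      noncomm_ring
    rw [e, norm_smul, hcn, inv_mul_le_iff₀ hNp]
    refine (norm_sub_le _ _).trans ?_
    rw [norm_star]
    have h1 := ckTri p hs hn b (hb b hbF).1 (N + 1)
    have h2 := ckTri p hs hn (star b) (hb b hbF).2 (N + 1)
    rw [norm_star] at h2
    have := hN b hbF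
    rw [div_le_iff₀ hε] at this
    linarith
end tri
end part1

section part2
open Filter Topology

section fr
variable {H : Type*} [NormedAddCommGroup H] [InnerProductSpace ℂ H] [CompleteSpace H]

/-- finite rank operators -/
def ckFR (T : H →L[ℂ] H) : Prop :=
  ∃ E : Submodule ℂ H, FiniteDimensional ℂ E ∧ ∀ v, T v ∈ E

lemma ckFR.proj {T : H →L[ℂ] H} (E : Submodule ℂ H) [FiniteDimensional ℂ E] (h : ∀ v, T v ∈ E) :
    E.starProjection * T = T := by
  ext v
  exact Submodule.starProjection_eq_self_iff.2 (h v)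

lemma ckFR.of_proj {T : H →L[ℂ] H} (E : Submodule ℂ H) [FiniteDimensional ℂ E]
    (h : E.starProjection * T = T) : ckFR T := by
  refine ⟨E, inferInstance, fun v => ?_⟩
  rw [← h]
  exact E.starProjection_apply_mem _

lemma ckFR.add {S T : H →L[ℂ] H} (hS : ckFR S) (hT : ckFR T) : ckFR (S + T) := by
  obtain ⟨E, _, hE⟩ := hS
  obtain ⟨F, _, hF⟩ := hT
  exact ⟨E ⊔ F, inferInstance, fun v => Submodule.add_mem_sup (hE v) (hF v)⟩

lemma ckFR.neg {S : H →L[ℂ] H} (hS : ckFR S) : ckFR (-S) := by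
  obtain ⟨E, _, hE⟩ := hS
  exact ⟨E, inferInstance, fun v => E.neg_mem (hE v)⟩

lemma ckFR.sub {S T : H →L[ℂ] H} (hS : ckFR S) (hT : ckFR T) : ckFR (S - T) := by
  rw [sub_eq_add_neg]; exact hS.add hT.neg

lemma ckFR.mul_right {S : H →L[ℂ] H} (hS : ckFR S) (T : H →L[ℂ] H) : ckFR (S * T) := by
  obtain ⟨E, _, hE⟩ := hS
  exact ⟨E, inferInstance, fun v => hE _⟩

lemma ckFR.mul_left {S : H →L[ℂ] H} (hS : ckFR S) (T : H →L[ℂ] H) : ckFR (T * S) := by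
  obtain ⟨E, _, hE⟩ := hS
  exact ⟨E.map (T : H →ₗ[ℂ] H), inferInstance, fun v => Submodule.mem_map_of_mem (hE v)⟩

lemma ckStarProj (E : Submodule ℂ H) [E.HasOrthogonalProjection] :
    star (E.starProjection) = E.starProjection := by
  rw [ContinuousLinearMap.star_eq_adjoint]
  exact (E.starProjection_isSymmetric).isSelfAdjoint.adjoint_eq

lemma ckFR.star {S : H →L[ℂ] H} (hS : ckFR S) : ckFR (star S) := by
  obtain ⟨E, _, hE⟩ := hS
  have h := congrArg Star.star (ckFR.proj E hE)
  rw [star_mul, ckStarProj] at h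
  rw [← h]
  exact ckFR.mul_left ⟨E, inferInstance, fun v => E.starProjection_apply_mem v⟩ _

lemma ckFR.zero : ckFR (0 : H →L[ℂ] H) := ⟨⊥, inferInstance, fun v => by simp⟩

lemma ckFR.sum {ι : Type*} (s : Finset ι) (f : ι → H →L[ℂ] H) (h : ∀ i ∈ s, ckFR (f i)) :
    ckFR (∑ i ∈ s, f i) := by
  classical
  induction s using Finset.induction_on with
  | empty => simpa using ckFR.zero
  | insert a s ha ih =>
    rw [Finset.sum_insert ha]
    exact (h a (by simp)).add (ih fun i hi => h i (by simp [hi]))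

lemma ckFR.cpt {Q : Type*} [CStarAlgebra Q] {π : (H →L[ℂ] H) →⋆ₐ[ℂ] Q}
    (hker : ∀ T : H →L[ℂ] H, π T = 0 ↔ IsCompactOperator T) {T : H →L[ℂ] H} (hT : ckFR T) :
    π T = 0 := by
  obtain ⟨E, _, hE⟩ := hT
  have h1 : IsCompactOperator (id : E → E) :=
    (isCompactOperator_id_iff_finiteDimensional (𝕜 := ℂ) (E := E)).2 inferInstance
  have h2 : IsCompactOperator (E.starProjection) := by
    have := (h1.clm_comp E.subtypeL).comp_clm E.orthogonalProjectionOnto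
    exact this
  have h3 := (hker _).2 h2
  rw [← ckFR.proj E hE, map_mul, h3, zero_mul]

lemma ckSeqCpt {Q : Type*} [CStarAlgebra Q] {π : (H →L[ℂ] H) →⋆ₐ[ℂ] Q}
    (D : ℕ → H →L[ℂ] H) (T : H →L[ℂ] H) (N₀ : ℕ) (C : ℝ) (h0 : ∀ n, π (D n) = 0)
    (hD : ∀ n, N₀ ≤ n → ‖D (n + 1) - D n‖ ≤ C / 2 ^ n)
    (hT : ∀ v w, Tendsto (fun n => inner ℂ (D n v) w) atTop (𝓝 (inner ℂ (T v) w))) :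
    π T = 0 := by
  have hc : CauchySeq (fun n => D (n + N₀)) := by
    refine cauchySeq_of_le_geometric_two (C := 2 * C) fun n => ?_
    rw [dist_comm, dist_eq_norm]
    have := hD (n + N₀) (by omega)
    rw [show n + 1 + N₀ = n + N₀ + 1 by ring]
    refine this.trans ?_
    have hC : 0 ≤ C / 2 ^ (n + N₀) := (norm_nonneg _).trans this
    have hC' : 0 ≤ C := by
      by_contra h
      push Not at h
      have := div_neg_of_neg_of_pos h (show (0 : ℝ) < 2 ^ (n + N₀) by positivity)
      linarith
    rw [mul_div_cancel_left₀ _ (two_ne_zero)]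
    exact div_le_div_of_nonneg_left hC' (by positivity) (pow_le_pow_right₀ (by norm_num) (by omega))
  obtain ⟨L, hL⟩ := cauchySeq_tendsto_of_complete hc
  have hLT : L = T := by
    ext v
    refine ext_inner_right ℂ fun w => ?_
    have h1 : Tendsto (fun n => inner ℂ (D (n + N₀) v) w) atTop (𝓝 (inner ℂ (L v) w)) := by
      have : Continuous fun A : H →L[ℂ] H => inner ℂ (A v) w := by fun_prop
      exact (this.tendsto L).comp hL
    exact tendsto_nhds_unique h1 ((tendsto_add_atTop_iff_nat (f := fun n => inner ℂ (D n v) w) N₀).2 (hT v w))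
  have hcont : Continuous π := AddMonoidHomClass.continuous_of_bound π 1 fun x => by
    simpa using NonUnitalStarAlgHom.norm_apply_le π x
  have h2 := (hcont.tendsto L).comp hL
  rw [hLT] at h2
  refine (tendsto_nhds_unique h2 ?_)
  simp [Function.comp_def, h0]

lemma ckExpNeg {R : Type*} [NormedRing R] [NormedAlgebra ℂ R] [CompleteSpace R] (y : R) :
    NormedSpace.exp y * NormedSpace.exp (-y) = 1 := by
  letI : NormedAlgebra ℚ R := NormedAlgebra.restrictScalars ℚ ℂ R
  rw [← NormedSpace.exp_add_of_commute, add_neg_cancel, NormedSpace.exp_zero]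
  exact (Commute.refl y).neg_right

lemma ckQC [Nontrivial H] (G : Submodule ℂ H) [FiniteDimensional ℂ G] (F : Finset (H →L[ℂ] H))
    (ε : ℝ) (hε : 0 < ε) :
    ∃ (s c : H →L[ℂ] H), star s = s ∧ star c = c ∧ s * s + c * c = 1 ∧ ckFR s ∧ ckFR (1 - c) ∧
      ‖s‖ ≤ 1 ∧ ‖c‖ ≤ 1 ∧
      (∀ g ∈ G, c g = 0) ∧ ∀ b ∈ F, ‖s * b - b * s‖ ≤ ε ∧ ‖c * b - b * c‖ ≤ ε := by
  obtain ⟨G', hG'⟩ := (Submodule.fg_iff_finiteDimensional G).2 inferInstance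
  set K : ℝ := Real.exp 2 * 2 with hK
  have hKp : 0 < K := by positivity
  obtain ⟨k, E, _, ks, kn, kE, kG, kF⟩ := ckQC0 G' F (ε / K) (by positivity)
  have kG2 : ∀ g ∈ G, k g = g := by
    intro g hg
    rw [← hG'] at hg
    induction hg using Submodule.span_induction with
    | mem x hx => exact kG x hx
    | zero => simp
    | add x y _ _ hx hy => rw [map_add, hx, hy]
    | smul a x _ hx => rw [map_smul, hx]
  set y : H →L[ℂ] H := (Complex.I * (Real.pi / 2 : ℝ)) • k with hy
  have hyn : ‖y‖ ≤ 2 := by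
    rw [hy, norm_smul, norm_mul, Complex.norm_I, one_mul, Complex.norm_real,
      Real.norm_of_nonneg (by positivity)]
    have := Real.pi_le_four
    have := Real.pi_pos
    nlinarith [norm_nonneg k]
  have hys : star y = -y := by
    rw [hy, star_smul, ks, ← neg_smul]
    congr 1
    simp
  set U := NormedSpace.exp y with hU
  set U' := NormedSpace.exp (-y) with hU'
  have hUs : star U = U' := by rw [hU, NormedSpace.star_exp, hys]
  have hUs' : star U' = U := by rw [← hUs, star_star]
  have c1 : U * U' = 1 := ckExpNeg y
  have c2 : U' * U = 1 := by
    have := ckExpNeg (-y)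
    rwa [neg_neg] at this
  have cb : ∀ b ∈ F, ‖y * b - b * y‖ ≤ 2 * (ε / K) := by
    intro b hb
    have : y * b - b * y = (Complex.I * (Real.pi / 2 : ℝ)) • (k * b - b * k) := by
      rw [hy, smul_mul_assoc, mul_smul_comm, smul_sub]
    rw [this, norm_smul, norm_mul, Complex.norm_I, one_mul, Complex.norm_real,
      Real.norm_of_nonneg (by positivity)]
    have h1 := kF b hb
    have := Real.pi_le_four
    have := Real.pi_pos
    gcongr
    linarith
  have Ub : ∀ b ∈ F, ‖U * b - b * U‖ ≤ ε ∧ ‖U' * b - b * U'‖ ≤ ε := by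
    intro b hb
    have e1 : Real.exp 2 * (2 * (ε / K)) = ε := by rw [hK]; field_simp
    have h0 := cb b hb
    constructor
    · refine (ckExpComm y b).trans ?_
      rw [← e1]
      gcongr
    · refine (ckExpComm (-y) b).trans ?_
      rw [← e1, norm_neg]
      gcongr
      rw [neg_mul, mul_neg, sub_neg_eq_add, neg_add_eq_sub, norm_sub_rev]
      exact h0
  have nU : ‖U‖ = 1 := CStarRing.norm_of_mem_unitary (U := U)
    (Unitary.mem_iff.2 ⟨by rw [hUs, c2], by rw [hUs, c1]⟩)
  have nU' : ‖U'‖ = 1 := by rw [← hUs, norm_star, nU]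
  set p := E.starProjection with hp
  have kp : k * (1 - p) = 0 := by
    have := congrArg star kE
    rw [star_mul, ckStarProj, ks] at this
    rw [mul_sub, this, mul_one, sub_self]
  have Up : U * (1 - p) = 1 - p := by
    have := ckExpEig y (1 - p) 0 (by rw [hy, smul_mul_assoc, kp, smul_zero, zero_smul])
    simpa using this
  have Up' : U' * (1 - p) = 1 - p := by
    have := ckExpEig (-y) (1 - p) 0 (by
      rw [hy, neg_mul, smul_mul_assoc, kp, smul_zero, zero_smul, neg_zero])
    simpa using this
  have two : (2 : ℂ)⁻¹ + 2⁻¹ = 1 := by norm_num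
  set s : H →L[ℂ] H := (-(Complex.I / 2)) • (U - U') with hs
  set c : H →L[ℂ] H := (2 : ℂ)⁻¹ • (U + U') with hc
  have ss : star s = s := by
    rw [hs, star_smul, star_sub, hUs, hUs', ← neg_sub U U', smul_neg, ← neg_smul]
    congr 1
    simp [neg_div]
  have cs : star c = c := by
    rw [hc, star_smul, star_add, hUs, hUs', add_comm U' U]
    congr 1
    simp
  refine ⟨s, c, ss, cs, ?_, ?_, ?_, ?_, ?_, ?_, ?_⟩
  · rw [hs, hc, smul_mul_smul_comm, smul_mul_smul_comm]
    have e1 : (U - U') * (U - U') = U * U + U' * U' - (2 : ℂ) • 1 := by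
      rw [two_smul]
      simp only [sub_mul, mul_sub, c1, c2]; abel
    have e2 : (U + U') * (U + U') = U * U + U' * U' + (2 : ℂ) • 1 := by
      rw [two_smul]
      simp only [add_mul, mul_add, c1, c2]; abel
    rw [e1, e2]
    have i2 : -(Complex.I / 2) * -(Complex.I / 2) = -(4 : ℂ)⁻¹ := by
      ring_nf; rw [Complex.I_sq]; norm_num
    rw [i2, neg_smul, smul_sub, smul_add, smul_add, smul_smul, smul_smul]
    norm_num
    module
  · have h1 : s * (1 - p) = 0 := by
      rw [hs, smul_mul_assoc, sub_mul, Up, Up', sub_self, smul_zero]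
    have h2 := congrArg star h1
    rw [star_mul, star_sub, star_one, ckStarProj, ss, star_zero, sub_mul, one_mul, sub_eq_zero] at h2
    exact ckFR.of_proj E h2.symm
  · have h1 : (1 - c) * (1 - p) = 0 := by
      rw [hc, sub_mul, smul_mul_assoc, add_mul, Up, Up', smul_add, ← add_smul, two, one_mul, one_smul,
        sub_self]
    have h2 := congrArg star h1
    rw [star_mul, star_sub, star_sub, star_one, ckStarProj, cs, star_zero, sub_mul, one_mul,
      sub_eq_zero] at h2
    exact ckFR.of_proj E h2.symm
  · rw [hs, norm_smul]
    have := norm_sub_le U U'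
    simp only [norm_neg, norm_div, Complex.norm_I, Complex.norm_ofNat]
    linarith
  · rw [hc, norm_smul]
    have := norm_add_le U U'
    simp only [norm_inv, Complex.norm_ofNat]
    linarith
  · intro g hg
    have hq : k * G.starProjection = G.starProjection := by
      ext v; exact kG2 _ (G.starProjection_apply_mem v)
    have u1 := ckExpEig y G.starProjection (Complex.I * (Real.pi / 2 : ℝ)) (by
      rw [hy, smul_mul_assoc, hq])
    have u2 := ckExpEig (-y) G.starProjection (-(Complex.I * (Real.pi / 2 : ℝ))) (by
      rw [hy, neg_mul, smul_mul_assoc, hq, neg_smul])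
    have ei : Complex.exp (Complex.I * (Real.pi / 2 : ℝ)) = Complex.I := by
      rw [mul_comm]; push_cast; exact Complex.exp_pi_div_two_mul_I
    have ei' : Complex.exp (-(Complex.I * (Real.pi / 2 : ℝ))) = -Complex.I := by
      rw [Complex.exp_neg, ei, Complex.inv_I]
    rw [ei] at u1
    rw [ei'] at u2
    have : c * G.starProjection = 0 := by
      rw [hc, smul_mul_assoc, add_mul]
      rw [u1, u2]; simp
    have h3 : c (G.starProjection g) = 0 := congrArg (fun A : H →L[ℂ] H => A g) this
    rwa [Submodule.starProjection_eq_self_iff.2 hg] at h3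
  · intro b hb
    obtain ⟨b1, b2⟩ := Ub b hb
    constructor
    · have : s * b - b * s = (-(Complex.I / 2)) • ((U * b - b * U) - (U' * b - b * U')) := by
        rw [hs, smul_mul_assoc, mul_smul_comm, ← smul_sub]; congr 1; noncomm_ring
      rw [this, norm_smul]
      have := norm_sub_le (U * b - b * U) (U' * b - b * U')
      simp only [norm_neg, norm_div, Complex.norm_I, Complex.norm_ofNat]
      linarith
    · have : c * b - b * c = (2 : ℂ)⁻¹ • ((U * b - b * U) + (U' * b - b * U')) := by
        rw [hc, smul_mul_assoc, mul_smul_comm, ← smul_sub]; congr 1; noncomm_ring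
      rw [this, norm_smul]
      have := norm_add_le (U * b - b * U) (U' * b - b * U')
      simp only [norm_inv, Complex.norm_ofNat]
      linarith

end fr
end part2

section part3
open Filter Topology

section part
variable {H : Type*} [NormedAddCommGroup H] [InnerProductSpace ℂ H] [CompleteSpace H]

lemma ckPiCont {Q : Type*} [CStarAlgebra Q] (π : (H →L[ℂ] H) →⋆ₐ[ℂ] Q) : Continuous π :=
  AddMonoidHomClass.continuous_of_bound π 1 fun x => by
    simpa using NonUnitalStarAlgHom.norm_apply_le π x

/-- finite-dimensional subspace containing the ranges of finitely many finite rank operators -/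
lemma ckFinRange {ι : Type*} (s : Finset ι) (g : ι → H →L[ℂ] H) (h : ∀ i ∈ s, ckFR (g i)) :
    ∃ G : Submodule ℂ H, FiniteDimensional ℂ G ∧ ∀ i ∈ s, ∀ v, g i v ∈ G := by
  classical
  choose E hE hE' using h
  refine ⟨s.attach.sup fun i => E i.1 i.2, ?_, fun i hi v => ?_⟩
  · have := fun i : s => hE i.1 i.2
    exact Submodule.finite_finset_sup _ _
  · exact (Finset.le_sup (f := fun i : s => E i.1 i.2) (Finset.mem_attach s ⟨i, hi⟩)) (hE' i hi v)

lemma ckPartStep [Nontrivial H] (P : H →L[ℂ] H) (hP : ‖P‖ ≤ 1) (hP1 : ckFR (1 - P))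
    (F : Finset (H →L[ℂ] H)) (V : Finset H) (ε : ℝ) (hε : 0 < ε) :
    ∃ f P' : H →L[ℂ] H, ‖P'‖ ≤ 1 ∧ ckFR (1 - P') ∧ (ckFR f ∧ ‖f‖ ≤ 1) ∧
      star f * f + star P' * P' = star P * P ∧ (∀ v ∈ V, P' v = 0) ∧
      ∀ b ∈ F, ‖P' * b - b * P'‖ ≤ ε ∧ ‖f * b - b * f‖ ≤ ε + ‖P * b - b * P‖ := by
  classical
  obtain ⟨G₁, _, hG₁⟩ := ckFinRange F (fun b => b * (1 - P) - (1 - P) * b)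
    (fun b _ => (hP1.mul_left b).sub (hP1.mul_right b))
  have : FiniteDimensional ℂ (Submodule.span ℂ ((V.image P : Finset H) : Set H)) :=
    FiniteDimensional.span_finset ℂ _
  obtain ⟨s, c, ss, cs, sc, sF, cF, sn, cn, cG, cb⟩ :=
    ckQC (G₁ ⊔ Submodule.span ℂ ((V.image P : Finset H) : Set H)) F ε hε
  refine ⟨s * P, c * P, ?_, ?_, ⟨sF.mul_right P,
    (norm_mul_le _ _).trans (mul_le_one₀ sn (norm_nonneg _) hP)⟩, ?_, ?_, ?_⟩
  · exact (norm_mul_le _ _).trans (mul_le_one₀ cn (norm_nonneg _) hP)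
  · have : 1 - c * P = (1 - c) + c * (1 - P) := by noncomm_ring
    rw [this]
    exact cF.add (hP1.mul_left c)
  · have : star (s * P) * (s * P) + star (c * P) * (c * P) = star P * (s * s + c * c) * P := by
      rw [star_mul, star_mul, ss, cs]; noncomm_ring
    rw [this, sc, mul_one]
  · intro v hv
    refine cG _ (Submodule.mem_sup_right (Submodule.subset_span ?_))
    simp only [Finset.coe_image]
    exact ⟨v, hv, rfl⟩
  · intro b hb
    obtain ⟨b1, b2⟩ := cb b hb
    have z : c * (P * b - b * P) = 0 := by
      ext v
      have e : P * b - b * P = b * (1 - P) - (1 - P) * b := by noncomm_ring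
      rw [e]
      exact cG _ (Submodule.mem_sup_left (hG₁ b hb v))
    constructor
    · have e : c * P * b - b * (c * P) = (c * b - b * c) * P + c * (P * b - b * P) := by noncomm_ring
      rw [e, z, add_zero]
      exact (norm_mul_le _ _).trans ((mul_le_of_le_one_right (norm_nonneg _) hP).trans b2)
    · have e : s * P * b - b * (s * P) = (s * b - b * s) * P + s * (P * b - b * P) := by noncomm_ring
      rw [e]
      refine (norm_add_le _ _).trans (add_le_add ?_ ?_)
      · exact (norm_mul_le _ _).trans ((mul_le_of_le_one_right (norm_nonneg _) hP).trans b1)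
      · exact (norm_mul_le _ _).trans (mul_le_of_le_one_left (norm_nonneg _) sn)

lemma ckPartition [Nontrivial H] [TopologicalSpace.SeparableSpace H] (b : ℕ → H →L[ℂ] H) :
    ∃ f : ℕ → H →L[ℂ] H, (∀ n, ckFR (f n)) ∧ (∀ n, ‖f n‖ ≤ 1) ∧
      (∀ v, Tendsto (fun N => ∑ n ∈ Finset.range N, (star (f n) * f n) v) atTop (𝓝 v)) ∧
      ∀ k n, k ≤ n → ‖f n * b k - b k * f n‖ ≤ 2 / 2 ^ n := by
  classical
  let vs := TopologicalSpace.denseSeq H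
  let St := {P : H →L[ℂ] H // ‖P‖ ≤ 1 ∧ ckFR (1 - P)}
  have step : ∀ (n : ℕ) (P : St), ∃ (f : H →L[ℂ] H) (P' : St), (ckFR f ∧ ‖f‖ ≤ 1) ∧
      star f * f + star P'.1 * P'.1 = star P.1 * P.1 ∧ (∀ k ≤ n, P'.1 (vs k) = 0) ∧
      ∀ k ≤ n + 1, ‖P'.1 * b k - b k * P'.1‖ ≤ 1 / 2 ^ (n + 1) ∧
        ‖f * b k - b k * f‖ ≤ 1 / 2 ^ (n + 1) + ‖P.1 * b k - b k * P.1‖ := by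
    intro n P
    obtain ⟨f, P', h1, h2, h3, h4, h5, h6⟩ := ckPartStep P.1 P.2.1 P.2.2
      ((Finset.range (n + 2)).image b) ((Finset.range (n + 1)).image vs) (1 / 2 ^ (n + 1))
      (by positivity)
    refine ⟨f, ⟨P', h1, h2⟩, h3, h4, fun k hk => h5 _ ?_, fun k hk => h6 _ ?_⟩
    · exact Finset.mem_image_of_mem _ (by simp; omega)
    · exact Finset.mem_image_of_mem _ (by simp; omega)
  choose f nx h1 h2 h3 h4 using step
  let P : ℕ → St := fun n => Nat.rec ⟨1, by simp, by simpa using ckFR.zero⟩ (fun n P => nx n P) n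
  have hPs : ∀ n, P (n + 1) = nx n (P n) := fun n => rfl
  have hP0 : (P 0).1 = 1 := rfl
  have hPb : ∀ n k, k ≤ n → ‖(P n).1 * b k - b k * (P n).1‖ ≤ 1 / 2 ^ n := by
    intro n k hk
    cases n with
    | zero => rw [hP0]; simp
    | succ n => rw [hPs]; exact (h4 n (P n) k hk).1
  refine ⟨fun n => f n (P n), fun n => (h1 _ _).1, fun n => (h1 _ _).2, fun v => ?_, fun k n hk => ?_⟩
  · have tel : ∀ N, ∑ n ∈ Finset.range N, (star (f n (P n)) * f n (P n)) v
        = v - (star (P N).1 * (P N).1) v := by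
      intro N
      induction N with
      | zero => simp [hP0]
      | succ N ih =>
        have := congrArg (fun A : H →L[ℂ] H => A v) (h2 N (P N))
        rw [← hPs] at this
        simp only [add_apply] at this
        rw [Finset.sum_range_succ, ih, ← this]
        abel
    have z : Tendsto (fun N => (star (P N).1 * (P N).1) v) atTop (𝓝 0) := by
      rw [Metric.tendsto_atTop]
      intro ε hε
      obtain ⟨k, hk⟩ := (TopologicalSpace.denseRange_denseSeq H).exists_dist_lt v hε
      refine ⟨k + 1, fun n hn => ?_⟩
      obtain ⟨m, rfl⟩ : ∃ m, n = m + 1 := ⟨n - 1, by omega⟩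
      have hz : (P (m + 1)).1 (vs k) = 0 := by rw [hPs]; exact h3 m (P m) k (by omega)
      have e : (star (P (m + 1)).1 * (P (m + 1)).1) v
          = (star (P (m + 1)).1 * (P (m + 1)).1) (v - vs k) := by
        rw [map_sub]
        have : (star (P (m + 1)).1 * (P (m + 1)).1) (vs k) = star (P (m + 1)).1 ((P (m + 1)).1 (vs k)) := rfl
        rw [this, hz, map_zero, sub_zero]
      rw [dist_zero_right, e]
      refine (ContinuousLinearMap.le_opNorm _ _).trans_lt ?_
      have hn : ‖star (P (m + 1)).1 * (P (m + 1)).1‖ ≤ 1 :=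
        (norm_mul_le _ _).trans (mul_le_one₀ (by rw [norm_star]; exact (P (m + 1)).2.1)
          (norm_nonneg _) (P (m + 1)).2.1)
      rw [dist_eq_norm] at hk
      exact (mul_le_of_le_one_left (norm_nonneg _) hn).trans_lt hk
    simp only [tel]
    simpa using tendsto_const_nhds.sub z
  · have a1 := (h4 n (P n) k (by omega)).2
    have a2 := hPb n k hk
    have : (1 : ℝ) / 2 ^ (n + 1) ≤ 1 / 2 ^ n := by
      apply div_le_div_of_nonneg_left <;> first | positivity | skip
      exact pow_le_pow_right₀ (by norm_num) (by omega)
    calc _ ≤ _ := a1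
      _ ≤ 1 / 2 ^ n + 1 / 2 ^ n := add_le_add this a2
      _ = _ := by ring
end part
end part3

section part4
open Filter Topology

section lemA
variable {H : Type*} [NormedAddCommGroup H] [InnerProductSpace ℂ H] [CompleteSpace H]

noncomputable def ckJ {d : ℕ} (z r : Fin d → H) : H →L[ℂ] H :=
  ∑ i, InnerProductSpace.rankOne ℂ (z i) (r i)

lemma ckJ_star {d : ℕ} (z r : Fin d → H) : star (ckJ z r) = ckJ r z := by
  simp [ckJ, star_sum, ContinuousLinearMap.star_eq_adjoint]

lemma ckJ_apply {d : ℕ} (z r : Fin d → H) (v : H) : ckJ z r v = ∑ i, inner ℂ (r i) v • z i := by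
  simp [ckJ, sum_apply]

lemma ckJ_conj {d : ℕ} (z r : Fin d → H) (A : H →L[ℂ] H) :
    star (ckJ z r) * A * ckJ z r
      = ∑ i, ∑ j, inner ℂ (z i) (A (z j)) • InnerProductSpace.rankOne ℂ (r i) (r j) := by
  rw [ckJ_star]
  ext v
  change ckJ r z (A (ckJ z r v)) = _
  rw [ckJ_apply, ckJ_apply, sum_apply]
  refine Finset.sum_congr rfl fun i _ => ?_
  rw [sum_apply, map_sum, inner_sum, Finset.sum_smul]
  refine Finset.sum_congr rfl fun j _ => ?_
  simp [inner_smul_right, smul_smul, mul_comm]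

lemma ckJ_diff {d : ℕ} (z r : Fin d → H) (hr : ∀ i, ‖r i‖ ≤ 1) (A B : H →L[ℂ] H) (δ : ℝ)
    (h : ∀ i j, ‖inner ℂ (z i) (A (z j)) - inner ℂ (r i) (B (r j))‖ ≤ δ) :
    ‖star (ckJ z r) * A * ckJ z r - star (ckJ r r) * B * ckJ r r‖ ≤ d * d * δ := by
  rw [ckJ_conj, ckJ_conj]
  simp only [← Finset.sum_sub_distrib, ← sub_smul]
  calc _ ≤ ∑ i : Fin d, ∑ j : Fin d, δ := by
        refine (norm_sum_le _ _).trans (Finset.sum_le_sum fun i _ => ?_)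
        refine (norm_sum_le _ _).trans (Finset.sum_le_sum fun j _ => ?_)
        rw [norm_smul, InnerProductSpace.norm_rankOne]
        have h1 := h i j
        have h2 : ‖r i‖ * ‖r j‖ ≤ 1 := mul_le_one₀ (hr i) (norm_nonneg _) (hr j)
        calc _ ≤ δ * 1 := mul_le_mul h1 h2 (by positivity) ((norm_nonneg _).trans h1)
          _ = δ := mul_one _
    _ = _ := by simp; ring

/-- moving vectors out of a finite dimensional space by an isometry -/
lemma ckMove (t : ℕ → H →L[ℂ] H) (ht : ∀ k l, star (t k) * t l = if k = l then 1 else 0)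
    (G : Submodule ℂ H) [FiniteDimensional ℂ G] {d : ℕ} (y : Fin d → H) :
    ∃ (N : ℕ) (l : Fin N → ℂ), (star (∑ k, l k • t k) * (∑ k, l k • t k) = 1) ∧
      ∀ i, ∀ g ∈ G, inner ℂ g ((∑ k, l k • t k) (y i)) = 0 := by
  classical
  set N := Module.finrank ℂ (Fin d → G) + 1 with hN
  let T : (Fin N → ℂ) →ₗ[ℂ] (Fin d → G) :=
    LinearMap.pi fun i => ∑ k : Fin N, (LinearMap.toSpanSingleton ℂ G
      (G.orthogonalProjectionOnto (t k (y i)))) ∘ₗ LinearMap.proj k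
  have hk : LinearMap.ker T ≠ ⊥ := LinearMap.ker_ne_bot_of_finrank_lt (by simp [hN])
  obtain ⟨l, hl, hl0⟩ := (Submodule.ne_bot_iff _).1 hk
  set n : ℝ := Real.sqrt (∑ k, ‖l k‖ ^ 2) with hn
  have hpos : 0 < ∑ k, ‖l k‖ ^ 2 := by
    obtain ⟨k, hk⟩ := Function.ne_iff.1 hl0
    refine Finset.sum_pos' (fun _ _ => by positivity) ⟨k, Finset.mem_univ _, ?_⟩
    have : 0 < ‖l k‖ := norm_pos_iff.2 hk
    positivity
  have hn0 : n ≠ 0 := (Real.sqrt_pos.2 hpos).ne'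
  have hn2 : n * n = ∑ k, ‖l k‖ ^ 2 := Real.mul_self_sqrt hpos.le
  refine ⟨N, fun k => (n : ℂ)⁻¹ * l k, ?_, ?_⟩
  · have e : ∑ k, ((n : ℂ)⁻¹ * l k) • t k = (n : ℂ)⁻¹ • ∑ k, l k • t k := by
      rw [Finset.smul_sum]; simp [smul_smul]
    have e2 : star (∑ k : Fin N, l k • t k) * (∑ k : Fin N, l k • t k)
        = ((n * n : ℝ) : ℂ) • (1 : H →L[ℂ] H) := by
      rw [star_sum, Finset.sum_mul, hn2]
      push_cast
      rw [Finset.sum_smul]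
      refine Finset.sum_congr rfl fun k _ => ?_
      rw [Finset.mul_sum, Finset.sum_eq_single k]
      · rw [star_smul, smul_mul_smul_comm, ht]
        simp only [if_true]
        congr 1
        exact Complex.conj_mul' (l k)
      · intro j _ hj
        rw [star_smul, smul_mul_smul_comm, ht, if_neg, smul_zero]
        exact fun h => hj (Fin.ext h).symm
      · simp
    rw [e, star_smul, smul_mul_smul_comm, e2, smul_smul]
    have : star (n : ℂ)⁻¹ * (n : ℂ)⁻¹ * ((n * n : ℝ) : ℂ) = 1 := by
      have : (n : ℂ) ≠ 0 := by exact_mod_cast hn0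
      simp
      field_simp
    rw [this, one_smul]
  · intro i g hg
    have e : ∑ k, ((n : ℂ)⁻¹ * l k) • t k = (n : ℂ)⁻¹ • ∑ k, l k • t k := by
      rw [Finset.smul_sum]; simp [smul_smul]
    have h0 : G.orthogonalProjectionOnto ((∑ k : Fin N, l k • t k) (y i)) = 0 := by
      have := congrFun (LinearMap.mem_ker.1 hl) i
      simpa [T, sum_apply, map_sum] using this
    rw [e]
    rw [Submodule.orthogonalProjectionOnto_eq_zero_iff] at h0
    have h1 := (Submodule.mem_orthogonal _ _).1 h0 g hg
    change inner ℂ g ((n : ℂ)⁻¹ • ((∑ k : Fin N, l k • t k) (y i))) = 0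
    rw [inner_smul_right, h1, mul_zero]

/-- Absorption of `B₁` by `B₂`. -/
def ckAbs (B₁ B₂ : ℕ → H →L[ℂ] H) : Prop :=
  ∀ (d : ℕ) (r : Fin d → H), Orthonormal ℂ r → ∀ (n : ℕ) (δ : ℝ), 0 < δ →
    ∃ y : Fin d → H, Orthonormal ℂ y ∧ ∀ k ≤ n, ∀ i j,
      ‖inner ℂ (y i) (B₂ k (y j)) - inner ℂ (r i) (B₁ k (r j))‖ ≤ δ

lemma ckA (B₁ B₂ : ℕ → H →L[ℂ] H) (hA : ckAbs B₁ B₂) (t : ℕ → H →L[ℂ] H)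
    (ht : ∀ k l, star (t k) * t l = if k = l then 1 else 0)
    (htc : ∀ k l, t k * B₂ l = B₂ l * t k) (f : H →L[ℂ] H) (hf : ckFR f) (n : ℕ)
    (G : Submodule ℂ H) [FiniteDimensional ℂ G] (ε : ℝ) (hε : 0 < ε) :
    ∃ Z : H →L[ℂ] H, ckFR Z ∧ star Z * Z = star f * f ∧ (∀ g ∈ G, star Z g = 0) ∧
      ∀ k ≤ n, ‖star Z * B₂ k * Z - star f * B₁ k * f‖ ≤ ε := by
  classical
  obtain ⟨E, _, hE⟩ := hf
  set d := Module.finrank ℂ E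
  let bs := stdOrthonormalBasis ℂ E
  let r : Fin d → H := fun i => bs i
  have hr : Orthonormal ℂ r := bs.orthonormal.comp_linearIsometry E.subtypeₗᵢ
  have hp : ckJ r r = E.starProjection := (bs.starProjection_eq_sum_rankOne).symm
  have hpf : ckJ r r * f = f := by rw [hp]; exact ckFR.proj E hE
  set δ : ℝ := ε / ((d * d + 1) * (‖f‖ * ‖f‖ + 1)) with hδ
  have hδp : 0 < δ := by positivity
  obtain ⟨y, hy, hyB⟩ := hA d r hr n δ hδp
  obtain ⟨N, l, hl1, hl2⟩ := ckMove t ht G y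
  set u := ∑ k, l k • t k with hu
  let z : Fin d → H := fun i => u (y i)
  have hin : ∀ v w, inner ℂ (u v) (u w) = inner ℂ v w := by
    intro v w
    rw [← ContinuousLinearMap.adjoint_inner_right]
    change inner ℂ v ((star u * u) w) = _
    rw [hl1]; rfl
  have huB : ∀ k, u * B₂ k = B₂ k * u := by
    intro k
    simp [hu, Finset.sum_mul, Finset.mul_sum, htc]
  have hzB : ∀ k i j, inner ℂ (z i) (B₂ k (z j)) = inner ℂ (y i) (B₂ k (y j)) := by
    intro k i j
    have : B₂ k (u (y j)) = u (B₂ k (y j)) :=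
      congrArg (fun A : H →L[ℂ] H => A (y j)) (huB k).symm
    rw [← hin (y i), ← this]
  have hz1 : star (ckJ z r) * ckJ z r = ckJ r r := by
    have h1 := ckJ_conj z r 1
    rw [mul_one] at h1
    rw [h1, ckJ]
    refine Finset.sum_congr rfl fun i _ => ?_
    rw [Finset.sum_eq_single i]
    · have : inner ℂ (z i) ((1 : H →L[ℂ] H) (z i)) = 1 := by
        change inner ℂ (u (y i)) (u (y i)) = 1
        rw [hin, inner_self_eq_norm_sq_to_K, hy.1]; simp
      rw [this, one_smul]
    · intro j _ hj
      have : inner ℂ (z i) ((1 : H →L[ℂ] H) (z j)) = 0 := by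
        change inner ℂ (u (y i)) (u (y j)) = 0
        rw [hin, hy.2 hj.symm]
      rw [this, zero_smul]
    · simp
  refine ⟨ckJ z r * f, ?_, ?_, ?_, ?_⟩
  · exact ckFR.mul_left ⟨E, inferInstance, hE⟩ _
  · rw [star_mul, mul_assoc, ← mul_assoc (star (ckJ z r)), hz1, hpf]
  · intro g hg
    rw [star_mul, ckJ_star]
    change star f (ckJ r z g) = 0
    rw [ckJ_apply]
    have : ∀ i, inner ℂ (z i) g = 0 := fun i => by
      rw [← inner_conj_symm, hl2 i g hg, map_zero]
    simp [this]
  · intro k hk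
    have h1 := ckJ_diff z r (fun i => (hr.1 i).le) (B₂ k) (B₁ k) δ (fun i j => by
      rw [hzB]; exact hyB k hk i j)
    have hsf : star f * star (ckJ r r) = star f := by rw [← star_mul, hpf]
    have e : star (ckJ z r * f) * B₂ k * (ckJ z r * f) - star f * B₁ k * f
        = star f * (star (ckJ z r) * B₂ k * ckJ z r - star (ckJ r r) * B₁ k * ckJ r r) * f := by
      have : star f * B₁ k * f = (star f * star (ckJ r r)) * B₁ k * (ckJ r r * f) := by
        rw [hsf, hpf]
      rw [this, star_mul]
      noncomm_ring
    rw [e]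
    calc _ ≤ ‖f‖ * (d * d * δ) * ‖f‖ := by
          refine (norm_mul_le _ _).trans ?_
          gcongr
          refine (norm_mul_le _ _).trans ?_
          rw [norm_star]
          gcongr
      _ = ((d * d : ℝ) * (‖f‖ * ‖f‖)) * δ := by ring
      _ ≤ ((d * d + 1) * (‖f‖ * ‖f‖ + 1)) * δ := by
          gcongr <;> linarith
      _ = ε := by rw [hδ]; field_simp
end lemA
end part4

section part5
open Filter Topology

section alg
variable {R : Type*} [Ring R] [StarRing R]

/-- Cuntz pair -/
def ckCz (c d : R) : Prop :=
  star c * c = 1 ∧ star d * d = 1 ∧ star c * d = 0 ∧ c * star c + d * star d = 1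

lemma ckCz.dc {c d : R} (h : ckCz c d) : star d * c = 0 := by
  have := congrArg star h.2.2.1
  simpa using this

lemma ckInter (v x y : R) (hv : star v * v = 1) (h1 : star v * y * v = x)
    (h2 : star v * (star y * y) * v = star x * x) :
    star (y * v - v * x) * (y * v - v * x) = 0 := by
  have h3 : star v * star y * v = star x := by
    rw [← h1]; simp [mul_assoc]
  have e : star (y * v - v * x) * (y * v - v * x)
      = star v * (star y * y) * v - (star v * star y * v) * x - star x * (star v * y * v)
        + star x * (star v * v) * x := by
    simp only [star_sub, star_mul]; noncomm_ring
  rw [e, h1, h2, h3, hv]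
  noncomm_ring

lemma ckPair {v c d : R} (hv : star v * v = 1) (h : ckCz c d) :
    ckCz (v * c) (v * d * star v + 1 - v * star v) := by
  obtain ⟨h1, h2, h3, h4⟩ := h
  have hv' : ∀ z, star v * (v * z) = z := fun z => by rw [← mul_assoc, hv, one_mul]
  have h1' : ∀ z, star c * (c * z) = z := fun z => by rw [← mul_assoc, h1, one_mul]
  have h2' : ∀ z, star d * (d * z) = z := fun z => by rw [← mul_assoc, h2, one_mul]
  have h3' : ∀ z, star c * (d * z) = 0 := fun z => by rw [← mul_assoc, h3, zero_mul]
  have h4' : ∀ z, c * (star c * z) = z - d * (star d * z) := fun z => by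
    rw [← mul_assoc, ← mul_assoc, eq_sub_iff_add_eq, ← add_mul, h4, one_mul]
  refine ⟨?_, ?_, ?_, ?_⟩
  · simp only [star_mul, mul_assoc, hv', h1]
  · simp only [star_mul, star_sub, star_add, star_one, star_star, mul_add, add_mul, mul_sub, sub_mul,
      mul_assoc, hv', h2', mul_one, one_mul]
    abel
  · simp only [star_mul, mul_add, mul_sub, mul_assoc, hv', h3', mul_one]
    abel
  · simp only [star_mul, star_sub, star_add, star_one, star_star, mul_add, add_mul, mul_sub, sub_mul,
      mul_assoc, hv', h4', mul_one, one_mul]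
    abel

lemma ckUnit {a b a' b' : R} (h : ckCz a b) (h' : ckCz a' b') :
    (a * star b' + b * star a') * star (a * star b' + b * star a') = 1 := by
  obtain ⟨k1, k2, k3, k4⟩ := h'
  have k5 : star b' * a' = 0 := by
    have := congrArg star k3
    simpa using this
  obtain ⟨h1, h2, h3, h4⟩ := h
  have e : (a * star b' + b * star a') * star (a * star b' + b * star a')
    = a * (star b' * b') * star a + a * (star b' * a') * star b + b * (star a' * b') * star a
      + b * (star a' * a') * star b := by
    simp only [star_add, star_mul, star_star]; noncomm_ring
  rw [e, k1, k2, k3, k5]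
  simpa using h4

lemma ckCz.swap {a b : R} (h : ckCz a b) : ckCz b a :=
  ⟨h.2.1, h.1, h.dc, by rw [add_comm]; exact h.2.2.2⟩

lemma ckUnit2 {a b a' b' : R} (h : ckCz a b) (h' : ckCz a' b') :
    star (a * star b' + b * star a') * (a * star b' + b * star a') = 1 := by
  have := ckUnit h' h
  have e : star (a * star b' + b * star a') = a' * star b + b' * star a := by
    simp; abel
  rw [e]
  have e2 : star (a' * star b + b' * star a) = a * star b' + b * star a' := by
    simp; abel
  rwa [e2] at this

lemma ckInt1 {v c d x y : R} (h : y * v = v * x) (hs : star y * v = v * star x)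
    (hc : c * x = x * c) (hd : d * x = x * d) :
    y * (v * c) = v * c * x ∧
      y * (v * d * star v + 1 - v * star v) = (v * d * star v + 1 - v * star v) * y := by
  have hs' : star v * y = x * star v := by
    have := congrArg star hs
    simpa using this
  have h' : ∀ z, y * (v * z) = v * (x * z) := fun z => by rw [← mul_assoc, h, mul_assoc]
  have hd' : ∀ z, d * (x * z) = x * (d * z) := fun z => by rw [← mul_assoc, hd, mul_assoc]
  constructor
  · simp only [mul_assoc, h', hc]
  · simp only [mul_add, mul_sub, add_mul, sub_mul, mul_assoc, h', hs', hd', mul_one, one_mul]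

lemma ckInt2 {v c d v' c' d' x y : R} (h : y * v = v * x) (hs : star y * v = v * star x)
    (hc : c * x = x * c) (hd : d * x = x * d)
    (h' : x * v' = v' * y) (hs' : star x * v' = v' * star y)
    (hc' : c' * star y = star y * c') (hd' : d' * star y = star y * d') :
    y * (v * c * star (v' * d' * star v' + 1 - v' * star v')
      + (v * d * star v + 1 - v * star v) * star (v' * c'))
    = (v * c * star (v' * d' * star v' + 1 - v' * star v')
      + (v * d * star v + 1 - v * star v) * star (v' * c')) * x := by
  obtain ⟨a1, a2⟩ := ckInt1 h hs hc hd
  obtain ⟨b1, b2⟩ := ckInt1 (x := star y) (y := star x) hs' (by simpa using h') hc' hd'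
  have b1' := congrArg star b1
  have b2' := congrArg star b2
  rw [star_mul, star_mul _ (star y), star_star, star_star] at b1'
  rw [star_mul, star_mul _ (star x), star_star] at b2'
  rw [mul_add, add_mul, ← mul_assoc, a1, ← mul_assoc, a2, mul_assoc _ x, mul_assoc _ y, ← b1',
    ← b2', ← mul_assoc, ← mul_assoc]
end alg

section lemV
variable {H : Type*} [NormedAddCommGroup H] [InnerProductSpace ℂ H] [CompleteSpace H]

lemma ckStrong (A : ℕ → H →L[ℂ] H) (h : ∀ v, CauchySeq fun n => A n v) :
    ∃ L : H →L[ℂ] H, ∀ v, Tendsto (fun n => A n v) atTop (𝓝 (L v)) := by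
  choose f hf using fun v => cauchySeq_tendsto_of_complete (h v)
  exact ⟨continuousLinearMapOfTendsto A (tendsto_pi_nhds.2 hf), hf⟩

lemma ckV [Nontrivial H] [TopologicalSpace.SeparableSpace H]
    {Q : Type*} [CStarAlgebra Q] {π : (H →L[ℂ] H) →⋆ₐ[ℂ] Q}
    (hker : ∀ T : H →L[ℂ] H, π T = 0 ↔ IsCompactOperator T)
    (B₁ B₂ : ℕ → H →L[ℂ] H) (hA : ckAbs B₁ B₂) (t : ℕ → H →L[ℂ] H)
    (ht : ∀ k l, star (t k) * t l = if k = l then 1 else 0)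
    (htc : ∀ k l, t k * B₂ l = B₂ l * t k) :
    ∃ V : H →L[ℂ] H, star V * V = 1 ∧ ∀ k, π (star V * B₂ k * V - B₁ k) = 0 := by
  classical
  obtain ⟨f, fF, fn, fS, fc⟩ := ckPartition B₁
  let St := {R : Submodule ℂ H // FiniteDimensional ℂ R}
  have step : ∀ (n : ℕ) (R : St), ∃ (Z : H →L[ℂ] H) (R' : St), ckFR Z ∧
      star Z * Z = star (f n) * f n ∧ (∀ g ∈ R.1, star Z g = 0) ∧
      (∀ k ≤ n, ∀ g ∈ R.1, star Z (B₂ k g) = 0 ∧ star Z (star (B₂ k) g) = 0) ∧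
      (∀ k ≤ n, ‖star Z * B₂ k * Z - star (f n) * B₁ k * f n‖ ≤ 1 / 2 ^ n) ∧
      R.1 ≤ R'.1 ∧ ∀ v, Z v ∈ R'.1 := by
    intro n R
    have := R.2
    have hfin := Submodule.finite_finset_sup (Finset.range (n + 1)) (fun k =>
      R.1.map (B₂ k : H →ₗ[ℂ] H) ⊔ R.1.map ((star (B₂ k) : H →L[ℂ] H) : H →ₗ[ℂ] H))
    set G₁ := (Finset.range (n + 1)).sup fun k =>
      R.1.map (B₂ k : H →ₗ[ℂ] H) ⊔ R.1.map ((star (B₂ k) : H →L[ℂ] H) : H →ₗ[ℂ] H) with hG₁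
    have hle : ∀ k ≤ n, R.1.map (B₂ k : H →ₗ[ℂ] H) ⊔
        R.1.map ((star (B₂ k) : H →L[ℂ] H) : H →ₗ[ℂ] H) ≤ G₁ := fun k hk =>
      Finset.le_sup (f := fun k => R.1.map (B₂ k : H →ₗ[ℂ] H) ⊔
        R.1.map ((star (B₂ k) : H →L[ℂ] H) : H →ₗ[ℂ] H)) (by simp; omega)
    obtain ⟨Z, z1, z2, z3, z4⟩ := ckA B₁ B₂ hA t ht htc (f n) (fF n) n (R.1 ⊔ G₁) (1 / 2 ^ n)
      (by positivity)
    obtain ⟨E, _, hE⟩ := id z1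
    refine ⟨Z, ⟨R.1 ⊔ E, inferInstance⟩, z1, z2, fun g hg => z3 g (Submodule.mem_sup_left hg), ?_, z4,
      le_sup_left, fun v => Submodule.mem_sup_right (hE v)⟩
    intro k hk g hg
    constructor
    · exact z3 _ (Submodule.mem_sup_right (hle k hk (Submodule.mem_sup_left
        (Submodule.mem_map_of_mem hg))))
    · exact z3 _ (Submodule.mem_sup_right (hle k hk (Submodule.mem_sup_right
        (Submodule.mem_map_of_mem (f := ((star (B₂ k) : H →L[ℂ] H) : H →ₗ[ℂ] H)) hg))))
  choose Zf nx h1 h2 h3 h4 h5 h6 h7 using step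
  let R : ℕ → St := fun n => Nat.rec ⟨⊥, inferInstance⟩ (fun n R => nx n R) n
  let Z : ℕ → H →L[ℂ] H := fun n => Zf n (R n)
  have hRs : ∀ n, R (n + 1) = nx n (R n) := fun n => rfl
  let V : ℕ → H →L[ℂ] H := fun N => ∑ n ∈ Finset.range N, Z n
  let P : ℕ → H →L[ℂ] H := fun N => ∑ n ∈ Finset.range N, star (f n) * f n
  have hVR : ∀ N v, V N v ∈ (R N).1 := by
    intro N v
    induction N with
    | zero => simp [V]
    | succ N ih =>
      simp only [V, Finset.sum_range_succ, add_apply]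
      refine Submodule.add_mem _ ?_ ?_
      · rw [hRs]; exact h6 N (R N) ih
      · rw [hRs]; exact h7 N (R N) v
  have zV : ∀ N M, N ≤ M → star (Z M) * V N = 0 := by
    intro N M h
    have mono : ∀ N M, N ≤ M → (R N).1 ≤ (R M).1 := fun N M h =>
      monotone_nat_of_le_succ (f := fun n => (R n).1) (fun n => by
        change (R n).1 ≤ (R (n + 1)).1
        rw [hRs]; exact h6 n (R n)) h
    ext v
    exact h3 M (R M) _ (mono N M h (hVR N v))
  have Vz : ∀ N M, N ≤ M → star (V N) * Z M = 0 := by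
    intro N M h
    have := congrArg star (zV N M h)
    simpa using this
  have hVs : ∀ N, V (N + 1) = V N + Z N := fun N => Finset.sum_range_succ _ _
  have hPs : ∀ N, P (N + 1) = P N + star (f N) * f N := fun N => Finset.sum_range_succ _ _
  have VV0 : ∀ N, star (V N) * V N = P N := by
    intro N
    induction N with
    | zero => simp [V, P]
    | succ N ih =>
      rw [hVs, hPs, star_add, add_mul, mul_add, mul_add, ih, Vz N N le_rfl, zV N N le_rfl, h2]
      abel
  have VV : ∀ N M, N ≤ M → star (V N) * V M = P N := by
    intro N M h
    induction M, h using Nat.le_induction with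
    | base => exact VV0 N
    | succ M h ih => rw [hVs, mul_add, ih, Vz N M h, add_zero]
  have Psa : ∀ N, star (P N) = P N := fun N => by rw [← VV0]; simp
  have VV' : ∀ N M, N ≤ M → star (V M) * V N = P N := by
    intro N M h
    have := congrArg star (VV N M h)
    simpa [Psa] using this
  have PS : ∀ v, Tendsto (fun N => P N v) atTop (𝓝 v) := by
    intro v
    have := fS v
    simpa [P, sum_apply] using this
  have hsq : ∀ N M, N ≤ M → ∀ v, ‖V M v - V N v‖ ^ 2 ≤ ‖P M v - P N v‖ * ‖v‖ := by
    intro N M h v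
    have e : star (V M - V N) * (V M - V N) = P M - P N := by
      rw [star_sub, sub_mul, mul_sub, mul_sub, VV0, VV0, VV N M h, VV' N M h]; abel
    have : inner ℂ ((V M - V N) v) ((V M - V N) v) = inner ℂ ((P M - P N) v) v := by
      rw [← e, ← ContinuousLinearMap.adjoint_inner_left]; rfl
    have h8 : ‖(V M - V N) v‖ ^ 2 = (inner ℂ ((P M - P N) v) v).re := by
      rw [← this]; exact (inner_self_eq_norm_sq (𝕜 := ℂ) _).symm
    have h9 : (inner ℂ ((P M - P N) v) v).re ≤ ‖(P M - P N) v‖ * ‖v‖ :=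
      (Complex.re_le_norm _).trans (norm_inner_le_norm _ _)
    rw [← h8] at h9
    simpa using h9
  have VC : ∀ v, CauchySeq fun n => V n v := by
    intro v
    rw [Metric.cauchySeq_iff']
    intro ε hε
    obtain ⟨N, hN⟩ := Metric.cauchySeq_iff'.1 (PS v).cauchySeq (ε ^ 2 / (‖v‖ + 1)) (by positivity)
    refine ⟨N, fun n hn => ?_⟩
    have a1 := hN n hn
    have a2 := hsq N n hn v
    rw [dist_eq_norm] at a1 ⊢
    have a3 : ‖V n v - V N v‖ ^ 2 < ε ^ 2 := by
      refine a2.trans_lt ?_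
      rw [lt_div_iff₀ (by positivity)] at a1
      nlinarith [norm_nonneg (P n v - P N v)]
    exact lt_of_pow_lt_pow_left₀ 2 hε.le a3
  obtain ⟨L, hL⟩ := ckStrong V VC
  refine ⟨L, ?_, fun k => ?_⟩
  · ext v
    refine ext_inner_right ℂ fun w => ?_
    have a1 : Tendsto (fun N => inner ℂ (V N v) (V N w)) atTop (𝓝 (inner ℂ (L v) (L w))) :=
      (hL v).inner (hL w)
    have a2 : Tendsto (fun N => inner ℂ (V N v) (V N w)) atTop (𝓝 (inner ℂ v w)) := by
      have : ∀ N, inner ℂ (V N v) (V N w) = inner ℂ (P N v) w := by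
        intro N
        rw [← VV0, ← ContinuousLinearMap.adjoint_inner_left]; rfl
      simp only [this]
      exact (PS v).inner tendsto_const_nhds
    have a3 := tendsto_nhds_unique a1 a2
    rw [← ContinuousLinearMap.adjoint_inner_left] at a3
    exact a3
  · have PF : ∀ N, ckFR (P N) := fun N => ckFR.sum _ _ fun n _ => (fF n).mul_left _
    have VF : ∀ N, ckFR (V N) := fun N => ckFR.sum _ _ fun n _ => h1 n (R n)
    refine ckSeqCpt (fun N => star (V N) * B₂ k * V N - P N * B₁ k) _ k 3 (fun N => ?_)
      (fun N hN => ?_) (fun v w => ?_)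
    · exact (((VF N).mul_left _).sub ((PF N).mul_right _)).cpt hker
    · have z1 : star (Z N) * B₂ k * V N = 0 := by
        ext v; exact (h4 N (R N) k hN _ (hVR N v)).1
      have z2 : star (V N) * B₂ k * Z N = 0 := by
        have : star (Z N) * star (B₂ k) * V N = 0 := by
          ext v; exact (h4 N (R N) k hN _ (hVR N v)).2
        have := congrArg star this
        simpa [mul_assoc] using this
      have e : star (V (N + 1)) * B₂ k * V (N + 1) - P (N + 1) * B₁ k
          - (star (V N) * B₂ k * V N - P N * B₁ k)
          = (star (Z N) * B₂ k * Z N - star (f N) * B₁ k * f N)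
            - star (f N) * (f N * B₁ k - B₁ k * f N)
            + star (Z N) * B₂ k * V N + star (V N) * B₂ k * Z N := by
        rw [hVs, hPs, star_add]; noncomm_ring
      rw [e, z1, z2, add_zero, add_zero]
      refine (norm_sub_le _ _).trans ?_
      have a1 := h5 N (R N) k hN
      have a2 := fc k N hN
      have a3 : ‖star (f N) * (f N * B₁ k - B₁ k * f N)‖ ≤ 2 / 2 ^ N :=
        (norm_mul_le _ _).trans ((mul_le_of_le_one_left (norm_nonneg _)
          (by rw [norm_star]; exact fn N)).trans a2)
      calc _ ≤ 1 / 2 ^ N + 2 / 2 ^ N := add_le_add a1 a3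
        _ = (3 : ℝ) / 2 ^ N := by ring
    · have e1 : ∀ N, inner ℂ ((star (V N) * B₂ k * V N - P N * B₁ k) v) w
          = inner ℂ (B₂ k (V N v)) (V N w) - inner ℂ (P N (B₁ k v)) w := by
        intro N
        rw [← ContinuousLinearMap.adjoint_inner_left, ← inner_sub_left]; rfl
      have e2 : inner ℂ ((star L * B₂ k * L - B₁ k) v) w
          = inner ℂ (B₂ k (L v)) (L w) - inner ℂ (B₁ k v) w := by
        rw [← ContinuousLinearMap.adjoint_inner_left, ← inner_sub_left]; rfl
      simp only [e1, e2]
      refine Tendsto.sub ?_ ((PS _).inner tendsto_const_nhds)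
      exact (((B₂ k).continuous.tendsto _).comp (hL v)).inner (hL w)
end lemV
end part5

section part6
open Filter Topology

section good
variable {H : Type*} [NormedAddCommGroup H] [InnerProductSpace ℂ H] [CompleteSpace H]
variable {K : Type*} [NormedAddCommGroup K] [InnerProductSpace ℂ K] [CompleteSpace K]

lemma ckCountClosure {M : Type*} [Monoid M] {s : Set M} (hs : s.Countable) :
    (Submonoid.closure s : Set M).Countable := by
  have : Countable s := hs
  rw [Submonoid.closure_eq_mrange, MonoidHom.coe_mrange]
  have : Countable (FreeMonoid s) := inferInstanceAs (Countable (List s))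
  exact Set.countable_range _

noncomputable def ckC (W : H →L[ℂ] K) (a : K →L[ℂ] K) : H →L[ℂ] H :=
  (ContinuousLinearMap.adjoint W).comp (a.comp W)

structure ckGood (S : Set (K →L[ℂ] K)) (W : H →L[ℂ] K) : Prop where
  iso : (ContinuousLinearMap.adjoint W).comp W = 1
  comm : ∀ a ∈ S, (W.comp (ContinuousLinearMap.adjoint W)) * a
    = a * (W.comp (ContinuousLinearMap.adjoint W))
  abs : ∀ (d : ℕ) (e : Fin d → K), Orthonormal ℂ e → ∀ F : Finset (K →L[ℂ] K),
    (F : Set (K →L[ℂ] K)) ⊆ Submonoid.closure S → ∀ δ : ℝ, 0 < δ →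
    ∃ y : Fin d → H, Orthonormal ℂ y ∧ ∀ a ∈ F, ∀ i j,
      ‖inner ℂ (y i) (ckC W a (y j)) - inner ℂ (e i) (a (e j))‖ ≤ δ

lemma ckGood.mono {S S' : Set (K →L[ℂ] K)} {W : H →L[ℂ] K} (h : ckGood S W) (hS : S' ⊆ S) :
    ckGood S' W :=
  ⟨h.iso, fun a ha => h.comm a (hS ha), fun d e he F hF δ hδ => h.abs d e he F
    (hF.trans (Submonoid.closure_mono hS)) δ hδ⟩

lemma ckGood.comm' {S : Set (K →L[ℂ] K)} {W : H →L[ℂ] K} (h : ckGood S W) {a : K →L[ℂ] K}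
    (ha : a ∈ Submonoid.closure S) : (W.comp (ContinuousLinearMap.adjoint W)) * a
    = a * (W.comp (ContinuousLinearMap.adjoint W)) := by
  induction ha using Submonoid.closure_induction with
  | mem x hx => exact h.comm x hx
  | one => simp
  | mul x y _ _ hx hy => rw [← mul_assoc, hx, mul_assoc, hy, mul_assoc]

lemma ckC_star (W : H →L[ℂ] K) (a : K →L[ℂ] K) : ckC W (star a) = star (ckC W a) := by
  simp only [ckC, ContinuousLinearMap.star_eq_adjoint, ContinuousLinearMap.adjoint_comp,
    ContinuousLinearMap.adjoint_adjoint]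
  rfl

lemma ckGood.mul {S : Set (K →L[ℂ] K)} {W : H →L[ℂ] K} (h : ckGood S W) {a : K →L[ℂ] K}
    (ha : a ∈ Submonoid.closure S) (b : K →L[ℂ] K) : ckC W (a * b) = ckC W a * ckC W b := by
  have h1 := h.comm' ha
  ext v
  have h2 := congrArg (fun A : K →L[ℂ] K => ContinuousLinearMap.adjoint W (A (b (W v)))) h1
  have h3 := congrArg (fun A : H →L[ℂ] H => A (ContinuousLinearMap.adjoint W (a (b (W v))))) h.iso
  change ContinuousLinearMap.adjoint W (W (ContinuousLinearMap.adjoint W (a (b (W v))))) =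
    ContinuousLinearMap.adjoint W (a (W (ContinuousLinearMap.adjoint W (b (W v))))) at h2
  change ContinuousLinearMap.adjoint W (W (ContinuousLinearMap.adjoint W (a (b (W v))))) =
    ContinuousLinearMap.adjoint W (a (b (W v))) at h3
  exact h3.symm.trans h2

lemma ckGood.one {S : Set (K →L[ℂ] K)} {W : H →L[ℂ] K} (h : ckGood S W) : ckC W 1 = 1 := h.iso

lemma ckC_add (W : H →L[ℂ] K) (a b : K →L[ℂ] K) : ckC W (a + b) = ckC W a + ckC W b := by
  ext v; simp [ckC]

lemma ckC_zero (W : H →L[ℂ] K) : ckC W 0 = 0 := by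
  ext v; simp [ckC]

lemma ckC_smul (W : H →L[ℂ] K) (l : ℂ) (a : K →L[ℂ] K) : ckC W (l • a) = l • ckC W a := by
  ext v; simp [ckC]

lemma ckC_inner (W : H →L[ℂ] K) (a : K →L[ℂ] K) (v w : H) :
    inner ℂ v (ckC W a w) = inner ℂ (W v) (a (W w)) := by
  rw [← ContinuousLinearMap.adjoint_inner_right]; rfl

lemma ckGood.cz {S : Set (K →L[ℂ] K)} {W : H →L[ℂ] K} (h : ckGood S W) {c d : K →L[ℂ] K}
    (hS : ∀ a ∈ S, star a ∈ S) (hc : c ∈ S) (hd : d ∈ S) (hz : ckCz c d) :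
    ckCz (ckC W c) (ckC W d) := by
  have s : ∀ a ∈ S, a ∈ Submonoid.closure S := fun a ha => Submonoid.subset_closure ha
  refine ⟨?_, ?_, ?_, ?_⟩
  · rw [← ckC_star, ← h.mul (s _ (hS _ hc)), hz.1, h.one]
  · rw [← ckC_star, ← h.mul (s _ (hS _ hd)), hz.2.1, h.one]
  · rw [← ckC_star, ← h.mul (s _ (hS _ hc)), hz.2.2.1, ckC_zero]
  · rw [← ckC_star, ← ckC_star, ← h.mul (s _ hc), ← h.mul (s _ hd), ← ckC_add, hz.2.2.2, h.one]

lemma ckCz.fam {R : Type*} [Ring R] [StarRing R] {c d : R} (h : ckCz c d) (k l : ℕ) :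
    star (d ^ k * c) * (d ^ l * c) = if k = l then 1 else 0 := by
  obtain ⟨h1, h2, h3, h4⟩ := id h
  have hd : ∀ n (z : R), star d ^ n * (d ^ n * z) = z := by
    intro n
    induction n with
    | zero => simp
    | succ n ih =>
      intro z
      rw [pow_succ, pow_succ', mul_assoc, mul_assoc, ← mul_assoc (star d), h2, one_mul, ih]
  rcases lt_trichotomy k l with hkl | rfl | hkl
  · obtain ⟨m, rfl⟩ : ∃ m, l = k + (m + 1) := ⟨l - k - 1, by omega⟩
    rw [if_neg (by omega), star_mul, star_pow, pow_add, mul_assoc, mul_assoc, hd, pow_succ',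
      mul_assoc, ← mul_assoc, h3, zero_mul]
  · rw [if_pos rfl, star_mul, star_pow, mul_assoc, hd, h1]
  · obtain ⟨m, rfl⟩ : ∃ m, k = l + (m + 1) := ⟨k - l - 1, by omega⟩
    have : star d ^ (l + (m + 1)) = star d ^ m * star d * star d ^ l := by
      rw [add_comm, pow_add, pow_succ]
    rw [if_neg (by omega), star_mul, star_pow, this, mul_assoc, mul_assoc, hd, mul_assoc, h.dc,
      mul_zero, mul_zero]

lemma ckGood.orth {S : Set (K →L[ℂ] K)} {W : H →L[ℂ] K} (h : ckGood S W) (v w : H) :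
    inner ℂ (W v) (W w) = inner ℂ v w := by
  rw [← ContinuousLinearMap.adjoint_inner_right]
  exact congrArg (fun A : H →L[ℂ] H => inner ℂ v (A w)) h.iso

lemma ckGood.orthonormal {S : Set (K →L[ℂ] K)} {W : H →L[ℂ] K} (h : ckGood S W) {ι : Type*}
    {r : ι → H} (hr : Orthonormal ℂ r) : Orthonormal ℂ (fun i => W (r i)) := by
  classical
  rw [orthonormal_iff_ite] at hr ⊢
  intro i j
  rw [h.orth, hr]

lemma ckGoodV [Nontrivial H] [TopologicalSpace.SeparableSpace H]
    {Q : Type*} [CStarAlgebra Q] {π : (H →L[ℂ] H) →⋆ₐ[ℂ] Q}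
    (hker : ∀ T : H →L[ℂ] H, π T = 0 ↔ IsCompactOperator T)
    {S R : Set (K →L[ℂ] K)} {W₁ W₂ : H →L[ℂ] K} (h₁ : ckGood S W₁) (h₂ : ckGood S W₂)
    (hS : ∀ a ∈ S, star a ∈ S) (hR : ∀ a ∈ R, star a ∈ R) (hRS : R ⊆ S) (hRc : R.Countable)
    {c d : K →L[ℂ] K} (hc : c ∈ S) (hd : d ∈ S) (hz : ckCz c d)
    (hcR : ∀ a ∈ R, c * a = a * c) (hdR : ∀ a ∈ R, d * a = a * d) :
    ∃ V : H →L[ℂ] H, star V * V = 1 ∧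
      ∀ a ∈ R, π (ckC W₂ a) * π V = π V * π (ckC W₁ a) := by
  classical
  have s : ∀ a ∈ S, a ∈ Submonoid.closure S := fun a ha => Submonoid.subset_closure ha
  obtain ⟨a, ha⟩ := (ckCountClosure hRc).exists_eq_range ⟨1, Submonoid.one_mem _⟩
  have haR : ∀ k, a k ∈ Submonoid.closure R := fun k => by
    have : a k ∈ Set.range a := ⟨k, rfl⟩
    rw [← ha] at this; exact this
  have haS : ∀ k, a k ∈ Submonoid.closure S := fun k => Submonoid.closure_mono hRS (haR k)
  have hcom : ∀ k, c * a k = a k * c ∧ d * a k = a k * d := by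
    intro k
    have := haR k
    generalize a k = x at this
    induction this using Submonoid.closure_induction with
    | mem x hx => exact ⟨hcR x hx, hdR x hx⟩
    | one => simp
    | mul x y _ _ hx hy =>
      exact ⟨by rw [← mul_assoc, hx.1, mul_assoc, hy.1, mul_assoc],
        by rw [← mul_assoc, hx.2, mul_assoc, hy.2, mul_assoc]⟩
  have cc : ∀ k, ckC W₂ c * ckC W₂ (a k) = ckC W₂ (a k) * ckC W₂ c := fun k => by
    rw [← h₂.mul (s _ hc), (hcom k).1, h₂.mul (haS k)]
  have dd : ∀ k, ckC W₂ d * ckC W₂ (a k) = ckC W₂ (a k) * ckC W₂ d := fun k => by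
    rw [← h₂.mul (s _ hd), (hcom k).2, h₂.mul (haS k)]
  obtain ⟨V, hV, hVk⟩ := ckV hker (fun k => ckC W₁ (a k)) (fun k => ckC W₂ (a k)) (by
      intro n r hr N δ hδ
      obtain ⟨y, hy, hy2⟩ := h₂.abs n (fun i => W₁ (r i)) (h₁.orthonormal hr)
        ((Finset.range (N + 1)).image a) (by
          intro x hx
          simp only [Finset.coe_image] at hx
          obtain ⟨k, _, rfl⟩ := hx
          exact haS k) δ hδ
      refine ⟨y, hy, fun k hk i j => ?_⟩
      have := hy2 (a k) (Finset.mem_image_of_mem _ (by simp; omega)) i j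
      rwa [← ckC_inner W₁] at this)
    (fun k => ckC W₂ d ^ k * ckC W₂ c) (h₂.cz hS hc hd hz).fam
    (fun k l => by
      have h1 : Commute (ckC W₂ d ^ k) (ckC W₂ (a l)) := Commute.pow_left (dd l) k
      exact Commute.mul_left h1 (cc l))
  have hVk' : ∀ x ∈ Submonoid.closure R, star (π V) * π (ckC W₂ x) * π V = π (ckC W₁ x) := by
    intro x hx
    have : x ∈ Set.range a := by rw [← ha]; exact hx
    obtain ⟨k, rfl⟩ := this
    have := hVk k
    rw [map_sub, sub_eq_zero] at this
    simpa [map_star] using this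
  refine ⟨V, hV, fun x hx => ?_⟩
  have sR : ∀ a ∈ R, a ∈ Submonoid.closure R := fun a ha => Submonoid.subset_closure ha
  have key := ckInter (π V) (π (ckC W₁ x)) (π (ckC W₂ x))
    (by rw [← map_star, ← map_mul, hV, map_one]) (hVk' x (sR x hx)) (by
      have := hVk' (star x * x) (mul_mem (sR _ (hR x hx)) (sR x hx))
      rw [h₂.mul (s _ (hS _ (hRS hx))), h₁.mul (s _ (hS _ (hRS hx))), ckC_star, ckC_star,
        map_mul, map_mul, map_star, map_star] at this
      exact this)
  rw [CStarRing.star_mul_self_eq_zero_iff, sub_eq_zero] at key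
  exact key

lemma ckGoodU [Nontrivial H] [TopologicalSpace.SeparableSpace H]
    {Q : Type*} [CStarAlgebra Q] {π : (H →L[ℂ] H) →⋆ₐ[ℂ] Q}
    (hker : ∀ T : H →L[ℂ] H, π T = 0 ↔ IsCompactOperator T)
    {S R : Set (K →L[ℂ] K)} {W₁ W₂ : H →L[ℂ] K} (h₁ : ckGood S W₁) (h₂ : ckGood S W₂)
    (hS : ∀ a ∈ S, star a ∈ S) (hR : ∀ a ∈ R, star a ∈ R) (hRS : R ⊆ S) (hRc : R.Countable)
    {c d : K →L[ℂ] K} (hc : c ∈ S) (hd : d ∈ S) (hz : ckCz c d)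
    (hcR : ∀ a ∈ R, c * a = a * c) (hdR : ∀ a ∈ R, d * a = a * d) :
    ∃ u : H →L[ℂ] H, star u * u = 1 ∧ u * star u = 1 ∧
      ∀ a ∈ R, π (ckC W₂ a) * π u = π u * π (ckC W₁ a) := by
  obtain ⟨V, hV, hVa⟩ := ckGoodV hker h₁ h₂ hS hR hRS hRc hc hd hz hcR hdR
  obtain ⟨V', hV', hVa'⟩ := ckGoodV hker h₂ h₁ hS hR hRS hRc hc hd hz hcR hdR
  have s : ∀ a ∈ S, a ∈ Submonoid.closure S := fun a ha => Submonoid.subset_closure ha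
  have p1 := ckPair hV (h₁.cz hS hc hd hz)
  have p2 := ckPair hV' (h₂.cz hS hc hd hz)
  refine ⟨_, ckUnit2 p1 p2, ckUnit p1 p2, fun a ha => ?_⟩
  have cm : ∀ (W : H →L[ℂ] K) (h : ckGood S W), ∀ x ∈ R,
      π (ckC W c) * π (ckC W x) = π (ckC W x) * π (ckC W c) ∧
      π (ckC W d) * π (ckC W x) = π (ckC W x) * π (ckC W d) := by
    intro W h x hx
    rw [← map_mul, ← map_mul, ← map_mul, ← map_mul, ← h.mul (s _ hc), ← h.mul (s _ (hRS hx)),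
      ← h.mul (s _ hd), ← h.mul (s _ (hRS hx)), hcR x hx, hdR x hx]
    exact ⟨rfl, rfl⟩
  have ss : ∀ (W : H →L[ℂ] K), star (π (ckC W a)) = π (ckC W (star a)) := fun W => by
    rw [ckC_star, map_star]
  have key := ckInt2 (c' := π (ckC W₂ c)) (d' := π (ckC W₂ d)) (hVa a ha) (by rw [ss, ss]; exact hVa _ (hR a ha))
    (cm W₁ h₁ a ha).1 (cm W₁ h₁ a ha).2 (hVa' a ha) (by rw [ss, ss]; exact hVa' _ (hR a ha))
    (by rw [ss]; exact (cm W₂ h₂ _ (hR a ha)).1) (by rw [ss]; exact (cm W₂ h₂ _ (hR a ha)).2)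
  simpa [map_star] using key
end good
end part6

section part7
open Filter Topology

section swindle
variable {R : Type*} [Ring R] [StarRing R]

def ckX (g x : R) : R := g * x * star g + 1 - g * star g

lemma ckX_mul {g : R} (hg : star g * g = 1) (x y : R) : ckX g x * ckX g y = ckX g (x * y) := by
  have hg' : ∀ z, star g * (g * z) = z := fun z => by rw [← mul_assoc, hg, one_mul]
  simp only [ckX, mul_add, add_mul, mul_sub, sub_mul, mul_assoc, hg', mul_one, one_mul]
  abel

lemma ckX_one {g : R} : ckX g 1 = 1 := by simp [ckX]

lemma ckX_star (g x : R) : star (ckX g x) = ckX g (star x) := by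
  simp [ckX, mul_assoc]

lemma ckX_comp (g h x : R) : ckX (g * h) x = ckX g (ckX h x) := by
  simp only [ckX, star_mul]; noncomm_ring

lemma ckX_split {c d x : R} (h : ckCz c d) (hc : c * x = x * c) (hd : d * x = x * d) :
    ckX c x * ckX d x = x := by
  obtain ⟨h1, h2, h3, h4⟩ := h
  have h3' : ∀ z, star c * (d * z) = 0 := fun z => by rw [← mul_assoc, h3, zero_mul]
  have e : ckX c x * ckX d x = x * (c * star c + d * star d) + 1 - (c * star c + d * star d) := by
    have hd' : ∀ z, x * (d * z) = d * (x * z) := fun z => by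
      rw [← mul_assoc, ← hd, mul_assoc]
    have hc' : ∀ z, x * (c * z) = c * (x * z) := fun z => by
      rw [← mul_assoc, ← hc, mul_assoc]
    simp only [ckX, mul_add, add_mul, mul_sub, sub_mul]
    simp only [mul_assoc, hd', hc', h3', mul_one, one_mul, mul_zero]
    abel
  rw [e, h4]; simp

def ckSym (D : Set R) : Set R := {r | star r = r ∧ r * r = 1 ∧ ∀ a ∈ D, r * a = a * r}

lemma ckX_comm {g x a : R} (hx : Commute x a) (hg : Commute g a) (hg' : Commute (star g) a) :
    Commute (ckX g x) a := by
  unfold ckX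
  exact (((hg.mul_left hx).mul_left hg').add_left (Commute.one_left a)).sub_left (hg.mul_left hg')

lemma ckSw1 (D : Set R) {g h x : R} (hg : star g * g = 1) (hh : star h * h = 1)
    (hgh : star g * h = 0) (hx : star x * x = 1) (hx' : x * star x = 1)
    (cg : ∀ a ∈ D, Commute g a ∧ Commute (star g) a)
    (chh : ∀ a ∈ D, Commute h a ∧ Commute (star h) a)
    (cx : ∀ a ∈ D, Commute x a ∧ Commute (star x) a) :
    ckX g x * ckX h (star x) ∈ Submonoid.closure (ckSym D) := by
  have hhg : star h * g = 0 := by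
    have := congrArg star hgh
    simpa using this
  have g1 : ∀ z, star g * (g * z) = z := fun z => by rw [← mul_assoc, hg, one_mul]
  have h1 : ∀ z, star h * (h * z) = z := fun z => by rw [← mul_assoc, hh, one_mul]
  have gh : ∀ z, star g * (h * z) = 0 := fun z => by rw [← mul_assoc, hgh, zero_mul]
  have hg1 : ∀ z, star h * (g * z) = 0 := fun z => by rw [← mul_assoc, hhg, zero_mul]
  set T := h * star g + g * star h + 1 - g * star g - h * star h with hT
  have Ts : star T = T := by simp [hT]; abel
  have TT : T * T = 1 := by
    simp only [hT, mul_add, add_mul, mul_sub, sub_mul, mul_assoc, g1, h1, gh, hg1, mul_one, one_mul,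
      mul_zero]
    abel
  have Tg : T * g = h := by
    simp only [hT, add_mul, sub_mul, mul_assoc, hg, hhg, mul_one, one_mul, mul_zero]
    abel
  have TX : T * ckX g (star x) * T = ckX h (star x) := by
    have Tg' : star g * T = star h := by
      have := congrArg star Tg
      simpa [Ts] using this
    have : T * ckX g (star x) * T = (T * g) * star x * (star g * T) + T * T
        - (T * g) * (star g * T) := by
      simp only [ckX]; noncomm_ring
    rw [this, Tg, Tg', TT, ckX]
  have hXX : ckX g (star x) * ckX g x = 1 := by rw [ckX_mul hg, hx, ckX_one]
  have hXX' : ckX g x * ckX g (star x) = 1 := by rw [ckX_mul hg, hx', ckX_one]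
  have e : ckX g x * ckX h (star x) = (ckX g x * T * ckX g (star x)) * T := by
    rw [← TX]; noncomm_ring
  have cT : ∀ a ∈ D, Commute T a := fun a ha => by
    rw [hT]
    exact ((((chh a ha).1.mul_left (cg a ha).2).add_left ((cg a ha).1.mul_left (chh a ha).2)).add_left
      (Commute.one_left a)).sub_left ((cg a ha).1.mul_left (cg a ha).2) |>.sub_left
      ((chh a ha).1.mul_left (chh a ha).2)
  rw [e]
  refine mul_mem (Submonoid.subset_closure ⟨?_, ?_, fun a ha => ?_⟩)
    (Submonoid.subset_closure ⟨Ts, TT, fun a ha => cT a ha⟩)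
  · simp only [star_mul, ckX_star, star_star, Ts, mul_assoc]
  · have : ckX g x * T * ckX g (star x) * (ckX g x * T * ckX g (star x))
        = ckX g x * (T * (ckX g (star x) * ckX g x) * T) * ckX g (star x) := by noncomm_ring
    rw [this, hXX, mul_one, TT, mul_one, hXX']
  · exact ((ckX_comm (cx a ha).1 (cg a ha).1 (cg a ha).2).mul_left (cT a ha)).mul_left
      (ckX_comm (cx a ha).2 (cg a ha).1 (cg a ha).2)

lemma ckSwindle (D : Set R) {c d x : R} (h : ckCz c d) (hx : star x * x = 1) (hx' : x * star x = 1)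
    (hc : c * x = x * c) (hd : d * x = x * d)
    (cc : ∀ a ∈ D, Commute c a ∧ Commute (star c) a)
    (cd : ∀ a ∈ D, Commute d a ∧ Commute (star d) a)
    (cx : ∀ a ∈ D, Commute x a) :
    x ∈ Submonoid.closure (ckSym D) := by
  obtain ⟨h1, h2, h3, h4⟩ := id h
  have cx' : ∀ a ∈ D, Commute x a ∧ Commute (star x) a := fun a ha => ⟨cx a ha, by
    have : x * a = a * x := cx a ha
    change star x * a = a * star x
    calc star x * a = star x * (a * x) * star x := by rw [mul_assoc, mul_assoc, hx', mul_one]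
      _ = (star x * x) * a * star x := by rw [← this]; noncomm_ring
      _ = a * star x := by rw [hx, one_mul]⟩
  have iso : ∀ g : R, star g * g = 1 → star (d * g) * (d * g) = 1 := fun g hg => by
    rw [star_mul, mul_assoc, ← mul_assoc (star d), h2, one_mul, hg]
  have cm : ∀ g : R, (∀ a ∈ D, Commute g a ∧ Commute (star g) a) →
      ∀ a ∈ D, Commute (d * g) a ∧ Commute (star (d * g)) a := fun g hg a ha => by
    rw [star_mul]
    exact ⟨(cd a ha).1.mul_left (hg a ha).1, (hg a ha).2.mul_left (cd a ha).2⟩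
  have or : ∀ g : R, star c * (d * g) = 0 := fun g => by rw [← mul_assoc, h3, zero_mul]
  have s1 := ckSw1 D h1 (iso c h1) (or c) hx hx' cc (cm c cc) cx'
  have s2 := ckSw1 D h2 h1 h.dc hx hx' cd cc cx'
  have s3 := ckSw1 D h1 (iso d h2) (or d) hx hx' cc (cm d cd) cx'
  have e : ckX c x = (ckX c x * ckX (d * c) (star x)) * (ckX d x * ckX c (star x)) *
      (ckX c x * ckX (d * d) (star x)) := by
    have e1 : ckX d x = ckX (d * c) x * ckX (d * d) x := by
      rw [ckX_comp, ckX_comp, ckX_mul h2, ckX_split h hc hd]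
    have e2 : ckX (d * c) (star x) * ckX (d * c) x = 1 := by
      rw [ckX_mul (iso c h1), hx, ckX_one]
    have e3 : ckX (d * d) x * ckX (d * d) (star x) = 1 := by
      rw [ckX_mul (iso d h2), hx', ckX_one]
    have e4 : ckX c (star x) * ckX c x = 1 := by
      rw [ckX_mul h1, hx, ckX_one]
    symm
    calc _ = ckX c x * (ckX (d * c) (star x) * ckX (d * c) x) *
          (ckX (d * d) x * (ckX c (star x) * ckX c x) * ckX (d * d) (star x)) := by
            rw [e1]; simp only [mul_assoc]
      _ = _ := by rw [e2, e4, mul_one, mul_one, e3, mul_one]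
  have m1 : ckX c x ∈ Submonoid.closure (ckSym D) := by
    rw [e]; exact mul_mem (mul_mem s1 s2) s3
  have m2 : ckX d x ∈ Submonoid.closure (ckSym D) := by
    have : ckX d x = (ckX d x * ckX c (star x)) * ckX c x := by
      rw [mul_assoc, ckX_mul h1, hx, ckX_one, mul_one]
    rw [this]; exact mul_mem s2 m1
  rw [← ckX_split h hc hd]
  exact mul_mem m1 m2
end swindle

section modif
variable {H : Type*} [NormedAddCommGroup H] [InnerProductSpace ℂ H] [CompleteSpace H]

lemma ckApprox (k : H →L[ℂ] H) (hk : IsCompactOperator k) (η : ℝ) (hη : 0 < η) :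
    ∃ E : Submodule ℂ H, FiniteDimensional ℂ E ∧ ∀ c : H →L[ℂ] H, ‖c‖ ≤ 1 → (∀ g ∈ E, c g = 0) →
      ‖c * k‖ ≤ η := by
  obtain ⟨C, hC, hCk⟩ := IsCompactOperator.image_closedBall_subset_compact (f := (k : H →ₗ[ℂ] H)) hk 1
  obtain ⟨N, _, hNf, hN⟩ := hC.finite_cover_balls hη
  refine ⟨Submodule.span ℂ N, FiniteDimensional.span_of_finite ℂ hNf, fun c hc hcE => ?_⟩
  refine ContinuousLinearMap.opNorm_le_of_unit_norm (𝕜 := ℂ) hη.le fun v hv => ?_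
  have hv' : k v ∈ C := hCk ⟨v, by simp [hv], rfl⟩
  obtain ⟨g, hg, hg2⟩ := Set.mem_iUnion₂.1 (hN hv')
  have : (c * k) v = c (k v - g) := by
    rw [map_sub, hcE g (Submodule.subset_span hg), sub_zero]; rfl
  rw [this]
  refine (c.le_opNorm _).trans ((mul_le_of_le_one_left (norm_nonneg _) hc).trans ?_)
  rw [← dist_eq_norm]
  exact (Metric.mem_ball.1 hg2).le

def ckMod {Q : Type*} [CStarAlgebra Q] (π : (H →L[ℂ] H) →⋆ₐ[ℂ] Q) (D : Set (H →L[ℂ] H)) (x : Q) :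
    Prop :=
  ∀ (G : Finset H) (F : Finset (H →L[ℂ] H)), (F : Set (H →L[ℂ] H)) ⊆ D → ∀ ε : ℝ, 0 < ε →
    ∃ X : H →L[ℂ] H, star X * X = 1 ∧ X * star X = 1 ∧ π X = x ∧ (∀ v ∈ G, ‖X v - v‖ ≤ ε) ∧
      ∀ a ∈ F, ‖X * a - a * X‖ ≤ ε

lemma ckUnitNorm [Nontrivial H] {X : H →L[ℂ] H} (h1 : star X * X = 1) (h2 : X * star X = 1) :
    ‖X‖ = 1 := CStarRing.norm_of_mem_unitary (Unitary.mem_iff.2 ⟨h1, h2⟩)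

lemma ckModMul [Nontrivial H] {Q : Type*} [CStarAlgebra Q] {π : (H →L[ℂ] H) →⋆ₐ[ℂ] Q}
    {D : Set (H →L[ℂ] H)} {x y : Q} (hx : ckMod π D x) (hy : ckMod π D y) : ckMod π D (x * y) := by
  intro G F hF ε hε
  obtain ⟨X, x1, x2, x3, x4, x5⟩ := hx G F hF (ε / 2) (by positivity)
  obtain ⟨Y, y1, y2, y3, y4, y5⟩ := hy G F hF (ε / 2) (by positivity)
  have nX := ckUnitNorm x1 x2
  have nY := ckUnitNorm y1 y2
  refine ⟨X * Y, ?_, ?_, ?_, ?_, ?_⟩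
  · rw [star_mul, mul_assoc, ← mul_assoc (star X), x1, one_mul, y1]
  · rw [star_mul, mul_assoc, ← mul_assoc Y, y2, one_mul, x2]
  · rw [map_mul, x3, y3]
  · intro v hv
    have e : (X * Y) v - v = X (Y v - v) + (X v - v) := by
      rw [map_sub, sub_add_sub_cancel]; rfl
    rw [e]
    have h1 := X.le_opNorm (Y v - v)
    rw [nX, one_mul] at h1
    have h2 := norm_add_le (X (Y v - v)) (X v - v)
    linarith [x4 v hv, y4 v hv]
  · intro a ha
    have e : X * Y * a - a * (X * Y) = (X * a - a * X) * Y + X * (Y * a - a * Y) := by noncomm_ring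
    rw [e]
    have h1 := norm_mul_le (X * a - a * X) Y
    have h2 := norm_mul_le X (Y * a - a * Y)
    rw [nY, mul_one] at h1
    rw [nX, one_mul] at h2
    have h3 := norm_add_le ((X * a - a * X) * Y) (X * (Y * a - a * Y))
    linarith [x5 a ha, y5 a ha]

lemma ckModSym [Nontrivial H] {Q : Type*} [CStarAlgebra Q] {π : (H →L[ℂ] H) →⋆ₐ[ℂ] Q}
    (hsurj : Function.Surjective π)
    (hker : ∀ T : H →L[ℂ] H, π T = 0 ↔ IsCompactOperator T)
    (D : Set (H →L[ℂ] H)) {r : Q} (hr : r ∈ ckSym (π '' D)) : ckMod π D r := by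
  obtain ⟨rs, rr, rD⟩ := hr
  intro G F hF ε hε
  set P : Q := (2 : ℂ)⁻¹ • (1 - r) with hP
  have Ps : star P = P := by
    rw [hP, star_smul, star_sub, star_one, rs]; simp
  have PP : P * P = P := by
    rw [hP, smul_mul_smul_comm]
    have : (1 - r) * (1 - r) = (2 : ℂ) • (1 - r) := by
      rw [two_smul, mul_sub, sub_mul, sub_mul, rr]; simp; abel
    rw [this, smul_smul]; norm_num
  obtain ⟨h0, hh0⟩ := hsurj P
  set h : H →L[ℂ] H := (2 : ℂ)⁻¹ • (h0 + star h0) with hh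
  have hs : star h = h := by
    rw [hh, star_smul, star_add, star_star, add_comm]; simp
  have hπ : π h = P := by
    rw [hh, map_smul, map_add, map_star, hh0, Ps, ← two_smul ℂ, smul_smul]; norm_num
  -- compactness of commutators
  have hcp : ∀ a ∈ F, IsCompactOperator (h * a - a * h) := by
    intro a ha
    rw [← hker, map_sub, map_mul, map_mul, hπ, hP, smul_mul_assoc, mul_smul_comm, sub_mul, mul_sub,
      rD _ ⟨a, hF ha, rfl⟩]
    simp
  set M : ℝ := Real.exp (4 * ‖h‖) * (4 * (2 * ‖h‖ + 1)) with hM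
  have hMp : 0 < M := by positivity
  set η := ε / M with hη
  have hηp : 0 < η := by positivity
  classical
  choose! E hEf hE using fun a (ha : a ∈ F) => ckApprox (h * a - a * h) (hcp a ha) η hηp
  have f1 : FiniteDimensional ℂ (Submodule.span ℂ (G : Set H)) := FiniteDimensional.span_finset ℂ G
  have f2 : FiniteDimensional ℂ (F.attach.sup fun a => E a.1 : Submodule ℂ H) := by
    have := fun i : F => hEf i.1 i.2
    exact Submodule.finite_finset_sup _ _
  obtain ⟨s, c, _, cs, _, _, cF, _, cn, cG, cb⟩ :=
    ckQC (Submodule.span ℂ (G : Set H) ⊔ F.attach.sup fun a => E a.1) F η hηp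
  have cE : ∀ a ∈ F, ∀ g ∈ E a, c g = 0 := fun a ha g hg => cG g (Submodule.mem_sup_right
    (Finset.le_sup (f := fun a : F => E a.1) (Finset.mem_attach F ⟨a, ha⟩) hg))
  have πc : π c = 1 := by
    have := cF.cpt hker
    rw [map_sub, map_one, sub_eq_zero] at this
    exact this.symm
  set q := c * h * c with hq
  have qn : ‖q‖ ≤ ‖h‖ := by
    refine (norm_mul_le _ _).trans ((mul_le_of_le_one_right (norm_nonneg _) cn).trans ?_)
    exact (norm_mul_le _ _).trans (mul_le_of_le_one_left (norm_nonneg _) cn)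
  set y : H →L[ℂ] H := (Complex.I * Real.pi) • q with hy
  have npi : ‖Complex.I * (Real.pi : ℂ)‖ ≤ 4 := by
    rw [norm_mul, Complex.norm_I, one_mul, Complex.norm_real, Real.norm_of_nonneg Real.pi_pos.le]
    exact Real.pi_le_four
  have hyn : ‖y‖ ≤ 4 * ‖h‖ := by
    rw [hy, norm_smul]
    gcongr
  have hys : star y = -y := by
    have qs : star q = q := by rw [hq, star_mul, star_mul, hs, cs, mul_assoc]
    rw [hy, star_smul, qs, ← neg_smul]; congr 1; simp
  have st : star (NormedSpace.exp y) = NormedSpace.exp (-y) := by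
    rw [NormedSpace.star_exp, hys]
  refine ⟨NormedSpace.exp y, ?_, ?_, ?_, ?_, ?_⟩
  · rw [st]
    have := ckExpNeg (-y)
    rwa [neg_neg] at this
  · rw [st]; exact ckExpNeg y
  · have e1 : π (NormedSpace.exp y) = NormedSpace.exp (π y) := by
      letI : NormedAlgebra ℚ (H →L[ℂ] H) := NormedAlgebra.restrictScalars ℚ ℂ _
      letI : NormedAlgebra ℚ Q := NormedAlgebra.restrictScalars ℚ ℂ _
      exact NormedSpace.map_exp π (ckPiCont π) y
    have e2 : π y = (Complex.I * Real.pi) • P := by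
      rw [hy, map_smul, hq, map_mul, map_mul, πc, hπ]; simp
    rw [e1, e2]
    have e3 := ckExpEig ((Complex.I * Real.pi) • P) P (Complex.I * Real.pi)
      (by rw [smul_mul_assoc, PP])
    have e4 := ckExpEig ((Complex.I * Real.pi) • P) (1 - P) 0
      (by rw [smul_mul_assoc, mul_sub, PP]; simp)
    rw [mul_comm Complex.I, Complex.exp_pi_mul_I] at e3
    rw [mul_comm Complex.I, Complex.exp_zero] at e4
    have e5 := congrArg₂ (· + ·) e3 e4
    simp only [← mul_add, add_sub_cancel, mul_one] at e5
    rw [mul_comm Complex.I, e5, hP]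
    rw [smul_sub]
    module
  · intro v hv
    have hv' : v ∈ Submodule.span ℂ (G : Set H) := Submodule.subset_span hv
    set p := (Submodule.span ℂ (G : Set H)).starProjection
    have cp : c * p = 0 := by
      ext w
      exact cG _ (Submodule.mem_sup_left (Submodule.starProjection_apply_mem _ _))
    have e := ckExpEig y p 0 (by
      rw [hy, smul_mul_assoc, hq, mul_assoc, cp]; simp)
    rw [Complex.exp_zero, one_smul] at e
    have e' : NormedSpace.exp y (p v) = p v := congrArg (fun A : H →L[ℂ] H => A v) e
    rw [Submodule.starProjection_eq_self_iff.2 hv'] at e'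
    rw [e', sub_self, norm_zero]
    exact hε.le
  · intro a ha
    refine (ckExpComm y a).trans ?_
    have b1 := (cb a ha).2
    have b2 := hE a ha c cn (cE a ha)
    have e : q * a - a * q = (c * a - a * c) * (h * c) + (c * (h * a - a * h)) * c
        + (c * h) * (c * a - a * c) := by rw [hq]; noncomm_ring
    have b3 : ‖q * a - a * q‖ ≤ (2 * ‖h‖ + 1) * η := by
      rw [e]
      have n1 : ‖h * c‖ ≤ ‖h‖ := (norm_mul_le _ _).trans (mul_le_of_le_one_right (norm_nonneg _) cn)
      have n2 : ‖c * h‖ ≤ ‖h‖ := (norm_mul_le _ _).trans (mul_le_of_le_one_left (norm_nonneg _) cn)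
      have m1 : ‖(c * a - a * c) * (h * c)‖ ≤ η * ‖h‖ :=
        (norm_mul_le _ _).trans (mul_le_mul b1 n1 (norm_nonneg _) hηp.le)
      have m2 : ‖(c * (h * a - a * h)) * c‖ ≤ η :=
        (norm_mul_le _ _).trans ((mul_le_of_le_one_right (norm_nonneg _) cn).trans b2)
      have m3 : ‖(c * h) * (c * a - a * c)‖ ≤ ‖h‖ * η :=
        (norm_mul_le _ _).trans (mul_le_mul n2 b1 (norm_nonneg _) (norm_nonneg _))
      refine (norm_add₃_le).trans ?_
      linarith
    have b4 : ‖y * a - a * y‖ ≤ 4 * ((2 * ‖h‖ + 1) * η) := by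
      have : y * a - a * y = (Complex.I * Real.pi) • (q * a - a * q) := by
        rw [hy, smul_mul_assoc, mul_smul_comm, smul_sub]
      rw [this, norm_smul]
      exact mul_le_mul npi b3 (norm_nonneg _) (by norm_num)
    calc _ ≤ Real.exp (4 * ‖h‖) * (4 * ((2 * ‖h‖ + 1) * η)) := by gcongr
      _ = M * η := by rw [hM]; ring
      _ = ε := by rw [hη]; field_simp

lemma ckModCl [Nontrivial H] {Q : Type*} [CStarAlgebra Q] {π : (H →L[ℂ] H) →⋆ₐ[ℂ] Q}
    (hsurj : Function.Surjective π)
    (hker : ∀ T : H →L[ℂ] H, π T = 0 ↔ IsCompactOperator T)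
    (D : Set (H →L[ℂ] H)) {r : Q} (hr : r ∈ Submonoid.closure (ckSym (π '' D))) : ckMod π D r := by
  induction hr using Submonoid.closure_induction with
  | mem x hx => exact ckModSym hsurj hker D hx
  | one =>
    intro G F _ ε hε
    exact ⟨1, by simp, by simp, by simp, by simp [hε.le], by simp [hε.le]⟩
  | mul x y _ _ hx hy => exact ckModMul hx hy
end modif
end part7

section part8
open Filter Topology

section limit
variable {H : Type*} [NormedAddCommGroup H] [InnerProductSpace ℂ H] [CompleteSpace H]

lemma ckCauchyDense (A : ℕ → H →L[ℂ] H) (hA : ∀ n, ‖A n‖ ≤ 1) (v : ℕ → H) (hv : DenseRange v)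
    (h : ∀ m n, m ≤ n → ‖A (n + 1) (v m) - A n (v m)‖ ≤ 1 / 2 ^ n) (w : H) :
    CauchySeq (fun n => A n w) := by
  have hc : ∀ m, CauchySeq (fun n => A n (v m)) := by
    intro m
    rw [← cauchySeq_shift m]
    refine cauchySeq_of_le_geometric_two (C := 2) fun n => ?_
    rw [dist_comm, dist_eq_norm]
    have := h m (n + m) (by omega)
    rw [show n + 1 + m = n + m + 1 by ring]
    refine this.trans ?_
    rw [show (2 : ℝ) / 2 / 2 ^ n = 1 / 2 ^ n by norm_num]
    gcongr
    · norm_num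
    · omega
  rw [Metric.cauchySeq_iff']
  intro ε hε
  obtain ⟨m, hm⟩ := hv.exists_dist_lt w (show (0 : ℝ) < ε / 3 by positivity)
  obtain ⟨N, hN⟩ := Metric.cauchySeq_iff'.1 (hc m) (ε / 3) (by positivity)
  refine ⟨N, fun n hn => ?_⟩
  have h1 : ∀ k, dist (A k w) (A k (v m)) < ε / 3 := fun k => by
    rw [dist_eq_norm, ← map_sub]
    refine ((A k).le_opNorm _).trans_lt ?_
    refine (mul_le_of_le_one_left (norm_nonneg _) (hA k)).trans_lt ?_
    rwa [← dist_eq_norm]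
  have h2 := hN n hn
  have h3 := dist_triangle4 (A n w) (A n (v m)) (A N (v m)) (A N w)
  have h4 := h1 N
  rw [dist_comm] at h4
  linarith [h1 n]

lemma ckLimit [Nontrivial H] [TopologicalSpace.SeparableSpace H]
    {Q : Type*} [CStarAlgebra Q] {π : (H →L[ℂ] H) →⋆ₐ[ℂ] Q}
    (hker : ∀ T : H →L[ℂ] H, π T = 0 ↔ IsCompactOperator T)
    (D : ℕ → Set (H →L[ℂ] H)) (hD : Monotone D) (hDc : ∀ n, (D n).Countable)
    (hDn : ∀ n, (D n).Nonempty)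
    (u : ℕ → H →L[ℂ] H) (hu : ∀ n, star (u n) * u n = 1) (hu' : ∀ n, u n * star (u n) = 1)
    (hx : ∀ n, ckMod π (D n) (π (star (u n) * u (n + 1))))
    (hc : ∀ n, ∀ a ∈ D n, π (u (n + 1) * a * star (u (n + 1))) = π (u n * a * star (u n))) :
    ∃ U : H →L[ℂ] H, star U * U = 1 ∧ U * star U = 1 ∧
      ∀ n, ∀ a ∈ D n, π (U * a * star U) = π (u n * a * star (u n)) := by
  classical
  choose a ha using fun n => (hDc n).exists_eq_range (hDn n)
  have haD : ∀ n k, a n k ∈ D n := fun n k => by rw [ha]; exact ⟨k, rfl⟩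
  set F : ℕ → Finset (H →L[ℂ] H) := fun m =>
    (Finset.range (m + 1) ×ˢ Finset.range (m + 1)).image fun p => a p.1 p.2 with hF
  have hFD : ∀ m, (F m : Set (H →L[ℂ] H)) ⊆ D m := by
    intro m x hx
    simp only [hF, Finset.coe_image, Set.mem_image] at hx
    obtain ⟨p, hp, rfl⟩ := hx
    simp only [Finset.coe_product, Finset.coe_range, Set.mem_prod, Set.mem_Iio] at hp
    exact hD (by omega) (haD p.1 p.2)
  set v := TopologicalSpace.denseSeq H
  have hv : DenseRange v := TopologicalSpace.denseRange_denseSeq H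
  set G : ℕ → (H →L[ℂ] H) → Finset H := fun n U =>
    (Finset.range (n + 1)).image v ∪ (Finset.range (n + 1)).image fun m => star U (v m) with hG
  choose X X1 X2 X3 X4 X5 using fun n (U : H →L[ℂ] H) =>
    hx n (G n U) (F n) (hFD n) (1 / 2 ^ n) (by positivity)
  set U : ℕ → H →L[ℂ] H := fun n => Nat.rec (u 0) (fun n U => U * X n U) n with hU
  have U0 : U 0 = u 0 := rfl
  have Us : ∀ n, U (n + 1) = U n * X n (U n) := fun n => rfl
  have Uu : ∀ n, star (U n) * U n = 1 ∧ U n * star (U n) = 1 ∧ π (U n) = π (u n) := by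
    intro n
    induction n with
    | zero => exact ⟨hu 0, hu' 0, rfl⟩
    | succ n ih =>
      obtain ⟨i1, i2, i3⟩ := ih
      rw [Us]
      refine ⟨?_, ?_, ?_⟩
      · rw [star_mul, mul_assoc, ← mul_assoc (star (U n)), i1, one_mul, X1]
      · rw [star_mul, mul_assoc, ← mul_assoc (X n (U n)), X2, one_mul, i2]
      · rw [map_mul, i3, X3, ← map_mul, ← mul_assoc, hu', one_mul]
  have nU : ∀ n, ‖U n‖ = 1 := fun n => ckUnitNorm (Uu n).1 (Uu n).2.1
  have nUs : ∀ n, ‖star (U n)‖ = 1 := fun n => by rw [norm_star, nU]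
  obtain ⟨L, hL⟩ := ckStrong U (ckCauchyDense U (fun n => (nU n).le) v hv (fun m n hmn => by
    have h1 := X4 n (U n) (v m) (by
      simp only [hG, Finset.mem_union, Finset.mem_image]
      exact Or.inl ⟨m, by simp; omega, rfl⟩)
    have e : U (n + 1) (v m) - U n (v m) = U n (X n (U n) (v m) - v m) := by
      rw [map_sub, Us]; rfl
    rw [e]
    refine ((U n).le_opNorm _).trans ?_
    rw [nU, one_mul]; exact h1))
  obtain ⟨L', hL'⟩ := ckStrong (fun n => star (U n)) (ckCauchyDense _ (fun n => (nUs n).le) v hv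
    (fun m n hmn => by
    have h1 := X4 n (U n) (star (U n) (v m)) (by
      simp only [hG, Finset.mem_union, Finset.mem_image]
      exact Or.inr ⟨m, by simp; omega, rfl⟩)
    set w := star (U n) (v m)
    have e : star (U (n + 1)) (v m) - w = star (X n (U n)) (w - X n (U n) w) := by
      rw [map_sub, Us, star_mul]
      have := congrArg (fun A : H →L[ℂ] H => A w) (X1 n (U n))
      change star (X n (U n)) (X n (U n) w) = w at this
      rw [this]; rfl
    rw [e]
    refine ((star (X n (U n))).le_opNorm _).trans ?_
    rw [norm_star, ckUnitNorm (X1 _ _) (X2 _ _), one_mul, norm_sub_rev]; exact h1))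
  have hadj : star L = L' := by
    rw [ContinuousLinearMap.star_eq_adjoint]
    symm
    rw [ContinuousLinearMap.eq_adjoint_iff]
    intro x y
    have t1 := (hL' x).inner (𝕜 := ℂ) (tendsto_const_nhds (x := y))
    have t2 := (tendsto_const_nhds (x := x)).inner (𝕜 := ℂ) (hL y)
    refine tendsto_nhds_unique t1 (t2.congr fun n => ?_)
    rw [ContinuousLinearMap.star_eq_adjoint, ContinuousLinearMap.adjoint_inner_left]
  have isoOf : ∀ (A : ℕ → H →L[ℂ] H) (L : H →L[ℂ] H), (∀ v, Tendsto (fun n => A n v) atTop (𝓝 (L v)))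
      → (∀ n, star (A n) * A n = 1) → star L * L = 1 := by
    intro A L hL hA
    ext x
    refine ext_inner_left ℂ fun y => ?_
    have t := (hL y).inner (𝕜 := ℂ) (hL x)
    have e : inner ℂ y ((star L * L) x) = inner ℂ (L y) (L x) :=
      ContinuousLinearMap.adjoint_inner_right L y (L x)
    rw [e]
    refine tendsto_nhds_unique t (tendsto_const_nhds.congr fun n => ?_)
    have e2 : inner ℂ y ((star (A n) * A n) x) = inner ℂ (A n y) (A n x) :=
      ContinuousLinearMap.adjoint_inner_right (A n) y (A n x)
    rw [← e2, hA]
  have L1 : star L * L = 1 := isoOf U L hL fun n => (Uu n).1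
  have L2 : L * star L = 1 := by
    have := isoOf (fun n => star (U n)) L' hL' fun n => by rw [star_star]; exact (Uu n).2.1
    rwa [← hadj, star_star] at this
  refine ⟨L, L1, L2, fun n x hx => ?_⟩
  have up : ∀ k, π (u (n + k) * x * star (u (n + k))) = π (u n * x * star (u n)) := by
    intro k
    induction k with
    | zero => rfl
    | succ k ih => rw [← add_assoc, hc _ x (hD (by omega) hx), ih]
  obtain ⟨k, hk⟩ : ∃ k, a n k = x := by
    rw [ha] at hx; exact hx
  set N := n + k with hN
  rw [← up k, ← sub_eq_zero]
  have eN : π (u N * x * star (u N)) = π (U N * x * star (U N)) := by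
    simp only [map_mul, map_star, (Uu N).2.2]
  rw [← hN, eN, ← map_sub]
  have eN' : ∀ N, π (U N * x * star (U N)) = π (u N * x * star (u N)) := fun N => by
    simp only [map_mul, map_star, (Uu N).2.2]
  refine ckSeqCpt (fun m => U (m + N) * x * star (U (m + N)) - U N * x * star (U N)) _ 0 1 ?_ ?_ ?_
  · intro m
    rw [map_sub, eN', eN', add_comm m N, hN, add_assoc, up, up, sub_self]
  · intro m' hm'
    obtain ⟨m, hm0⟩ : ∃ m, m = m' + N := ⟨_, rfl⟩
    have hm : N ≤ m := by omega
    have hle : (1 : ℝ) / 2 ^ m ≤ 1 / 2 ^ m' := by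
      gcongr
      · norm_num
      · omega
    refine le_trans ?_ hle
    rw [show m' + 1 + N = m + 1 by omega, ← hm0]
    set Y := X m (U m)
    have e : U (m + 1) * x * star (U (m + 1)) - U N * x * star (U N) -
        (U m * x * star (U m) - U N * x * star (U N)) =
        U m * ((Y * x - x * Y) * star Y) * star (U m) := by
      have hY : Y * star Y = 1 := X2 m (U m)
      rw [sub_sub_sub_cancel_right, Us, star_mul, sub_mul, mul_assoc x, hY, mul_one]
      change U m * Y * x * (star Y * star (U m)) - _ = _
      noncomm_ring
    have hb : ‖Y * x - x * Y‖ ≤ 1 / 2 ^ m := X5 m (U m) x (by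
      simp only [hF, Finset.mem_image]
      exact ⟨(n, k), by simp; omega, hk⟩)
    have nY : ‖star Y‖ = 1 := by rw [norm_star]; exact ckUnitNorm (X1 _ _) (X2 _ _)
    rw [e]
    refine (norm_mul_le _ _).trans ?_
    rw [nUs, mul_one]
    refine (norm_mul_le _ _).trans ?_
    rw [nU, one_mul]
    refine (norm_mul_le _ _).trans ?_
    rw [nY, mul_one]
    exact hb
  · intro y w
    have t : Tendsto (fun m => inner ℂ (x (star (U m) y)) (star (U m) w)) atTop
        (𝓝 (inner ℂ (x (star L y)) (star L w))) := by
      rw [hadj]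
      exact Filter.Tendsto.inner ((x.continuous.tendsto _).comp (hL' y)) (hL' w)
    have e : ∀ A : H →L[ℂ] H, inner ℂ ((A * x * star A - U N * x * star (U N)) y) w =
        inner ℂ (x (star A y)) (star A w) - inner ℂ ((U N * x * star (U N)) y) w := by
      intro A
      rw [ContinuousLinearMap.sub_apply, inner_sub_left]
      congr 1
      exact (ContinuousLinearMap.adjoint_inner_right A _ _).symm
    simp only [e]
    exact (t.comp (tendsto_add_atTop_nat N)).sub_const _
end limit
end part8

section part9
open Filter Topology

section step
variable {H : Type*} [NormedAddCommGroup H] [InnerProductSpace ℂ H] [CompleteSpace H]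
variable {K : Type*} [NormedAddCommGroup K] [InnerProductSpace ℂ K] [CompleteSpace K]

lemma ckGood.unitary {S : Set (K →L[ℂ] K)} {W : H →L[ℂ] K} (h : ckGood S W) {U : H →L[ℂ] H}
    (h1 : star U * U = 1) (h2 : U * star U = 1) : ckGood S (W.comp (star U)) ∧
      ∀ a, ckC (W.comp (star U)) a = U * ckC W a * star U := by
  have ad : ContinuousLinearMap.adjoint (W.comp (star U)) = U.comp (ContinuousLinearMap.adjoint W) := by
    rw [ContinuousLinearMap.adjoint_comp, ← ContinuousLinearMap.star_eq_adjoint, star_star]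
  have hC : ∀ a, ckC (W.comp (star U)) a = U * ckC W a * star U := by
    intro a
    unfold ckC
    rw [ad]
    rfl
  have hUU : ∀ v, star U (U v) = v := fun v => congrArg (fun A : H →L[ℂ] H => A v) h1
  have hin : ∀ v w, inner ℂ (U v) (U w) = inner ℂ v w := fun v w => by
    rw [← ContinuousLinearMap.adjoint_inner_right, ← ContinuousLinearMap.star_eq_adjoint, hUU]
  have hP : (W.comp (star U)).comp (ContinuousLinearMap.adjoint (W.comp (star U)))
      = W.comp (ContinuousLinearMap.adjoint W) := by
    rw [ad]
    ext v
    exact congrArg W (hUU _)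
  refine ⟨⟨?_, ?_, ?_⟩, hC⟩
  · have := hC 1
    rw [h.one, mul_one, h2] at this
    exact this
  · intro a ha
    rw [hP]; exact h.comm a ha
  · intro d e he F hF δ hδ
    obtain ⟨y, hy, hy2⟩ := h.abs d e he F hF δ hδ
    refine ⟨fun i => U (y i), ?_, fun a ha i j => ?_⟩
    · classical
      rw [orthonormal_iff_ite] at hy ⊢
      intro i j
      rw [hin, hy]
    · have : (ckC (W.comp (star U)) a) (U (y j)) = U (ckC W a (y j)) := by
        rw [hC]
        exact congrArg (fun v => U (ckC W a v)) (hUU _)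
      rw [this, hin]
      exact hy2 a ha i j

def ckP (c d : ℕ → K →L[ℂ] K) (j : ℕ) : Set (K →L[ℂ] K) :=
  {x | x = c j ∨ x = star (c j) ∨ x = d j ∨ x = star (d j)}

def ckT (c d : ℕ → K →L[ℂ] K) (n : ℕ) : Set (K →L[ℂ] K) := {x | ∃ j, j < n ∧ x ∈ ckP c d j}

def ckTT (c d : ℕ → K →L[ℂ] K) : Set (K →L[ℂ] K) := {x | ∃ j, x ∈ ckP c d j}

lemma ckP_star {c d : ℕ → K →L[ℂ] K} {j : ℕ} {x : K →L[ℂ] K} (hx : x ∈ ckP c d j) :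
    star x ∈ ckP c d j := by
  rcases hx with rfl | rfl | rfl | rfl <;> simp [ckP]

lemma ckP_count (c d : ℕ → K →L[ℂ] K) (j : ℕ) : (ckP c d j).Countable := by
  have : ckP c d j = {c j, star (c j), d j, star (d j)} := by
    ext x; simp [ckP]
  rw [this]
  exact (Set.toFinite _).countable

lemma ckT_sub (c d : ℕ → K →L[ℂ] K) (n : ℕ) : ckT c d n ⊆ ckTT c d :=
  fun _ ⟨j, _, hx⟩ => ⟨j, hx⟩

lemma ckTT_count (c d : ℕ → K →L[ℂ] K) : (ckTT c d).Countable := by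
  have : ckTT c d = ⋃ j, ckP c d j := by ext x; simp [ckTT]
  rw [this]
  exact Set.countable_iUnion (ckP_count c d)

lemma ckStep [Nontrivial H] [TopologicalSpace.SeparableSpace H]
    {Q : Type*} [CStarAlgebra Q] {π : (H →L[ℂ] H) →⋆ₐ[ℂ] Q}
    (hsurj : Function.Surjective π)
    (hker : ∀ T : H →L[ℂ] H, π T = 0 ↔ IsCompactOperator T)
    {c d : ℕ → K →L[ℂ] K} (hz : ∀ j, ckCz (c j) (d j))
    (hT : ∀ i j, i ≠ j → ∀ x ∈ ckP c d i, ∀ y ∈ ckP c d j, Commute x y)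
    {S' : Set (K →L[ℂ] K)} (hST : ∀ a ∈ S', ∀ j, ∀ x ∈ ckP c d j, Commute x a)
    (S : ℕ → Set (K →L[ℂ] K)) (hSm : Monotone S) (hSc : ∀ n, (S n).Countable)
    (hSs : ∀ n, ∀ a ∈ S n, star a ∈ S n) (hSS : ∀ n, S n ⊆ S')
    (W : ℕ → H →L[ℂ] K) (hW : ∀ n, ckGood (S n ∪ ckTT c d) (W n))
    (hWc : ∀ n, ∀ a ∈ S n ∪ ckTT c d, π (ckC (W (n + 1)) a) = π (ckC (W n) a))
    {W' : H →L[ℂ] K} (hW' : ckGood (S' ∪ ckTT c d) W') :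
    ∃ V : H →L[ℂ] K, ckGood (S' ∪ ckTT c d) V ∧
      ∀ n, ∀ a ∈ S n ∪ ckTT c d, π (ckC V a) = π (ckC (W n) a) := by
  have Ps : ∀ n, ∀ a ∈ S n ∪ ckTT c d, star a ∈ S n ∪ ckTT c d := by
    rintro n a (ha | ⟨j, ha⟩)
    · exact Or.inl (hSs n a ha)
    · exact Or.inr ⟨j, ckP_star ha⟩
  have cmT : ∀ n m, ∀ a ∈ S n ∪ ckT c d m, ∀ j, m ≤ j → ∀ x ∈ ckP c d j, Commute x a := by
    rintro n m a (ha | ⟨j', hj', ha⟩) j hj x hx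
    · exact hST a (hSS n ha) j x hx
    · exact hT j j' (by omega) x hx a ha
  have hcP : ∀ j, c j ∈ ckP c d j := fun j => Or.inl rfl
  have hdP : ∀ j, d j ∈ ckP c d j := fun j => Or.inr (Or.inr (Or.inl rfl))
  choose u hu hu' huR using fun n => ckGoodU hker (R := S n ∪ ckT c d (n + 2))
    (hW'.mono (Set.union_subset_union_left _ (hSS n))) (hW n) (Ps n)
    (by
      rintro a (ha | ⟨j, hj, ha⟩)
      · exact Or.inl (hSs n a ha)
      · exact Or.inr ⟨j, hj, ckP_star ha⟩)
    (Set.union_subset_union_right _ (ckT_sub c d _))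
    ((hSc n).union ((ckTT_count c d).mono (ckT_sub c d _)))
    (Or.inr ⟨n + 2, hcP _⟩) (Or.inr ⟨n + 2, hdP _⟩) (hz (n + 2))
    (fun a ha => cmT n _ a ha (n + 2) le_rfl _ (hcP _))
    (fun a ha => cmT n _ a ha (n + 2) le_rfl _ (hdP _))
  have Tmono : ∀ m n, m ≤ n → ckT c d m ⊆ ckT c d n := fun m n h x ⟨j, hj, hx⟩ => ⟨j, by omega, hx⟩
  have sub' : ∀ n m, S n ∪ ckT c d m ⊆ S' ∪ ckTT c d := fun n m =>
    Set.union_subset_union (hSS n) (ckT_sub c d _)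
  have s' : ∀ a ∈ S' ∪ ckTT c d, a ∈ Submonoid.closure (S' ∪ ckTT c d) :=
    fun a ha => Submonoid.subset_closure ha
  have cmW : ∀ x ∈ S' ∪ ckTT c d, ∀ y ∈ S' ∪ ckTT c d, Commute x y →
      Commute (π (ckC W' x)) (π (ckC W' y)) := by
    intro x hx y hy h
    change _ * _ = _ * _
    rw [← map_mul, ← map_mul, ← hW'.mul (s' x hx), ← hW'.mul (s' y hy), h.eq]
  have conj : ∀ n, ∀ a ∈ S n ∪ ckT c d (n + 2),
      π (u n * ckC W' a * star (u n)) = π (ckC (W n) a) := by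
    intro n a ha
    rw [map_mul, map_mul, ← huR n a ha, mul_assoc, ← map_mul, hu', map_one, mul_one]
  have xc : ∀ n, ∀ a ∈ S n ∪ ckT c d (n + 2),
      Commute (π (star (u n) * u (n + 1))) (π (ckC W' a)) := by
    intro n a ha
    have h1 := huR n a ha
    have h2 := huR (n + 1) a (Set.union_subset_union (hSm (by omega)) (Tmono _ _ (by omega)) ha)
    rw [hWc n a (Set.union_subset_union_right _ (ckT_sub c d _) ha)] at h2
    have h3 : π (star (u n)) * π (ckC (W n) a) = π (ckC W' a) * π (star (u n)) := by
      have := congrArg (fun z => π (star (u n)) * z * π (star (u n))) h1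
      simp only [mul_assoc] at this
      rw [← map_mul π (u n), hu', ← mul_assoc (π (star (u n))) (π (u n)), ← map_mul π _ (u n),
        hu] at this
      simpa using this
    change _ * _ = _ * _
    rw [map_mul, mul_assoc, ← h2, ← mul_assoc, h3, mul_assoc]
  obtain ⟨U, hU, hU', hUc⟩ := ckLimit hker (fun n => Set.image (ckC W') (S n ∪ ckT c d (n + 1)))
    (fun m n hmn => Set.image_mono (Set.union_subset_union (hSm hmn) (Tmono _ _ (by omega))))
    (fun n => ((hSc n).union ((ckTT_count c d).mono (ckT_sub c d _))).image _)
    (fun n => ⟨_, ⟨c 0, Or.inr ⟨0, by omega, hcP 0⟩, rfl⟩⟩) u hu hu'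
    (fun n => by
      apply ckModCl hsurj hker
      have hp1 : ∀ x ∈ ckP c d (n + 1), x ∈ S' ∪ ckTT c d := fun x hx => Or.inr ⟨_, hx⟩
      have hp2 : ∀ x ∈ ckP c d (n + 1), x ∈ S n ∪ ckT c d (n + 2) :=
        fun x hx => Or.inr ⟨_, by omega, hx⟩
      have cz := (hW'.mono (Set.subset_union_right (t := ckTT c d))).cz
        (fun a ⟨j, ha⟩ => ⟨j, ckP_star ha⟩) ⟨_, hcP (n + 1)⟩ ⟨_, hdP (n + 1)⟩ (hz (n + 1))
      have cmm : ∀ y ∈ ckP c d (n + 1), ∀ a ∈ π '' (Set.image (ckC W') (S n ∪ ckT c d (n + 1))),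
          Commute (π (ckC W' y)) a ∧ Commute (star (π (ckC W' y))) a := by
        rintro y hy _ ⟨_, ⟨a, ha, rfl⟩, rfl⟩
        rw [← map_star, ← ckC_star]
        exact ⟨cmW y (hp1 _ hy) a (sub' _ _ ha) (cmT n _ a ha _ le_rfl y hy),
          cmW _ (hp1 _ (ckP_star hy)) a (sub' _ _ ha) (cmT n _ a ha _ le_rfl _ (ckP_star hy))⟩
      refine ckSwindle _ (c := π (ckC W' (c (n + 1)))) (d := π (ckC W' (d (n + 1)))) ?_ ?_ ?_ ?_ ?_
        (cmm _ (hcP _)) (cmm _ (hdP _)) ?_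
      · obtain ⟨z1, z2, z3, z4⟩ := cz
        refine ⟨?_, ?_, ?_, ?_⟩
        · rw [← map_star, ← map_mul, z1, map_one]
        · rw [← map_star, ← map_mul, z2, map_one]
        · rw [← map_star, ← map_mul, z3, map_zero]
        · rw [← map_star, ← map_star, ← map_mul, ← map_mul, ← map_add, z4, map_one]
      · rw [← map_star, ← map_mul, star_mul, star_star, mul_assoc, ← mul_assoc (u n), hu', one_mul,
          hu, map_one]
      · rw [← map_star, ← map_mul, star_mul, star_star, mul_assoc, ← mul_assoc (u (n + 1)), hu',
          one_mul, hu, map_one]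
      · exact (xc n _ (hp2 _ (hcP _))).symm
      · exact (xc n _ (hp2 _ (hdP _))).symm
      · rintro _ ⟨_, ⟨a, ha, rfl⟩, rfl⟩
        exact xc n a (Set.union_subset_union_right _ (Tmono _ _ (by omega)) ha))
    (by
      rintro n _ ⟨a, ha, rfl⟩
      have ha2 : a ∈ S n ∪ ckT c d (n + 2) :=
        Set.union_subset_union_right _ (Tmono _ _ (by omega)) ha
      rw [conj n a ha2, conj (n + 1) a (Set.union_subset_union (hSm (by omega))
        (Tmono _ _ (by omega)) ha2), hWc n a (Set.union_subset_union_right _ (ckT_sub c d _) ha2)])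
  obtain ⟨g1, g2⟩ := hW'.unitary hU hU'
  refine ⟨_, g1, fun n a ha => ?_⟩
  have main : ∀ n, ∀ a ∈ S n ∪ ckT c d (n + 1), π (ckC (W'.comp (star U)) a) = π (ckC (W n) a) := by
    intro n a ha
    rw [g2, hUc n _ ⟨a, ha, rfl⟩, conj n a (Set.union_subset_union_right _ (Tmono _ _ (by omega)) ha)]
  rcases ha with ha | ⟨j, ha⟩
  · exact main n a (Or.inl ha)
  · have up : ∀ k, π (ckC (W (n + k)) a) = π (ckC (W n) a) := by
      intro k
      induction k with
      | zero => rfl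
      | succ k ih => rw [← add_assoc, hWc _ a (Or.inr ⟨j, ha⟩), ih]
    rw [← up j]
    exact main (n + j) a (Or.inr ⟨j, by omega, ha⟩)
end step
end part9

section part10
open Filter Topology

section exist

lemma ckBasis {E : Type*} [NormedAddCommGroup E] [InnerProductSpace ℂ E] [CompleteSpace E]
    [TopologicalSpace.SeparableSpace E] (hE : ¬ FiniteDimensional ℂ E) :
    Nonempty (HilbertBasis ℕ ℂ E) := by
  obtain ⟨w, b, hb⟩ := exists_hilbertBasis ℂ E
  have ho := b.orthonormal
  have hcount : Countable w := by
    refine Pairwise.countable_of_isOpen_disjoint (s := fun i : w => Metric.ball (b i) (1 / 2))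
      (fun i j hij => ?_) (fun i => Metric.isOpen_ball) (fun i => ⟨b i, by simp⟩)
    refine Metric.ball_disjoint_ball ?_
    have h1 : ‖b i - b j‖ ^ 2 = 2 := by
      rw [@norm_sub_sq ℂ, ho.1, ho.1, ho.2 hij]; norm_num
    rw [dist_eq_norm]
    nlinarith [norm_nonneg (b i - b j)]
  have hinf : Infinite w := by
    by_contra hfin
    rw [not_infinite_iff_finite] at hfin
    apply hE
    have hfd : FiniteDimensional ℂ (Submodule.span ℂ (Set.range b)) :=
      FiniteDimensional.span_of_finite ℂ (Set.finite_range b)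
    have hd := b.dense_span
    rw [IsClosed.submodule_topologicalClosure_eq (Submodule.closed_of_finiteDimensional _)] at hd
    rw [hd] at hfd
    exact Module.Finite.equiv (Submodule.topEquiv (R := ℂ) (M := E))
  obtain ⟨den⟩ := nonempty_denumerable w
  let e : ℕ ≃ w := (Denumerable.eqv w).symm
  refine ⟨HilbertBasis.mk (v := fun n => b (e n)) (ho.comp e e.injective) ?_⟩
  have : Set.range (fun n => b (e n)) = Set.range b := e.surjective.range_comp b
  rw [this, b.dense_span]

variable {H : Type*} [NormedAddCommGroup H] [InnerProductSpace ℂ H] [CompleteSpace H]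
variable {K : Type*} [NormedAddCommGroup K] [InnerProductSpace ℂ K] [CompleteSpace K]

lemma ckDenseFam {ι X : Type*} [Countable ι] (f : X → ι → ℂ) :
    ∃ B : Set X, B.Countable ∧ ∀ x, ∀ F : Finset ι, ∀ δ : ℝ, 0 < δ →
      ∃ y ∈ B, ∀ i ∈ F, ‖f y i - f x i‖ ≤ δ := by
  obtain ⟨t, ht, htc, hd⟩ := (TopologicalSpace.IsSeparable.of_separableSpace
    (Set.range f)).exists_countable_dense_subset
  rcases isEmpty_or_nonempty X with hX | hX
  · exact ⟨∅, Set.countable_empty, fun x => hX.elim x⟩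
  choose! g hg using fun z (hz : z ∈ t) => ht hz
  refine ⟨g '' t, htc.image g, fun x F δ hδ => ?_⟩
  have hx := hd ⟨x, rfl⟩
  have hopen : IsOpen {z : ι → ℂ | ∀ i ∈ F, ‖z i - f x i‖ < δ} := by
    have : {z : ι → ℂ | ∀ i ∈ F, ‖z i - f x i‖ < δ} = ⋂ i ∈ F, {z | ‖z i - f x i‖ < δ} := by
      ext; simp
    rw [this]
    refine isOpen_biInter_finset fun i _ => ?_
    exact isOpen_lt (by fun_prop) continuous_const
  obtain ⟨z, hz, hzt⟩ := mem_closure_iff.1 hx _ hopen (by intro i _; simpa using hδ)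
  refine ⟨g z, ⟨z, hzt, rfl⟩, fun i hi => ?_⟩
  rw [hg z hzt]
  exact (hz i hi).le

lemma ckInnStar (A B : K →L[ℂ] K) (x y : K) :
    inner ℂ x ((star A * B) y) = inner ℂ (A x) (B y) :=
  ContinuousLinearMap.adjoint_inner_right A x (B y)

lemma ckInfDim {c d : K →L[ℂ] K} (hz : ckCz c d) {x0 : K} (hx0 : x0 ≠ 0) (N : Submodule ℂ K)
    (hmem : ∀ k, (d ^ k * c) x0 ∈ N) : ¬ FiniteDimensional ℂ N := by
  intro hfd
  have hin : ∀ k l, inner ℂ ((d ^ k * c) x0) ((d ^ l * c) x0) = if k = l then inner ℂ x0 x0 else 0 := by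
    intro k l
    rw [← ckInnStar, hz.fam k l]
    split_ifs <;> simp
  generalize hg : (fun k : ℕ => (d ^ k * c) x0) = g at *
  have hg' : ∀ k, (d ^ k * c) x0 = g k := fun k => congrFun hg k
  simp only [hg'] at hin hmem
  have hli : LinearIndependent ℂ (fun k : ℕ => (⟨g k, hmem k⟩ : N)) := by
    refine linearIndependent_of_ne_zero_of_inner_eq_zero (𝕜 := ℂ) (fun k h => ?_) (fun k l hkl => ?_)
    · have h1 := hin k k
      have h2 : g k = 0 := congrArg Subtype.val h
      rw [h2, if_pos rfl, inner_zero_left] at h1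
      exact hx0 (inner_self_eq_zero.1 h1.symm)
    · have := hin k l
      rw [if_neg hkl] at this
      exact this
  have := hli.finite
  exact not_finite ℕ

lemma ckExist [TopologicalSpace.SeparableSpace H] (hH : ¬ FiniteDimensional ℂ H) [Nontrivial K]
    {S : Set (K →L[ℂ] K)} (hSc : S.Countable) (hSs : ∀ a ∈ S, star a ∈ S)
    {c d : K →L[ℂ] K} (hc : c ∈ S) (hd : d ∈ S) (hz : ckCz c d) :
    ∃ W : H →L[ℂ] K, ckGood S W := by
  classical
  set M := Submonoid.closure S with hM
  have hMc : (M : Set (K →L[ℂ] K)).Countable := ckCountClosure hSc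
  have : Countable M := hMc
  choose B hBc hB using fun n : ℕ => ckDenseFam
    (fun (e : {e : Fin n → K // Orthonormal ℂ e}) (p : M × Fin n × Fin n) =>
      inner ℂ (e.1 p.2.1) (p.1.1 (e.1 p.2.2)))
  obtain ⟨x0, hx0⟩ := exists_ne (0 : K)
  set X : Set K := insert x0 (⋃ n, ⋃ e ∈ B n, Set.range e.1) with hX
  have hXc : X.Countable := Set.Countable.insert _ (Set.countable_iUnion fun n =>
    (hBc n).biUnion fun e _ => Set.countable_range _)
  set Y : Set K := Set.image2 (fun (a : K →L[ℂ] K) x => a x) M X with hY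
  have hYc : Y.Countable := hMc.image2 hXc _
  set N : Submodule ℂ K := (Submodule.span ℂ Y).topologicalClosure with hN
  have hXN : ∀ x ∈ X, x ∈ N := fun x hx => Submodule.le_topologicalClosure _
    (Submodule.subset_span ⟨1, Submonoid.one_mem M, x, hx, rfl⟩)
  have hinv : ∀ a ∈ M, ∀ v ∈ N, a v ∈ N := by
    intro a ha v hv
    have hle : Submodule.span ℂ Y ≤ N.comap (a : K →ₗ[ℂ] K) := by
      rw [Submodule.span_le]
      rintro _ ⟨b, hb, x, hx, rfl⟩
      exact Submodule.le_topologicalClosure _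
        (Submodule.subset_span ⟨a * b, mul_mem ha hb, x, hx, rfl⟩)
    have hcl : IsClosed ((N.comap (a : K →ₗ[ℂ] K) : Submodule ℂ K) : Set K) :=
      (Submodule.isClosed_topologicalClosure _).preimage a.continuous
    exact Submodule.topologicalClosure_minimal _ hle hcl hv
  have hNc : IsClosed (N : Set K) := Submodule.isClosed_topologicalClosure _
  have : CompleteSpace N := hNc.completeSpace_coe
  have : TopologicalSpace.SeparableSpace N := by
    have : TopologicalSpace.IsSeparable (N : Set K) := by
      rw [hN, Submodule.topologicalClosure_coe]
      exact hYc.isSeparable.span.closure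
    exact this.separableSpace
  have hNinf : ¬ FiniteDimensional ℂ N := by
    intro hfd
    have hmem : ∀ k, (d ^ k * c) x0 ∈ N := fun k => hinv _
      (mul_mem (pow_mem (Submonoid.subset_closure hd) k) (Submonoid.subset_closure hc)) _
      (hXN x0 (Set.mem_insert _ _))
    exact ckInfDim hz hx0 N hmem hfd
  obtain ⟨bH⟩ := ckBasis hH
  obtain ⟨bN⟩ := ckBasis hNinf
  let T : H ≃ₗᵢ[ℂ] N := bH.repr.trans bN.repr.symm
  let W : H →L[ℂ] K := N.subtypeL.comp (T.toContinuousLinearEquiv : H →L[ℂ] N)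
  have hWin : ∀ v w, inner ℂ (W v) (W w) = inner ℂ v w := fun v w => T.inner_map_map v w
  have hiso : (ContinuousLinearMap.adjoint W).comp W = 1 :=
    W.inner_map_map_iff_adjoint_comp_self.1 hWin
  have hWN : ∀ v ∈ N, ∃ x, W x = v := fun v hv => ⟨T.symm ⟨v, hv⟩, by
    change ((T (T.symm ⟨v, hv⟩) : N) : K) = v
    rw [T.apply_symm_apply]⟩
  set P : K →L[ℂ] K := W.comp (ContinuousLinearMap.adjoint W) with hP
  have hPN : ∀ v, P v ∈ N := fun v => (T (ContinuousLinearMap.adjoint W v)).2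
  have hPv : ∀ v ∈ N, P v = v := by
    intro v hv
    obtain ⟨x, rfl⟩ := hWN v hv
    exact congrArg (fun A : H →L[ℂ] H => W (A x)) hiso
  have hPs : star P = P := by
    rw [hP, ContinuousLinearMap.star_eq_adjoint, ContinuousLinearMap.adjoint_comp,
      ContinuousLinearMap.adjoint_adjoint]
  have hPa : ∀ a ∈ M, P * a * P = a * P := by
    intro a ha
    ext v
    exact hPv _ (hinv a ha _ (hPN v))
  refine ⟨W, hiso, ?_, ?_⟩
  · intro a ha
    have h1 := hPa a (Submonoid.subset_closure ha)
    have h2 := congrArg star (hPa _ (Submonoid.subset_closure (hSs a ha)))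
    simp only [star_mul, hPs, star_star] at h2
    rw [← mul_assoc] at h2
    exact h2.symm.trans h1
  · intro n e he F hF δ hδ
    obtain ⟨e', he', hh⟩ := hB n ⟨e, he⟩ ((F.attach.image fun a => (⟨a.1, hF a.2⟩ : M)) ×ˢ
      (Finset.univ ×ˢ Finset.univ)) δ hδ
    have hmem : ∀ i, e'.1 i ∈ N := fun i => hXN _ (Set.mem_insert_of_mem _
      (Set.mem_iUnion.2 ⟨n, Set.mem_iUnion₂.2 ⟨e', he', i, rfl⟩⟩))
    choose y hy using fun i => hWN _ (hmem i)
    refine ⟨y, ?_, fun a ha i j => ?_⟩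
    · have := e'.2
      rw [orthonormal_iff_ite] at this ⊢
      intro i j
      rw [← hWin, hy, hy, this]
    · rw [ckC_inner, hy, hy]
      exact hh (⟨a, hF ha⟩, i, j) (by
        simp only [Finset.mem_product, Finset.mem_univ, and_true, Finset.mem_image,
          Finset.mem_attach, true_and, Subtype.exists]
        exact ⟨a, ha, rfl⟩)
end exist
end part10

section part11
open Filter Topology

section peq
variable {X : Type*} {E : Type*} [NormedAddCommGroup E] [InnerProductSpace ℂ E] [CompleteSpace E]

lemma ckOsum (p : X ≃. X) (f : lp (fun _ : X => E) 2) (s : Finset X) :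
    ∑ x ∈ s, ‖(p x).elim 0 f‖ ^ (2 : ENNReal).toReal ≤ ‖f‖ ^ (2 : ENNReal).toReal := by
  classical
  have h2 : (0 : ℝ) < (2 : ENNReal).toReal := by norm_num
  set s' := s.filter fun x => (p x).isSome = true with hs'
  have h1 : ∑ x ∈ s, ‖(p x).elim 0 f‖ ^ (2 : ENNReal).toReal =
      ∑ x ∈ s', ‖(p x).elim 0 f‖ ^ (2 : ENNReal).toReal := by
    rw [hs', Finset.sum_filter_of_ne]
    intro x _ hx
    by_contra h
    rw [Option.not_isSome_iff_eq_none] at h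
    rw [h] at hx
    simp at hx
  have hget : ∀ x ∈ s', p x = some ((p x).getD x) := by
    intro x hx
    rw [hs', Finset.mem_filter] at hx
    obtain ⟨y, hy⟩ := Option.isSome_iff_exists.1 hx.2
    rw [hy]; rfl
  have h3 : ∑ x ∈ s', ‖(p x).elim 0 f‖ ^ (2 : ENNReal).toReal =
      ∑ x ∈ s', ‖f ((p x).getD x)‖ ^ (2 : ENNReal).toReal := by
    refine Finset.sum_congr rfl fun x hx => ?_
    conv_lhs => rw [hget x hx]
    rfl
  have h4 : ∑ x ∈ s', ‖f ((p x).getD x)‖ ^ (2 : ENNReal).toReal =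
      ∑ y ∈ s'.image fun x => (p x).getD x, ‖f y‖ ^ (2 : ENNReal).toReal := by
    rw [Finset.sum_image]
    intro x hx y hy hxy
    have hxy' : (p x).getD x = (p y).getD y := hxy
    have a1 := hget x hx
    have a2 := hget y hy
    rw [hxy'] at a1
    exact p.inj a1 a2
  rw [h1, h3, h4]
  exact lp.sum_rpow_le_norm_rpow h2 f _

noncomputable def ckO (p : X ≃. X) : lp (fun _ : X => E) 2 →L[ℂ] lp (fun _ : X => E) 2 :=
  LinearMap.mkContinuous
    { toFun := fun f => ⟨fun x => (p x).elim 0 f, memℓp_gen' (ckOsum p f)⟩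
      map_add' := fun f g => by
        ext x
        change (p x).elim 0 (f + g : lp (fun _ : X => E) 2) = (p x).elim 0 f + (p x).elim 0 g
        cases p x
        · exact (add_zero 0).symm
        · rfl
      map_smul' := fun c f => by
        ext x
        change (p x).elim 0 (c • f : lp (fun _ : X => E) 2) = c • (p x).elim 0 f
        cases p x
        · exact (smul_zero c).symm
        · rfl } 1 fun f => by
    rw [one_mul]
    exact lp.norm_le_of_forall_sum_le (by norm_num) (norm_nonneg _) (ckOsum p f)

lemma ckO_apply (p : X ≃. X) (f : lp (fun _ : X => E) 2) (x : X) :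
    ckO p f x = (p x).elim 0 f := rfl

lemma ckO_mul (p q : X ≃. X) : (ckO p * ckO q : lp (fun _ : X => E) 2 →L[ℂ] _) = ckO (p.trans q) := by
  ext f x
  change (p x).elim 0 (ckO q f) = ((p.trans q) x).elim 0 f
  have : (p.trans q) x = (p x).bind q := rfl
  rw [this]
  cases p x <;> rfl

lemma ckO_refl : (ckO (PEquiv.refl X) : lp (fun _ : X => E) 2 →L[ℂ] _) = 1 := by
  ext f x
  rfl

lemma ckO_star (p : X ≃. X) : star (ckO p : lp (fun _ : X => E) 2 →L[ℂ] _) = ckO p.symm := by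
  classical
  rw [ContinuousLinearMap.star_eq_adjoint]
  refine lp.ext_continuousLinearMap (by norm_num) fun y => ?_
  ext1 a
  refine ext_inner_right ℂ fun g => ?_
  change inner ℂ (ContinuousLinearMap.adjoint (ckO p) (lp.single 2 y a)) g =
    inner ℂ (ckO p.symm (lp.single 2 y a)) g
  rw [ContinuousLinearMap.adjoint_inner_left, lp.inner_single_left, ckO_apply]
  rcases h : p y with _ | x
  · have : ckO p.symm (lp.single 2 y a) = 0 := by
      ext x
      rw [ckO_apply]
      rcases h' : p.symm x with _ | z
      · rfl
      · change (lp.single (E := fun _ => E) 2 y a) z = 0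
        rw [lp.single_apply_ne]
        rintro rfl
        rw [PEquiv.eq_some_iff, h] at h'
        simp at h'
    rw [this]
    simp
  · have : ckO p.symm (lp.single 2 y a) = lp.single 2 x a := by
      ext x'
      rw [ckO_apply]
      rcases h' : p.symm x' with _ | z
      · change 0 = _
        rw [lp.single_apply_ne]
        rintro rfl
        rw [← PEquiv.eq_some_iff, h'] at h
        simp at h
      · change (lp.single (E := fun _ => E) 2 y a) z = _
        rw [PEquiv.eq_some_iff] at h'
        by_cases hx : x' = x
        · subst hx
          have : z = y := p.inj h' h
          subst this
          rw [lp.single_apply_self, lp.single_apply_self]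
        · rw [lp.single_apply_ne, lp.single_apply_ne]
          · exact hx
          · rintro rfl
            rw [h] at h'
            exact hx (Option.some.inj h').symm
    rw [this, lp.inner_single_left]
    rfl

def ckLift (j : ℕ) (q : ℕ ≃. ℕ) : (ℕ → ℕ) ≃. (ℕ → ℕ) where
  toFun x := (q (x j)).map (Function.update x j)
  invFun x := (q.symm (x j)).map (Function.update x j)
  inv x y := by
    simp only [Option.mem_def, Option.map_eq_some_iff]
    constructor
    · rintro ⟨n, hn, rfl⟩
      rw [PEquiv.eq_some_iff] at hn
      exact ⟨y j, by simpa using hn, by simp⟩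
    · rintro ⟨n, hn, rfl⟩
      rw [← PEquiv.eq_some_iff] at hn
      exact ⟨x j, by simpa using hn, by simp⟩

lemma ckLift_apply (j : ℕ) (q : ℕ ≃. ℕ) (x : ℕ → ℕ) :
    ckLift j q x = (q (x j)).map (Function.update x j) := rfl

lemma ckLift_symm (j : ℕ) (q : ℕ ≃. ℕ) : (ckLift j q).symm = ckLift j q.symm := by
  ext x; rfl

lemma ckLift_trans (j : ℕ) (q r : ℕ ≃. ℕ) :
    (ckLift j q).trans (ckLift j r) = ckLift j (q.trans r) := by
  refine DFunLike.ext _ _ fun x => ?_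
  change (ckLift j q x).bind (ckLift j r) = ((q (x j)).bind r).map _
  rw [ckLift_apply]
  cases q (x j) with
  | none => rfl
  | some n =>
    change ckLift j r _ = (r n).map _
    rw [ckLift_apply, Function.update_self]
    congr 1
    funext m
    simp [Function.update_idem]

lemma ckLift_refl (j : ℕ) : ckLift j (PEquiv.refl ℕ) = PEquiv.refl _ := by
  refine DFunLike.ext _ _ fun x => ?_
  rw [ckLift_apply]
  simp

lemma ckLift_comm (i j : ℕ) (hij : i ≠ j) (q r : ℕ ≃. ℕ) :
    (ckLift i q).trans (ckLift j r) = (ckLift j r).trans (ckLift i q) := by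
  refine DFunLike.ext _ _ fun x => ?_
  change (ckLift i q x).bind (ckLift j r) = (ckLift j r x).bind (ckLift i q)
  rw [ckLift_apply, ckLift_apply]
  have h1 : ∀ n, ckLift j r (Function.update x i n) =
      (r (x j)).map (Function.update (Function.update x i n) j) := fun n => by
    rw [ckLift_apply, Function.update_of_ne hij.symm]
  have h2 : ∀ n, ckLift i q (Function.update x j n) =
      (q (x i)).map (Function.update (Function.update x j n) i) := fun n => by
    rw [ckLift_apply, Function.update_of_ne hij]
  cases hq : q (x i) <;> cases hr : r (x j) <;> simp [h1, h2, hq, hr]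
  exact Function.update_comm hij _ _ _

def ckEv (b : ℕ) (hb : b < 2) : ℕ ≃. ℕ where
  toFun n := if n % 2 = b then some (n / 2) else none
  invFun n := some (2 * n + b)
  inv m n := by
    simp only [Option.mem_def, Option.some.injEq]
    split_ifs with h
    · simp only [Option.some.injEq]; omega
    · simp only [reduceCtorEq, iff_false]; omega

noncomputable def ckCc (E : Type*) [NormedAddCommGroup E] [InnerProductSpace ℂ E]
    [CompleteSpace E] (b : ℕ)
    (hb : b < 2) (j : ℕ) :
    lp (fun _ : ℕ → ℕ => E) 2 →L[ℂ] lp (fun _ : ℕ → ℕ => E) 2 := ckO (ckLift j (ckEv b hb))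

lemma ckCz_std (j : ℕ) : ckCz (ckCc E 0 (by norm_num) j) (ckCc E 1 (by norm_num) j) := by
  have e1 : ∀ b hb, ((ckEv b hb).symm).trans (ckEv b hb) = PEquiv.refl ℕ := by
    intro b hb
    refine DFunLike.ext _ _ fun n => ?_
    change (some (2 * n + b)).bind (ckEv b hb) = some n
    change (if (2 * n + b) % 2 = b then some ((2 * n + b) / 2) else none) = some n
    rw [if_pos (by omega)]
    congr 1; omega
  unfold ckCc
  refine ⟨?_, ?_, ?_, ?_⟩
  · rw [ckO_star, ckO_mul, ckLift_symm, ckLift_trans, e1, ckLift_refl, ckO_refl]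
  · rw [ckO_star, ckO_mul, ckLift_symm, ckLift_trans, e1, ckLift_refl, ckO_refl]
  · have e2 : ((ckEv 0 (by norm_num)).symm).trans (ckEv 1 (by norm_num)) = ⊥ := by
      refine DFunLike.ext _ _ fun n => ?_
      change (if (2 * n + 0) % 2 = 1 then some ((2 * n + 0) / 2) else none) = none
      rw [if_neg (by omega)]
    rw [ckO_star, ckO_mul, ckLift_symm, ckLift_trans, e2]
    ext f x
    rfl
  · rw [ckO_star, ckO_mul, ckLift_symm, ckLift_trans, ckO_star, ckO_mul, ckLift_symm, ckLift_trans]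
    ext f x
    change ((ckLift j ((ckEv 0 _).trans (ckEv 0 _).symm)) x).elim 0 f +
      ((ckLift j ((ckEv 1 _).trans (ckEv 1 _).symm)) x).elim 0 f = f x
    have e3 : ∀ b hb, (((ckEv b hb).trans (ckEv b hb).symm) (x j)) =
        if x j % 2 = b then some (x j) else none := by
      intro b hb
      change (if x j % 2 = b then some (x j / 2) else none).bind (fun n => some (2 * n + b)) = _
      split_ifs with h
      · change some _ = some _
        congr 1; omega
      · rfl
    rw [ckLift_apply, ckLift_apply, e3, e3]
    rcases Nat.mod_two_eq_zero_or_one (x j) with h | h <;> simp [h]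

lemma ckP_std_comm (i j : ℕ) (hij : i ≠ j) :
    ∀ x ∈ ckP (ckCc E 0 (by norm_num)) (ckCc E 1 (by norm_num)) i,
    ∀ y ∈ ckP (ckCc E 0 (by norm_num)) (ckCc E 1 (by norm_num)) j, Commute x y := by
  have key : ∀ j, ∀ x ∈ ckP (ckCc E 0 (by norm_num)) (ckCc E 1 (by norm_num)) j,
      ∃ q, x = ckO (ckLift j q) := by
    rintro j x (rfl | rfl | rfl | rfl)
    · exact ⟨_, rfl⟩
    · exact ⟨_, by rw [ckCc, ckO_star, ckLift_symm]⟩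
    · exact ⟨_, rfl⟩
    · exact ⟨_, by rw [ckCc, ckO_star, ckLift_symm]⟩
  intro x hx y hy
  obtain ⟨q, rfl⟩ := key i x hx
  obtain ⟨r, rfl⟩ := key j y hy
  change _ * _ = _ * _
  rw [ckO_mul, ckO_mul, ckLift_comm i j hij]
end peq
end part11

section part12
open Filter Topology

section rep0
open scoped ComplexOrder

section rep
variable {A : Type*} [NonUnitalCStarAlgebra A]

noncomputable def ckDS {ι : Type*} {E : ι → Type*} [∀ i, NormedAddCommGroup (E i)]
    [∀ i, InnerProductSpace ℂ (E i)] [∀ i, CompleteSpace (E i)]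
    (ρ : ∀ i, A →⋆ₙₐ[ℂ] (E i →L[ℂ] E i)) : A →⋆ₙₐ[ℂ] (lp E 2 →L[ℂ] lp E 2) where
  toFun a := lp.mapCLM 2 (fun i => ρ i a) (norm_nonneg a)
    (fun i => NonUnitalStarAlgHom.norm_apply_le (ρ i) a)
  map_smul' m a := by
    ext f i
    change ρ i (m • a) (f i) = m • (ρ i a (f i))
    rw [map_smul]; rfl
  map_zero' := by
    ext f i
    change ρ i 0 (f i) = 0
    rw [map_zero]; rfl
  map_add' a b := by
    ext f i
    change ρ i (a + b) (f i) = ρ i a (f i) + ρ i b (f i)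
    rw [map_add]; rfl
  map_mul' a b := by
    ext f i
    change ρ i (a * b) (f i) = ρ i a (ρ i b (f i))
    rw [map_mul]; rfl
  map_star' a := by
    rw [ContinuousLinearMap.star_eq_adjoint, ContinuousLinearMap.eq_adjoint_iff]
    intro x y
    rw [lp.inner_eq_tsum, lp.inner_eq_tsum]
    refine tsum_congr fun i => ?_
    change inner ℂ (ρ i (star a) (x i)) (y i) = inner ℂ (x i) (ρ i a (y i))
    rw [map_star, ContinuousLinearMap.star_eq_adjoint, ContinuousLinearMap.adjoint_inner_left]

lemma ckDS_apply {ι : Type*} {E : ι → Type*} [∀ i, NormedAddCommGroup (E i)]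
    [∀ i, InnerProductSpace ℂ (E i)] [∀ i, CompleteSpace (E i)]
    (ρ : ∀ i, A →⋆ₙₐ[ℂ] (E i →L[ℂ] E i)) (a : A) (f : lp E 2) (i : ι) :
    ckDS ρ a f i = ρ i a (f i) := rfl

lemma ckDS_inj {ι : Type*} {E : ι → Type*} [∀ i, NormedAddCommGroup (E i)]
    [∀ i, InnerProductSpace ℂ (E i)] [∀ i, CompleteSpace (E i)]
    (ρ : ∀ i, A →⋆ₙₐ[ℂ] (E i →L[ℂ] E i)) (h : ∀ a, (∀ i, ρ i a = 0) → a = 0) :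
    Function.Injective (ckDS ρ) := by
  classical
  rw [injective_iff_map_eq_zero]
  intro a ha
  refine h a fun i => ?_
  ext x
  have := ckDS_apply ρ a (lp.single 2 i x) i
  rw [ha, lp.single_apply_self] at this
  exact this.symm

lemma ckPosF [PartialOrder A] [StarOrderedRing A] (b : A) (hb : 0 ≤ b) (hb0 : b ≠ 0) :
    ∃ f : A →ₚ[ℂ] ℂ, f b ≠ 0 := by
  have h1 : -b ∉ {x : A | 0 ≤ x} := by
    intro h
    have h' : 0 ≤ -b := h
    exact hb0 (le_antisymm (neg_nonneg.1 h') hb)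
  have hcone : ∀ (t : ℝ) (x : A), 0 ≤ t → 0 ≤ x → 0 ≤ t • x := fun t x ht hx => smul_nonneg ht hx
  have h2 : Convex ℝ {x : A | 0 ≤ x} := by
    intro x hx y hy s t hs ht _
    exact add_nonneg (hcone s x hs hx) (hcone t y ht hy)
  obtain ⟨F, u, hu1, hu2⟩ := RCLike.geometric_hahn_banach_point_closed (𝕜 := ℂ) h2
    CStarAlgebra.isClosed_nonneg h1
  have hu0 : u < 0 := by
    have := hu2 0 (by simp)
    simpa using this
  have hF : ∀ x : A, 0 ≤ x → 0 ≤ (F x).re := by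
    intro x hx
    by_contra! hneg
    have h3 := hu2 ((u / (F x).re) • x) (hcone _ _ (by
      rw [← neg_div_neg_eq]; apply div_nonneg <;> linarith) hx)
    have h4 : F ((u / (F x).re) • x) = ((u / (F x).re : ℝ) : ℂ) * F x := by
      rw [← Complex.coe_smul, map_smul, smul_eq_mul]
    rw [h4] at h3
    have h5 : RCLike.re (((u / (F x).re : ℝ) : ℂ) * F x) = u / (F x).re * (F x).re := by
      simp
    rw [h5, div_mul_cancel₀ _ hneg.ne] at h3
    exact lt_irrefl _ h3
  let g : A →ₗ[ℂ] ℂ :=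
    { toFun := fun a => F a + star (F (star a))
      map_add' := fun a b => by simp only [star_add, map_add]; ring
      map_smul' := fun m a => by
        simp only [star_smul, map_smul, smul_eq_mul, star_mul', star_star, RingHom.id_apply]; ring }
  have hg : ∀ x : A, 0 ≤ x → g x = ((2 * (F x).re : ℝ) : ℂ) := by
    intro x hx
    change F x + star (F (star x)) = _
    rw [(IsSelfAdjoint.of_nonneg hx).star_eq]
    exact Complex.add_conj _
  refine ⟨PositiveLinearMap.mk₀ g fun x hx => ?_, ?_⟩
  · rw [hg x hx]
    exact_mod_cast mul_nonneg (by norm_num) (hF x hx)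
  · change g b ≠ 0
    rw [hg b hb]
    have : RCLike.re (F (-b)) = -(F b).re := by simp
    rw [this] at hu1
    norm_cast
    intro h
    linarith

lemma ckGNSzero [PartialOrder A] [StarOrderedRing A] (a : A)
    (h : ∀ f : A →ₚ[ℂ] ℂ, f.gnsNonUnitalStarAlgHom a = 0) : a = 0 := by
  by_contra ha
  have h1 : star a * a ≠ 0 := by rwa [Ne, CStarRing.star_mul_self_eq_zero_iff]
  have h2 : star (a * star a) * (a * star a) ≠ 0 := by
    rw [Ne, CStarRing.star_mul_self_eq_zero_iff, CStarRing.mul_star_self_eq_zero_iff]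
    exact ha
  obtain ⟨f, hf⟩ := ckPosF _ (star_mul_self_nonneg (a * star a)) h2
  apply hf
  have h3 : f.gnsNonUnitalStarAlgHom a ((f.toPreGNS (star a) : f.PreGNS) : f.GNS) = 0 := by
    rw [h f]; rfl
  rw [PositiveLinearMap.gnsNonUnitalStarAlgHom_apply_coe] at h3
  have h4 := congrArg norm h3
  rw [UniformSpace.Completion.norm_coe, norm_zero] at h4
  have h5 := f.preGNS_norm_sq (f.leftMulMapPreGNS a (f.toPreGNS (star a)))
  rw [h4] at h5
  simp only [PositiveLinearMap.leftMulMapPreGNS_apply, PositiveLinearMap.ofPreGNS_toPreGNS] at h5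
  rw [← h5]
  simp

end rep

lemma ckRep (A : Type) [NonUnitalCStarAlgebra A] :
    ∃ (K : Type) (_ : NormedAddCommGroup K) (_ : InnerProductSpace ℂ K) (_ : CompleteSpace K)
      (ρ : A →⋆ₙₐ[ℂ] (K →L[ℂ] K)), Function.Injective ρ := by
  letI := CStarAlgebra.spectralOrder A
  haveI := CStarAlgebra.spectralOrderedRing A
  exact ⟨lp (fun f : A →ₚ[ℂ] ℂ => f.GNS) 2, inferInstance, inferInstance, inferInstance,
    ckDS fun f => f.gnsNonUnitalStarAlgHom, ckDS_inj _ ckGNSzero⟩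

lemma ckRep2 (A : Type) [NonUnitalCStarAlgebra A] :
    ∃ (K : Type) (_ : NormedAddCommGroup K) (_ : InnerProductSpace ℂ K) (_ : CompleteSpace K)
      (ρ : A →⋆ₙₐ[ℂ] (K →L[ℂ] K)) (c d : ℕ → K →L[ℂ] K), Function.Injective ρ ∧
      (∀ j, ckCz (c j) (d j)) ∧
      (∀ i j, i ≠ j → ∀ x ∈ ckP c d i, ∀ y ∈ ckP c d j, Commute x y) ∧
      (∀ a, ∀ j, ∀ x ∈ ckP c d j, Commute x (ρ a)) := by
  obtain ⟨K, i1, i2, i3, ρ, hρ⟩ := ckRep A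
  refine ⟨lp (fun _ : ℕ → ℕ => K) 2, inferInstance, inferInstance, inferInstance,
    ckDS fun _ => ρ, ckCc K 0 (by norm_num), ckCc K 1 (by norm_num), ?_, ckCz_std, ckP_std_comm, ?_⟩
  · exact ckDS_inj _ fun a h => (injective_iff_map_eq_zero ρ).1 hρ a (h fun _ => 0)
  · have key : ∀ (p : (ℕ → ℕ) ≃. (ℕ → ℕ)) (a : A),
        Commute (ckO p) (ckDS (fun _ : ℕ → ℕ => ρ) a) := by
      intro p a
      change _ * _ = _ * _
      ext f x
      change (p x).elim 0 (fun y => ρ a (f y)) = ρ a ((p x).elim 0 f)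
      cases p x
      · exact (map_zero _).symm
      · rfl
    rintro a j x (rfl | rfl | rfl | rfl)
    · exact key _ _
    · rw [ckCc, ckO_star]; exact key _ _
    · exact key _ _
    · rw [ckCc, ckO_star]; exact key _ _

end rep0
end part12

section part13
open Filter Topology

section rec
variable {H : Type*} [NormedAddCommGroup H] [InnerProductSpace ℂ H] [CompleteSpace H]
variable {K : Type*} [NormedAddCommGroup K] [InnerProductSpace ℂ K] [CompleteSpace K]

lemma ckRecStep [Nontrivial H] [TopologicalSpace.SeparableSpace H]
    (hH : ¬ FiniteDimensional ℂ H) [Nontrivial K]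
    {Q : Type*} [CStarAlgebra Q] {π : (H →L[ℂ] H) →⋆ₐ[ℂ] Q}
    (hsurj : Function.Surjective π)
    (hker : ∀ T : H →L[ℂ] H, π T = 0 ↔ IsCompactOperator T)
    {c d : ℕ → K →L[ℂ] K} (hz : ∀ j, ckCz (c j) (d j))
    (hT : ∀ i j, i ≠ j → ∀ x ∈ ckP c d i, ∀ y ∈ ckP c d j, Commute x y)
    {I : Type*} [LinearOrder I] (S : I → Set (K →L[ℂ] K)) (hSm : Monotone S)
    (hSc : ∀ i, (S i).Countable) (hSs : ∀ i, ∀ a ∈ S i, star a ∈ S i)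
    (hST : ∀ i, ∀ a ∈ S i, ∀ j, ∀ x ∈ ckP c d j, Commute x a)
    (i : I) (hI : (Set.Iio i).Countable) (W : I → H →L[ℂ] K)
    (hW : ∀ k < i, ckGood (S k ∪ ckTT c d) (W k))
    (hWc : ∀ k < i, ∀ l < k, ∀ a ∈ S l ∪ ckTT c d, π (ckC (W k) a) = π (ckC (W l) a)) :
    ∃ V : H →L[ℂ] K, ckGood (S i ∪ ckTT c d) V ∧
      ∀ k < i, ∀ a ∈ S k ∪ ckTT c d, π (ckC V a) = π (ckC (W k) a) := by
  obtain ⟨W', hW'⟩ : ∃ W' : H →L[ℂ] K, ckGood (S i ∪ ckTT c d) W' := by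
    refine ckExist hH ((hSc i).union (ckTT_count c d)) ?_ (c := c 0) (d := d 0)
      (Or.inr ⟨0, Or.inl rfl⟩) (Or.inr ⟨0, Or.inr (Or.inr (Or.inl rfl))⟩) (hz 0)
    rintro a (ha | ⟨j, ha⟩)
    · exact Or.inl (hSs i a ha)
    · exact Or.inr ⟨j, ckP_star ha⟩
  rcases (Set.Iio i).eq_empty_or_nonempty with he | hne
  · refine ⟨W', hW', fun k hk => ?_⟩
    exact absurd (show k ∈ Set.Iio i from hk) (by rw [he]; simp)
  obtain ⟨f, hf⟩ := hI.exists_eq_range hne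
  have hg : ∀ n, partialSups f n < i := by
    intro n
    obtain ⟨m, _, hm⟩ := exists_partialSups_eq f n
    rw [hm]
    have : f m ∈ Set.Iio i := by rw [hf]; exact ⟨m, rfl⟩
    exact this
  have coh : ∀ k l, k < i → l ≤ k → ∀ a ∈ S l ∪ ckTT c d, π (ckC (W k) a) = π (ckC (W l) a) := by
    intro k l hk hl a ha
    rcases hl.eq_or_lt with rfl | hl
    · rfl
    · exact hWc k hk l hl a ha
  obtain ⟨V, hV, hV'⟩ := ckStep hsurj hker hz hT (hST i) (fun n => S (partialSups f n))
    (fun m n h => hSm ((partialSups f).monotone h)) (fun n => hSc _) (fun n => hSs _)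
    (fun n => hSm (hg n).le) (fun n => W (partialSups f n)) (fun n => hW _ (hg n))
    (fun n => coh _ _ (hg _) ((partialSups f).monotone (Nat.le_succ n))) hW'
  refine ⟨V, hV, fun k hk a ha => ?_⟩
  have : k ∈ Set.Iio i := hk
  rw [hf] at this
  obtain ⟨n, rfl⟩ := this
  have hle : f n ≤ partialSups f n := le_partialSups f n
  rw [hV' n a (Set.union_subset_union_left _ (hSm hle) ha)]
  exact coh _ _ (hg n) hle a ha

lemma ckRec [Nontrivial H] [TopologicalSpace.SeparableSpace H]
    (hH : ¬ FiniteDimensional ℂ H) [Nontrivial K]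
    {Q : Type*} [CStarAlgebra Q] {π : (H →L[ℂ] H) →⋆ₐ[ℂ] Q}
    (hsurj : Function.Surjective π)
    (hker : ∀ T : H →L[ℂ] H, π T = 0 ↔ IsCompactOperator T)
    {c d : ℕ → K →L[ℂ] K} (hz : ∀ j, ckCz (c j) (d j))
    (hT : ∀ i j, i ≠ j → ∀ x ∈ ckP c d i, ∀ y ∈ ckP c d j, Commute x y)
    {I : Type*} [LinearOrder I] [WellFoundedLT I] (S : I → Set (K →L[ℂ] K)) (hSm : Monotone S)
    (hSc : ∀ i, (S i).Countable) (hSs : ∀ i, ∀ a ∈ S i, star a ∈ S i)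
    (hST : ∀ i, ∀ a ∈ S i, ∀ j, ∀ x ∈ ckP c d j, Commute x a)
    (hI : ∀ i : I, (Set.Iio i).Countable) :
    ∃ W : I → H →L[ℂ] K, ∀ i, ckGood (S i ∪ ckTT c d) (W i) ∧
      ∀ k < i, ∀ a ∈ S k ∪ ckTT c d, π (ckC (W i) a) = π (ckC (W k) a) := by
  classical
  let P : ∀ i : I, (∀ k, k < i → H →L[ℂ] K) → (H →L[ℂ] K) → Prop := fun i prev V =>
    ckGood (S i ∪ ckTT c d) V ∧ ∀ k (hk : k < i), ∀ a ∈ S k ∪ ckTT c d,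
      π (ckC V a) = π (ckC (prev k hk) a)
  let W : I → H →L[ℂ] K := (wellFounded_lt (α := I)).fix fun i prev =>
    if h : ∃ V, P i prev V then h.choose else 0
  have hWeq : ∀ i, W i = if h : ∃ V, P i (fun k _ => W k) V then h.choose else 0 := fun i =>
    WellFounded.fix_eq _ _ i
  refine ⟨W, fun i => ?_⟩
  induction i using (wellFounded_lt (α := I)).induction with
  | _ i ih =>
    have hex : ∃ V, P i (fun k _ => W k) V :=
      ckRecStep hH hsurj hker hz hT S hSm hSc hSs hST i (hI i) W (fun k hk => (ih k hk).1)
        (fun k hk => (ih k hk).2)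
    have h1 := hWeq i
    rw [dif_pos hex] at h1
    have h2 := hex.choose_spec
    rw [← h1] at h2
    exact h2

lemma ckNoCpt {T C D : H →L[ℂ] H} (hT : IsCompactOperator T) (hz : ckCz C D)
    (hC : Commute C T) (hD : Commute D T) : T = 0 := by
  ext y
  change T y = 0
  by_contra hv
  have hfam : ∀ k l (x z : H), inner ℂ ((D ^ k * C) x) ((D ^ l * C) z) =
      if k = l then inner ℂ x z else 0 := by
    intro k l x z
    rw [← ckInnStar, hz.fam]
    split_ifs <;> simp
  have hn : ∀ k (x : H), ‖(D ^ k * C) x‖ = ‖x‖ := by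
    intro k x
    rw [@norm_eq_sqrt_re_inner ℂ, hfam, if_pos rfl, ← @norm_eq_sqrt_re_inner ℂ]
  have hcm : ∀ k, T ((D ^ k * C) y) = (D ^ k * C) (T y) := by
    intro k
    have : Commute (D ^ k * C) T := (hD.pow_left k).mul_left hC
    exact (congrArg (fun A : H →L[ℂ] H => A y) this.eq).symm
  have hK := hT.isCompact_closure_image_closedBall ‖y‖
  obtain ⟨z, _, φ, hφ, hlim⟩ := hK.tendsto_subseq (x := fun k => T ((D ^ k * C) y)) fun k =>
    subset_closure ⟨_, by rw [mem_closedBall_zero_iff, hn], rfl⟩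
  have hc := hlim.cauchySeq
  obtain ⟨N, hN⟩ := Metric.cauchySeq_iff'.1 hc ‖T y‖ (norm_pos_iff.2 hv)
  have h1 := hN (N + 1) (Nat.le_succ N)
  simp only [Function.comp, hcm] at h1
  rw [dist_eq_norm] at h1
  have hne : φ (N + 1) ≠ φ N := (hφ (Nat.lt_succ_self N)).ne'
  have h2 := @norm_sub_sq ℂ _ _ _ _ ((D ^ φ (N + 1) * C) (T y)) ((D ^ φ N * C) (T y))
  rw [hfam, if_neg hne, hn, hn] at h2
  simp only [map_zero, mul_zero, sub_zero] at h2
  have h3 : 0 < ‖T y‖ := norm_pos_iff.2 hv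
  nlinarith [norm_nonneg ((D ^ φ (N + 1) * C) (T y) - (D ^ φ N * C) (T y))]

lemma ckGood.faithful {S : Set (K →L[ℂ] K)} {W : H →L[ℂ] K} (h : ckGood S W)
    (hS : ∀ a ∈ S, star a ∈ S) {a c d : K →L[ℂ] K} (ha : a ∈ S) (hc : c ∈ S) (hd : d ∈ S)
    (hz : ckCz c d) (hca : Commute c a) (hda : Commute d a)
    (hcpt : IsCompactOperator (ckC W a)) : a = 0 := by
  have s : ∀ a ∈ S, a ∈ Submonoid.closure S := fun a ha => Submonoid.subset_closure ha
  have cm : ∀ x ∈ S, Commute x a → Commute (ckC W x) (ckC W a) := by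
    intro x hx hxa
    change _ * _ = _ * _
    rw [← h.mul (s _ hx), ← h.mul (s _ ha), hxa.eq]
  have hT := ckNoCpt hcpt (h.cz hS hc hd hz) (cm c hc hca) (cm d hd hda)
  have key : ∀ x : K, ‖x‖ = 1 → a x = 0 := by
    intro x hx
    by_contra hv
    have hp : 0 < ‖a x‖ := norm_pos_iff.2 hv
    have ho : Orthonormal ℂ (fun _ : Fin 1 => x) :=
      ⟨fun _ => hx, fun i j hij => absurd (Subsingleton.elim i j) hij⟩
    obtain ⟨y, _, hy⟩ := h.abs 1 _ ho {star a * a} (by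
      simp only [Finset.coe_singleton, Set.singleton_subset_iff]
      exact mul_mem (s _ (hS _ ha)) (s _ ha)) (‖a x‖ ^ 2 / 2) (by positivity)
    have h1 := hy _ (Finset.mem_singleton_self _) 0 0
    rw [h.mul (s _ (hS _ ha)), hT, mul_zero, ckInnStar, inner_self_eq_norm_sq_to_K] at h1
    simp at h1
    nlinarith
  ext x
  change a x = 0
  by_cases hx : x = 0
  · rw [hx, map_zero]
  · have := key ((‖x‖⁻¹ : ℂ) • x) (by
      rw [norm_smul, norm_inv, Complex.norm_real, norm_norm, inv_mul_cancel₀ (norm_ne_zero_iff.2 hx)])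
    rw [map_smul, smul_eq_zero] at this
    rcases this with h0 | h0
    · simp [hx] at h0
    · exact h0
end rec

lemma ckHom {H : Type*} [NormedAddCommGroup H] [InnerProductSpace ℂ H] [CompleteSpace H]
    [TopologicalSpace.SeparableSpace H]
    (hH : ¬ FiniteDimensional ℂ H)
    {Q : Type*} [CStarAlgebra Q] {π : (H →L[ℂ] H) →⋆ₐ[ℂ] Q}
    (hsurj : Function.Surjective π)
    (hker : ∀ T : H →L[ℂ] H, π T = 0 ↔ IsCompactOperator T)
    {I : Type*} [LinearOrder I] [WellFoundedLT I] (hI : ∀ i : I, (Set.Iio i).Countable)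
    (A : Type) [NonUnitalCStarAlgebra A] (e : I → A) (he : Function.Surjective e) :
    ∃ φ : A →⋆ₙₐ[ℂ] Q, Function.Injective φ := by
  haveI : Nontrivial H := by
    by_contra hn
    rw [not_nontrivial_iff_subsingleton] at hn
    exact hH inferInstance
  rcases subsingleton_or_nontrivial A with hA | hA
  · exact ⟨0, fun x y _ => Subsingleton.elim _ _⟩
  obtain ⟨K, _, _, _, ρ, c, d, hρ, hz, hT, hcom⟩ := ckRep2 A
  haveI : Nontrivial K := by
    by_contra hn
    rw [not_nontrivial_iff_subsingleton] at hn
    obtain ⟨x, y, hxy⟩ := hA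
    exact hxy (hρ (by ext v; exact Subsingleton.elim _ _))
  let S : I → Set (K →L[ℂ] K) := fun i => {x | ∃ k ≤ i, x = ρ (e k) ∨ x = star (ρ (e k))}
  have hSm : Monotone S := fun i j hij x ⟨k, hk, hx⟩ => ⟨k, hk.trans hij, hx⟩
  have hSc : ∀ i, (S i).Countable := by
    intro i
    have h1 : (Set.Iic i).Countable := by
      rw [← Set.Iio_insert]; exact (hI i).insert i
    refine ((h1.image fun k => ρ (e k)).union (h1.image fun k => star (ρ (e k)))).mono ?_
    rintro x ⟨k, hk, rfl | rfl⟩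
    · exact Or.inl ⟨k, hk, rfl⟩
    · exact Or.inr ⟨k, hk, rfl⟩
  have hSs : ∀ i, ∀ a ∈ S i, star a ∈ S i := by
    rintro i x ⟨k, hk, rfl | rfl⟩
    · exact ⟨k, hk, Or.inr rfl⟩
    · exact ⟨k, hk, Or.inl (star_star _)⟩
  have hST : ∀ i, ∀ a ∈ S i, ∀ j, ∀ x ∈ ckP c d j, Commute x a := by
    rintro i a ⟨k, hk, rfl | rfl⟩ j x hx
    · exact hcom _ j x hx
    · rw [← map_star]; exact hcom _ j x hx
  obtain ⟨W, hW⟩ := ckRec hH hsurj hker hz hT S hSm hSc hSs hST hI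
  let r : A → I := Function.surjInv he
  have hr : ∀ a i, r a ≤ i → ρ a ∈ S i := fun a i hi =>
    ⟨r a, hi, Or.inl (by rw [Function.surjInv_eq he])⟩
  let Φ : A → Q := fun a => π (ckC (W (r a)) (ρ a))
  have hΦ : ∀ a i, r a ≤ i → Φ a = π (ckC (W i) (ρ a)) := by
    intro a i hi
    rcases hi.eq_or_lt with h | h
    · rw [← h]
    · exact ((hW i).2 (r a) h _ (Or.inl (hr a _ le_rfl))).symm
  let φ : A →⋆ₙₐ[ℂ] Q :=
    { toFun := Φ
      map_smul' := fun m a => by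
        rw [hΦ a _ (le_max_left (r a) (r (m • a))), hΦ (m • a) _ (le_max_right (r a) (r (m • a))),
          map_smul, ckC_smul, map_smul]; rfl
      map_zero' := by
        change π _ = 0
        rw [map_zero, ckC_zero, map_zero]
      map_add' := fun a b => by
        set i := max (r a) (max (r b) (r (a + b))) with hi
        rw [hΦ a i (by simp [hi]), hΦ b i (by simp [hi]), hΦ (a + b) i (by simp [hi]),
          map_add, ckC_add, map_add]
      map_mul' := fun a b => by
        set i := max (r a) (max (r b) (r (a * b))) with hi
        rw [hΦ a i (by simp [hi]), hΦ b i (by simp [hi]), hΦ (a * b) i (by simp [hi]),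
          map_mul, (hW i).1.mul (Submonoid.subset_closure (Or.inl (hr a i (by simp [hi])))),
          map_mul]
      map_star' := fun a => by
        rw [hΦ a _ (le_max_left (r a) (r (star a))),
          hΦ (star a) _ (le_max_right (r a) (r (star a))), map_star, ckC_star, map_star] }
  refine ⟨φ, (injective_iff_map_eq_zero φ).2 fun a ha => ?_⟩
  have ha' : π (ckC (W (r a)) (ρ a)) = 0 := ha
  rw [hker] at ha'
  apply (injective_iff_map_eq_zero ρ).1 hρ
  have hc0 : c 0 ∈ ckP c d 0 := Or.inl rfl
  have hd0 : d 0 ∈ ckP c d 0 := Or.inr (Or.inr (Or.inl rfl))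
  refine (hW (r a)).1.faithful ?_ (Or.inl (hr a _ le_rfl)) (Or.inr ⟨0, hc0⟩) (Or.inr ⟨0, hd0⟩)
    (hz 0) (hcom a 0 _ hc0) (hcom a 0 _ hd0) ha'
  rintro a (ha | ⟨j, ha⟩)
  · exact Or.inl (hSs _ a ha)
  · exact Or.inr ⟨j, ckP_star ha⟩
end part13

lemma ckCardDense {X : Type} [MetricSpace X] (s : Set X) (hs : Dense s)
    (h : #s ≤ (2 : Cardinal) ^ Cardinal.aleph0) : #X ≤ (2 : Cardinal) ^ Cardinal.aleph0 := by
  have h1 : ∀ x : X, ∃ f : ℕ → s, Filter.Tendsto (fun n => (f n : X)) Filter.atTop (nhds x) := by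
    intro x
    obtain ⟨f, hf, hf'⟩ := mem_closure_iff_seq_limit.1 (hs x)
    exact ⟨fun n => ⟨f n, hf n⟩, hf'⟩
  choose F hF using h1
  have hinj : Function.Injective F := by
    intro x y hxy
    have := hF x
    rw [hxy] at this
    exact tendsto_nhds_unique this (hF y)
  calc #X ≤ #(ℕ → s) := mk_le_of_injective hinj
    _ = #s ^ Cardinal.aleph0 := by simp
    _ ≤ ((2 : Cardinal) ^ Cardinal.aleph0) ^ Cardinal.aleph0 := Cardinal.power_le_power_right h
    _ = 2 ^ Cardinal.aleph0 := by rw [← Cardinal.power_mul, Cardinal.aleph0_mul_aleph0]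

lemma ckDensAtt (X : Type) [TopologicalSpace X] : ∃ s : Set X, Dense s ∧ #s = densityCharacter X :=
  csInf_mem (s := {c : Cardinal | ∃ s : Set X, Dense s ∧ #s = c}) ⟨_, Set.univ, dense_univ, rfl⟩

lemma ckDensLe (X : Type) [TopologicalSpace X] (s : Set X) (hs : Dense s) :
    densityCharacter X ≤ #s := csInf_le' ⟨s, hs, rfl⟩

lemma ckCH0.{u} (CH : (2 : Cardinal.{u}) ^ Cardinal.aleph0 = Cardinal.aleph 1) :
    (2 : Cardinal.{0}) ^ Cardinal.aleph0.{0} = Cardinal.aleph 1 := by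
  apply Cardinal.lift_injective.{u, 0}
  simpa using CH

lemma ckUniv (CH : (2 : Cardinal.{0}) ^ Cardinal.aleph0.{0} = Cardinal.aleph 1)
    (H : Type) [NormedAddCommGroup H] [InnerProductSpace ℂ H] [CompleteSpace H]
    [TopologicalSpace.SeparableSpace H] (hH : ¬ FiniteDimensional ℂ H)
    (Q : Type) [CStarAlgebra Q] (π : (H →L[ℂ] H) →⋆ₐ[ℂ] Q)
    (hsurj : Function.Surjective π)
    (hker : ∀ T : H →L[ℂ] H, π T = 0 ↔ IsCompactOperator T)
    (A : Type) [NonUnitalCStarAlgebra A] (hA : densityCharacter A ≤ (2 : Cardinal) ^ Cardinal.aleph0) :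
    ∃ φ : A →⋆ₙₐ[ℂ] Q, Function.Injective φ := by
  obtain ⟨s, hs, hs'⟩ := ckDensAtt A
  have hc : #A ≤ Cardinal.aleph 1 := by
    rw [← CH]
    exact ckCardDense s hs (hs'.trans_le hA)
  let I : Type := (Cardinal.aleph.{0} 1).ord.ToType
  have hI0 : #I = Cardinal.aleph 1 := Cardinal.mk_ord_toType _
  have hI : ∀ i : I, (Set.Iio i).Countable := by
    intro i
    have h1 : #(Set.Iio i) < #I := Cardinal.mk_Iio_lt i (by simp [I])
    have h2 : #(Set.Iio i) < Order.succ Cardinal.aleph0 := by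
      rw [Cardinal.succ_aleph0]
      exact h1.trans_eq hI0
    exact Cardinal.mk_le_aleph0_iff.1 (Order.lt_succ_iff.1 h2)
  rw [← hI0] at hc
  obtain ⟨g⟩ := hc
  exact ckHom hH hsurj hker hI A (Function.invFun g) (Function.invFun_surjective g.injective)

lemma ckCardQ (H : Type) [NormedAddCommGroup H] [InnerProductSpace ℂ H] [CompleteSpace H]
    [TopologicalSpace.SeparableSpace H] (Q : Type) [CStarAlgebra Q] (π : (H →L[ℂ] H) →⋆ₐ[ℂ] Q)
    (hsurj : Function.Surjective π) : #Q ≤ (2 : Cardinal) ^ Cardinal.aleph0 := by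
  have h1 : #H ≤ (2 : Cardinal) ^ Cardinal.aleph0 := by
    obtain ⟨s, hc, hs⟩ := TopologicalSpace.exists_countable_dense H
    exact ckCardDense s hs ((Cardinal.mk_le_aleph0_iff.2 hc).trans (Cardinal.cantor _).le)
  have hinj : Function.Injective
      (fun T : H →L[ℂ] H => fun n : ℕ => T (TopologicalSpace.denseSeq H n)) := by
    intro T T' h
    have : (T : H → H) = T' := by
      refine (TopologicalSpace.denseRange_denseSeq H).equalizer T.continuous T'.continuous h
    exact DFunLike.coe_injective this
  calc #Q ≤ #(H →L[ℂ] H) := mk_le_of_surjective hsurj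
    _ ≤ #(ℕ → H) := mk_le_of_injective hinj
    _ = #H ^ Cardinal.aleph0 := by simp
    _ ≤ ((2 : Cardinal) ^ Cardinal.aleph0) ^ Cardinal.aleph0 := Cardinal.power_le_power_right h1
    _ = 2 ^ Cardinal.aleph0 := by rw [← Cardinal.power_mul, Cardinal.aleph0_mul_aleph0]

open scoped BoundedContinuousFunction in
noncomputable def ckInd (U : Set ℕ) : ℕ →ᵇ ℂ :=
  BoundedContinuousFunction.ofNormedAddCommGroupDiscrete (U.indicator fun _ => (1 : ℂ)) 1 (by
    intro n
    by_cases h : n ∈ U <;> simp [h])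

lemma ckInd_dist (U V : Set ℕ) (h : U ≠ V) : 1 ≤ dist (ckInd U) (ckInd V) := by
  obtain ⟨n, hn⟩ : ∃ n, ¬ (n ∈ U ↔ n ∈ V) := by
    by_contra! hc
    exact h (Set.ext hc)
  refine le_trans ?_ (BoundedContinuousFunction.dist_coe_le_dist n)
  change 1 ≤ dist (U.indicator (fun _ => (1 : ℂ)) n) (V.indicator (fun _ => (1 : ℂ)) n)
  by_cases h1 : n ∈ U <;> by_cases h2 : n ∈ V <;> simp_all

open scoped BoundedContinuousFunction in
lemma ckDensB : densityCharacter (ℕ →ᵇ ℂ) ≤ (2 : Cardinal) ^ Cardinal.aleph0 := by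
  refine (ckDensLe _ _ dense_univ).trans ?_
  calc #(Set.univ : Set (ℕ →ᵇ ℂ)) = #(ℕ →ᵇ ℂ) := mk_univ
    _ ≤ #(ℕ → ℂ) := mk_le_of_injective (f := fun g => (g : ℕ → ℂ)) DFunLike.coe_injective
    _ = #ℂ ^ Cardinal.aleph0 := by simp
    _ = ((2 : Cardinal) ^ Cardinal.aleph0) ^ Cardinal.aleph0 := by
      rw [Cardinal.mk_complex, ← Cardinal.two_power_aleph0]
    _ = 2 ^ Cardinal.aleph0 := by rw [← Cardinal.power_mul, Cardinal.aleph0_mul_aleph0]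

open scoped BoundedContinuousFunction in
lemma ckDensGe (Q : Type) [CStarAlgebra Q] (φ : (ℕ →ᵇ ℂ) →⋆ₙₐ[ℂ] Q) (hφ : Function.Injective φ) :
    (2 : Cardinal) ^ Cardinal.aleph0 ≤ densityCharacter Q := by
  obtain ⟨s, hs, hs'⟩ := ckDensAtt Q
  rw [← hs']
  have h1 : ∀ U : Set ℕ, ∃ q : s, dist (φ (ckInd U)) q < 1 / 2 := by
    intro U
    obtain ⟨q, hq, hq'⟩ := hs.exists_dist_lt (φ (ckInd U)) (by norm_num : (0 : ℝ) < 1 / 2)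
    exact ⟨⟨q, hq⟩, hq'⟩
  choose F hF using h1
  have hinj : Function.Injective F := by
    intro U V hUV
    by_contra hne
    have h2 := ckInd_dist U V hne
    rw [← (NonUnitalStarAlgHom.isometry φ hφ).dist_eq] at h2
    have h3 := hF U
    rw [hUV] at h3
    have := dist_triangle_right (φ (ckInd U)) (φ (ckInd V)) (F V)
    linarith [hF V]
  calc (2 : Cardinal) ^ Cardinal.aleph0 = #(Set ℕ) := by simp
    _ ≤ #s := mk_le_of_injective hinj


/-- Assuming the Continuum Hypothesis `2^ℵ₀ = ℵ₁`, the Calkin algebra is a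
`2^ℵ₀`-universal C*-algebra.  Here `Q` plays the role of the Calkin algebra
`Q(H) = B(H)/K(H)`: it is a C*-algebra equipped with a surjective unital
*-homomorphism `π : B(H) → Q` whose kernel is exactly the ideal of compact operators. -/
theorem calkin_continuum_universal_of_CH
    (CH : (2 : Cardinal) ^ Cardinal.aleph0 = Cardinal.aleph 1)
    (H : Type) [NormedAddCommGroup H] [InnerProductSpace ℂ H] [CompleteSpace H]
    [TopologicalSpace.SeparableSpace H] (hH : ¬ FiniteDimensional ℂ H)
    (Q : Type) [CStarAlgebra Q] (π : (H →L[ℂ] H) →⋆ₐ[ℂ] Q)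
    (hsurj : Function.Surjective π)
    (hker : ∀ T : H →L[ℂ] H, π T = 0 ↔ IsCompactOperator T) :
    densityCharacter Q = (2 : Cardinal) ^ Cardinal.aleph0 ∧
      ∀ (A : Type) (_ : NonUnitalCStarAlgebra A),
        densityCharacter A ≤ (2 : Cardinal) ^ Cardinal.aleph0 →
          ∃ φ : A →⋆ₙₐ[ℂ] Q, Function.Injective φ := by
  have hu := ckUniv (ckCH0 CH) H hH Q π hsurj hker
  refine ⟨le_antisymm ?_ ?_, fun A iA hA => hu A hA⟩
  · refine (ckDensLe Q _ dense_univ).trans ?_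
    rw [mk_univ]
    exact ckCardQ H Q π hsurj
  · obtain ⟨φ, hφ⟩ := hu (BoundedContinuousFunction ℕ ℂ) ckDensB
    exact ckDensGe Q φ hφ
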